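/- Let B be a (k-1)-stacked PL (2k-1)-ball with n vertices such that the number of facets of B equals binom(n-k-1, k-1). Then B is (k-1)-neighborly with respect to its vertex set. -/

import Mathlib

/-- An (abstract) simplicial complex: a family of finite sets closed under subsets. -/
def IsComplex (K : Set (Finset ℕ)) : Prop :=
  ∀ s ∈ K, ∀ t ⊆ s, t ∈ K

/-- The geometric realization of a family of finite subsets of `ℕ`:
convex combinations of vertices supported on a face. -/
def spaceOf (K : Set (Finset ℕ)) : Set (ℕ → ℝ) :=
  {f | (∀ i, 0 ≤ f i) ∧ ∃ s ∈ K, (∀ i, f i ≠ 0 → i ∈ s) ∧ ∑ i ∈ s, f i = 1}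

/-- `K` is a (topological/PL) `d`-ball: its realization is homeomorphic to the
closed unit ball in `ℝ^d`. -/
def IsBall (d : ℕ) (K : Set (Finset ℕ)) : Prop :=
  Nonempty (spaceOf K ≃ₜ (Metric.closedBall (0 : EuclideanSpace ℝ (Fin d)) 1))

/-- `K` is a (topological/PL) `d`-sphere: its realization is homeomorphic to the
unit sphere in `ℝ^{d+1}`. -/
def IsSphere (d : ℕ) (K : Set (Finset ℕ)) : Prop :=
  Nonempty (spaceOf K ≃ₜ (Metric.sphere (0 : EuclideanSpace ℝ (Fin (d + 1))) 1))

/-- The boundary complex of a pure `d`-dimensional ball (facets have `d+1`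
vertices): faces contained in a `d`-element face lying in exactly one facet. -/
def bdry (d : ℕ) (K : Set (Finset ℕ)) : Set (Finset ℕ) :=
  {τ | ∃ ρ ∈ K, τ ⊆ ρ ∧ ρ.card = d ∧ ∃! F, F ∈ K ∧ F.card = d + 1 ∧ ρ ⊆ F}

/-- A `d`-ball `K` is `i`-stacked if all faces of dimension `≤ d - i - 1`
(i.e. with at most `d - i` vertices) lie in the boundary. -/
def IsStacked (i d : ℕ) (K : Set (Finset ℕ)) : Prop :=
  ∀ τ ∈ K, τ.card + i ≤ d → τ ∈ bdry d K

/-- The vertex set of a complex. -/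
def vertexSet (K : Set (Finset ℕ)) : Set ℕ := {v | {v} ∈ K}

/-- `K` is `s`-neighborly w.r.t. `V`: every subset of `V` with at most `s`
elements is a face. -/
def Nbrly (s : ℕ) (V : Set ℕ) (K : Set (Finset ℕ)) : Prop :=
  ∀ τ : Finset ℕ, ↑τ ⊆ V → τ.card ≤ s → τ ∈ K

/-- `fnum K i` is the number of faces of `K` with `i` vertices, i.e. `f_{i-1}`. -/
noncomputable def fnum (K : Set (Finset ℕ)) (i : ℕ) : ℕ :=
  Nat.card {s : Finset ℕ // s ∈ K ∧ s.card = i}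

/-- The `h`-numbers of a `(d-1)`-dimensional complex:
`h_j = ∑_{i=0}^{j} (-1)^{j-i} C(d-i, j-i) f_{i-1}`. -/
noncomputable def hnum (d : ℕ) (K : Set (Finset ℕ)) (j : ℕ) : ℤ :=
  ∑ i ∈ Finset.range (j + 1),
    (-1) ^ (j - i) * (Nat.choose (d - i) (j - i)) * (fnum K i : ℤ)

/-- The join of two complexes on disjoint vertex sets. -/
def joinC (K1 K2 : Set (Finset ℕ)) : Set (Finset ℕ) :=
  {u | ∃ s ∈ K1, ∃ t ∈ K2, u = s ∪ t}

/-- Oriented chains: formal real combinations of finite sets of natural numbers. -/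
abbrev OChain := Finset ℕ →₀ ℝ

/-- The sign of moving `v` into its place in the increasing enumeration of `s`. -/
def placeSign (v : ℕ) (s : Finset ℕ) : ℝ := (-1) ^ (s.filter (· < v)).card

lemma placeSign_insert {v w : ℕ} {s : Finset ℕ} (hw : w ∉ s) :
    placeSign v (insert w s) = if w < v then -placeSign v s else placeSign v s := by
  unfold placeSign
  rw [Finset.filter_insert]
  split_ifs with h
  · rw [Finset.card_insert_of_notMem (by simp [hw]), pow_succ]; ring
  · rfl

lemma placeSign_erase {v w : ℕ} {s : Finset ℕ} (hw : w ∈ s) :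
    placeSign v (s.erase w) = if w < v then -placeSign v s else placeSign v s := by
  have := placeSign_insert (v := v) (Finset.notMem_erase w s)
  rw [Finset.insert_erase hw] at this
  split_ifs with h <;> simp [this, h]

lemma placeSign_mul_self (v : ℕ) (s : Finset ℕ) : placeSign v s * placeSign v s = 1 := by
  unfold placeSign
  rw [← mul_pow]; simp

lemma placeSign_ne_zero (v : ℕ) (s : Finset ℕ) : placeSign v s ≠ 0 := by
  intro h
  have := placeSign_mul_self v s
  simp [h] at this

/-- Left exterior multiplication by the vertex `v`. -/
noncomputable def wedge (v : ℕ) : OChain →ₗ[ℝ] OChain :=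
  Finsupp.linearCombination ℝ
    (fun s => if v ∈ s then 0 else Finsupp.single (insert v s) (placeSign v s))

/-- Contraction with the vertex `v`. -/
noncomputable def del (v : ℕ) : OChain →ₗ[ℝ] OChain :=
  Finsupp.linearCombination ℝ
    (fun s => if v ∈ s then Finsupp.single (s.erase v) (placeSign v s) else 0)

/-- The boundary operator weighted by `u`. -/
noncomputable def bd (u : ℕ → ℝ) : OChain →ₗ[ℝ] OChain :=
  Finsupp.linearCombination ℝ (fun s => ∑ v ∈ s, u v • del v (Finsupp.single s 1))

lemma wedge_single (v : ℕ) (s : Finset ℕ) (c : ℝ) : wedge v (Finsupp.single s c) =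
    if v ∈ s then 0 else Finsupp.single (insert v s) (c * placeSign v s) := by
  unfold wedge
  rw [Finsupp.linearCombination_single]
  split_ifs <;> simp

lemma del_single (v : ℕ) (s : Finset ℕ) (c : ℝ) : del v (Finsupp.single s c) =
    if v ∈ s then Finsupp.single (s.erase v) (c * placeSign v s) else 0 := by
  unfold del
  rw [Finsupp.linearCombination_single]
  split_ifs <;> simp

lemma bd_single {u : ℕ → ℝ} {s V : Finset ℕ} (hV : s ⊆ V) (c : ℝ) :
    bd u (Finsupp.single s c) = ∑ v ∈ V, u v • del v (Finsupp.single s c) := by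
  unfold bd
  rw [Finsupp.linearCombination_single, Finset.smul_sum]
  rw [← Finset.sum_subset hV]
  · refine Finset.sum_congr rfl fun v hv => ?_
    rw [smul_comm, ← map_smul]
    simp
  · intro v _ hv
    simp [del_single, hv]

lemma ochain_hom_ext {f g : OChain →ₗ[ℝ] OChain}
    (h : ∀ s, f (Finsupp.single s 1) = g (Finsupp.single s 1)) (x : OChain) : f x = g x := by
  have : f = g := by
    apply Finsupp.lhom_ext'
    intro s
    ext1
    simpa using h s
  rw [this]

lemma del_del (v w : ℕ) (x : OChain) : del v (del w x) = -del w (del v x) := by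
  refine ochain_hom_ext (f := del v ∘ₗ del w) (g := -(del w ∘ₗ del v)) (fun s => ?_) x
  simp only [LinearMap.comp_apply, LinearMap.neg_apply]
  by_cases hvw : v = w
  · subst hvw
    by_cases hv : v ∈ s <;> simp [hv, del_single]
  · by_cases hv : v ∈ s <;> by_cases hw : w ∈ s
    · rw [del_single w s, if_pos hw, del_single, if_pos (Finset.mem_erase.mpr ⟨hvw, hv⟩),
        del_single v s, if_pos hv, del_single, if_pos (Finset.mem_erase.mpr ⟨Ne.symm hvw, hw⟩),
        ← Finsupp.single_neg,
        placeSign_erase hw, placeSign_erase hv, Finset.erase_right_comm]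
      congr 1
      rcases lt_or_gt_of_ne hvw with h | h
      · rw [if_pos h, if_neg (not_lt_of_gt h)]; ring
      · rw [if_pos h, if_neg (not_lt_of_gt h)]; ring
    all_goals simp [hv, hw, del_single]

lemma del_wedge (v w : ℕ) (x : OChain) :
    del v (wedge w x) = (if v = w then x else 0) - wedge w (del v x) := by
  by_cases hvw : v = w
  · subst hvw
    refine ochain_hom_ext (f := del v ∘ₗ wedge v)
      (g := (if v = v then LinearMap.id else 0) - (wedge v ∘ₗ del v)) (fun s => ?_) x |>.trans ?_
    · simp only [LinearMap.comp_apply, LinearMap.sub_apply, del_single, wedge_single]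
      by_cases hv : v ∈ s
      · simp [hv, wedge_single, placeSign_erase, placeSign_mul_self]
      · simp [hv, del_single, placeSign_insert, placeSign_mul_self]
    · simp
  · refine ochain_hom_ext (f := del v ∘ₗ wedge w)
      (g := - (wedge w ∘ₗ del v)) (fun s => ?_) x |>.trans ?_
    · simp only [LinearMap.comp_apply, LinearMap.neg_apply, del_single, wedge_single]
      by_cases hv : v ∈ s <;> by_cases hw : w ∈ s
      · simp [hv, hw, wedge_single, Ne.symm hvw]
      · rw [if_neg hw, if_pos hv, del_single, if_pos (Finset.mem_insert_of_mem hv), wedge_single,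
          if_neg (by simp [hw]), ← Finsupp.single_neg,
          placeSign_insert hw, placeSign_erase hv, Finset.erase_insert_of_ne (Ne.symm hvw)]
        congr 1
        rcases lt_or_gt_of_ne hvw with h | h
        · rw [if_pos h, if_neg (not_lt_of_gt h)]; ring
        · rw [if_pos h, if_neg (not_lt_of_gt h)]; ring
      · simp [hv, hw]
      · simp [hv, hw, del_single, hvw]
    · simp [hvw]

lemma bd_eq_sum {u : ℕ → ℝ} {V : Finset ℕ} {x : OChain} (hx : ∀ s ∈ x.support, s ⊆ V) :
    bd u x = ∑ v ∈ V, u v • del v x := by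
  have h : x = ∑ s ∈ x.support, Finsupp.single s (x s) := (Finsupp.sum_single x).symm
  rw [h]
  simp only [map_sum, Finset.smul_sum]
  rw [Finset.sum_comm]
  exact Finset.sum_congr rfl fun s hs => bd_single (hx s hs) _

lemma bd_bd (u u' : ℕ → ℝ) (x : OChain) : bd u (bd u' x) = -bd u' (bd u x) := by
  refine ochain_hom_ext (f := bd u ∘ₗ bd u') (g := -(bd u' ∘ₗ bd u)) (fun s => ?_) x
  have key : ∀ u u' : ℕ → ℝ, bd u (bd u' (Finsupp.single s 1)) =
      ∑ v ∈ s, ∑ w ∈ s, (u v * u' w) • del v (del w (Finsupp.single s 1)) := by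
    intro u u'
    rw [bd_single subset_rfl, map_sum, Finset.sum_comm]
    refine Finset.sum_congr rfl fun w hw => ?_
    rw [map_smul, del_single, if_pos hw, bd_single (Finset.erase_subset w s), Finset.smul_sum]
    refine Finset.sum_congr rfl fun v hv => ?_
    rw [smul_smul, mul_comm]
  rw [LinearMap.neg_apply, LinearMap.comp_apply, LinearMap.comp_apply, key, key, Finset.sum_comm,
    ← Finset.sum_neg_distrib]
  refine Finset.sum_congr rfl fun v _ => ?_
  rw [← Finset.sum_neg_distrib]
  refine Finset.sum_congr rfl fun w _ => ?_
  rw [del_del, smul_neg, mul_comm]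

lemma bd_bd_self (u : ℕ → ℝ) (x : OChain) : bd u (bd u x) = 0 := by
  have := bd_bd u u x
  exact self_eq_neg.mp this

lemma bd_wedge (u : ℕ → ℝ) (w : ℕ) (x : OChain) :
    bd u (wedge w x) = u w • x - wedge w (bd u x) := by
  refine ochain_hom_ext (f := bd u ∘ₗ wedge w)
    (g := u w • LinearMap.id - wedge w ∘ₗ bd u) (fun s => ?_) x
  simp only [LinearMap.comp_apply, LinearMap.sub_apply, LinearMap.smul_apply, LinearMap.id_apply]
  have h1 : bd u (wedge w (Finsupp.single s 1)) =
      ∑ v ∈ insert w s, u v • del v (wedge w (Finsupp.single s 1)) := by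
    apply bd_eq_sum
    intro t ht
    rw [wedge_single] at ht
    split_ifs at ht
    · simp at ht
    · have := Finsupp.support_single_subset ht
      simp at this
      rw [this]
  rw [h1, bd_single (Finset.subset_insert w s), map_sum]
  simp only [del_wedge, smul_sub, Finset.sum_sub_distrib, map_smul]
  congr 1
  rw [Finset.sum_eq_single w]
  · simp
  · intro b _ hb; simp [hb]
  · simp

lemma bd_apply {u : ℕ → ℝ} {V : Finset ℕ} {x : OChain} (hx : ∀ s ∈ x.support, s ⊆ V)
    (t : Finset ℕ) :
    bd u x t = ∑ v ∈ V \ t, u v * placeSign v t * x (insert v t) := by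
  have hdel : ∀ v, del v x t = if v ∈ t then 0 else placeSign v t * x (insert v t) := by
    intro v
    have hlin : Finsupp.lapply t ∘ₗ del v =
        (if v ∈ t then 0 else placeSign v t • Finsupp.lapply (insert v t) : OChain →ₗ[ℝ] ℝ) := by
      apply Finsupp.lhom_ext'
      intro s
      ext1
      simp only [LinearMap.comp_apply, Finsupp.lsingle_apply, Finsupp.lapply_apply, del_single]
      by_cases hvt : v ∈ t
      · have : s.erase v ≠ t := by rintro rfl; simp at hvt
        by_cases hvs : v ∈ s <;> simp [hvt, hvs, this]
      · by_cases hvs : v ∈ s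
        · by_cases hst : s = insert v t
          · subst hst
            simp [hvt, placeSign_insert]
          · have : s.erase v ≠ t := by
              rintro rfl; exact hst (Finset.insert_erase hvs).symm
            simp [hvt, hvs, this, hst]
        · have : s ≠ insert v t := by rintro rfl; simp at hvs
          simp [hvt, hvs, this]
    have := LinearMap.congr_fun hlin x
    simp only [LinearMap.comp_apply, Finsupp.lapply_apply] at this
    rw [this]
    split_ifs <;> simp
  rw [bd_eq_sum hx, Finsupp.finsetSum_apply]
  rw [← Finset.sum_subset (Finset.sdiff_subset : V \ t ⊆ V)]
  · refine Finset.sum_congr rfl fun v hv => ?_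
    rw [Finsupp.smul_apply, hdel, if_neg (Finset.mem_sdiff.mp hv).2, smul_eq_mul, mul_assoc]
  · intro v hv hvt
    have : v ∈ t := by simpa [hv] using hvt
    simp [hdel, this]

/-- Chains supported on a family of sets. -/
noncomputable abbrev chains (K : Set (Finset ℕ)) : Submodule ℝ OChain := Finsupp.supported ℝ ℝ K

/-- The members of `K` that do not contain `s`. -/
def antistar (K : Set (Finset ℕ)) (s : Finset ℕ) : Set (Finset ℕ) := {t ∈ K | ¬ s ⊆ t}

/-- The members of `K` with `m` elements. -/
def sized (K : Set (Finset ℕ)) (m : ℕ) : Set (Finset ℕ) := {t ∈ K | t.card = m}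

/-- Vanishing of the reduced homology. -/
def Acyclic (K : Set (Finset ℕ)) : Prop :=
  ∀ z ∈ chains K, bd 1 z = 0 → ∃ w ∈ chains K, bd 1 w = z

lemma chains_mono {K L : Set (Finset ℕ)} (h : K ⊆ L) : chains K ≤ chains L :=
  Finsupp.supported_mono h

lemma sized_mono {K L : Set (Finset ℕ)} (h : K ⊆ L) (m : ℕ) : sized K m ⊆ sized L m :=
  fun _ hs => ⟨h hs.1, hs.2⟩

lemma antistar_subset (K : Set (Finset ℕ)) (s : Finset ℕ) : antistar K s ⊆ K := fun _ hs => hs.1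

lemma antistar_mono {K L : Set (Finset ℕ)} (h : K ⊆ L) (s : Finset ℕ) :
    antistar K s ⊆ antistar L s :=
  fun _ hs => ⟨h hs.1, hs.2⟩

lemma eq_zero_of_mem_chains {K : Set (Finset ℕ)} {x : OChain} (h : x ∈ chains K)
    (h' : ∀ s ∈ K, False) : x = 0 := by
  ext s
  by_contra hs
  exact h' s (h (Finsupp.mem_support_iff.mpr hs))

lemma chains_induction {K : Set (Finset ℕ)} {S : Submodule ℝ OChain} {f : OChain →ₗ[ℝ] OChain}
    (h : ∀ s ∈ K, f (Finsupp.single s 1) ∈ S) {x : OChain} (hx : x ∈ chains K) : f x ∈ S := by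
  have : chains K ≤ S.comap f := by
    rw [chains, Finsupp.supported_eq_span_single, Submodule.span_le]
    rintro _ ⟨s, hs, rfl⟩
    exact h s hs
  exact this hx

lemma bd_mem_chains {A B : Set (Finset ℕ)} (u : ℕ → ℝ) (h : ∀ s ∈ A, ∀ v ∈ s, s.erase v ∈ B)
    {x : OChain} (hx : x ∈ chains A) : bd u x ∈ chains B := by
  refine chains_induction (fun s hs => ?_) hx
  rw [bd_single subset_rfl]
  refine Submodule.sum_mem _ fun v hv => Submodule.smul_mem _ _ ?_
  rw [del_single, if_pos hv]
  exact Finsupp.single_mem_supported ℝ _ (h s hs v hv)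

lemma IsComplex.bd_mem {K : Set (Finset ℕ)} (hK : IsComplex K) (u : ℕ → ℝ) {x : OChain}
    (hx : x ∈ chains K) : bd u x ∈ chains K :=
  bd_mem_chains u (fun s hs v _ => hK s hs _ (Finset.erase_subset v s)) hx

lemma IsComplex.bd_mem_sized {K : Set (Finset ℕ)} (hK : IsComplex K) (u : ℕ → ℝ) {m : ℕ}
    {x : OChain} (hx : x ∈ chains (sized K (m + 1))) : bd u x ∈ chains (sized K m) :=
  bd_mem_chains (A := sized K (m + 1)) (B := sized K m) u
    (fun s hs v hv => ⟨hK s hs.1 _ (Finset.erase_subset v s), by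
      rw [Finset.card_erase_of_mem hv, hs.2]; rfl⟩) hx

lemma IsComplex.isComplex_antistar {K : Set (Finset ℕ)} (hK : IsComplex K) (s : Finset ℕ) :
    IsComplex (antistar K s) :=
  fun t (ht : t ∈ K ∧ ¬ s ⊆ t) r hr => ⟨hK t ht.1 r hr, fun h => ht.2 (h.trans hr)⟩

lemma mem_chains_inter {A B : Set (Finset ℕ)} {x : OChain} (hA : x ∈ chains A)
    (hB : x ∈ chains B) : x ∈ chains (A ∩ B) := by
  rw [chains, Finsupp.mem_supported] at *
  exact Set.subset_inter hA hB

lemma filter_mem_chains {A : Set (Finset ℕ)} {x : OChain} (p : Finset ℕ → Prop) [DecidablePred p]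
    (hA : x ∈ chains A) : x.filter p ∈ chains (A ∩ {s | p s}) := by
  rw [chains, Finsupp.mem_supported] at *
  intro s hs
  simp only [Finsupp.support_filter, Finset.coe_filter, Set.mem_ofPred_eq] at hs
  exact ⟨hA hs.1, hs.2⟩

lemma bd_filter_card (u : ℕ → ℝ) (m : ℕ) (x : OChain) :
    bd u (x.filter (fun s => s.card = m + 1)) = (bd u x).filter (fun s => s.card = m) := by
  induction x using Finsupp.induction_linear with
  | zero => rw [Finsupp.filter_zero, map_zero, Finsupp.filter_zero]
  | add f g hf hg => simp only [map_add, Finsupp.filter_add, hf, hg]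
  | single s c =>
    rw [bd_single subset_rfl]
    rw [show (∑ v ∈ s, u v • del v (Finsupp.single s c)).filter (fun s => s.card = m) =
      ∑ v ∈ s, (u v • del v (Finsupp.single s c)).filter (fun s => s.card = m) from
      map_sum (Finsupp.filterAddHom _) _ _]
    by_cases hs : s.card = m + 1
    · rw [Finsupp.filter_single_of_pos (fun s : Finset ℕ => s.card = m + 1) hs,
        bd_single subset_rfl]
      refine Finset.sum_congr rfl fun v hv => ?_
      rw [del_single, if_pos hv, Finsupp.filter_smul, Finsupp.filter_single_of_pos]
      rw [Finset.card_erase_of_mem hv, hs]; rfl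
    · rw [Finsupp.filter_single_of_neg (fun s : Finset ℕ => s.card = m + 1) hs, map_zero]
      refine (Finset.sum_eq_zero fun v hv => ?_).symm
      rw [del_single, if_pos hv, Finsupp.filter_smul, Finsupp.filter_single_of_neg, smul_zero]
      have := Finset.card_erase_add_one hv
      omega

lemma Acyclic.exists_sized {K : Set (Finset ℕ)} (hK : Acyclic K) {m : ℕ} {z : OChain}
    (hz : z ∈ chains (sized K m)) (h0 : bd 1 z = 0) :
    ∃ w ∈ chains (sized K (m + 1)), bd 1 w = z := by
  obtain ⟨w, hw, rfl⟩ := hK z (chains_mono (fun s hs => hs.1) hz) h0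
  refine ⟨w.filter (fun s => s.card = m + 1), filter_mem_chains _ hw, ?_⟩
  rw [bd_filter_card]
  refine Finsupp.filter_eq_self_iff _ _ |>.mpr fun s hs => ?_
  exact (hz (Finsupp.mem_support_iff.mpr hs)).2

lemma exists_comp_eqOn {V W : Type*} [AddCommGroup V] [Module ℝ V] [AddCommGroup W]
    [Module ℝ W] (M : Submodule ℝ V) {φ : V →ₗ[ℝ] W} {F : V →ₗ[ℝ] ℝ}
    (h : ∀ x ∈ M, φ x = 0 → F x = 0) : ∃ g : W →ₗ[ℝ] ℝ, ∀ x ∈ M, g (φ x) = F x := by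
  have : F.domRestrict M ∈ LinearMap.range (φ.domRestrict M).dualMap := by
    rw [LinearMap.range_dualMap_eq_dualAnnihilator_ker, Submodule.mem_dualAnnihilator]
    exact fun x hx => h x x.2 hx
  obtain ⟨g, hg⟩ := this
  exact ⟨g, fun x hx => LinearMap.congr_fun hg ⟨x, hx⟩⟩

/-- The homological properties of a `(d-1)`-ball `B` with boundary sphere `D` that are needed
for the face count: dimension bounds, and acyclicity of `B` and of antistars of faces of `D`. -/
structure BallPair (d : ℕ) (B D : Set (Finset ℕ)) : Prop where
  isComplex : IsComplex B
  isComplex_bdry : IsComplex D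
  subset : D ⊆ B
  card_le : ∀ s ∈ B, s.card ≤ d
  card_lt : ∀ s ∈ D, s.card < d
  exists_top : ∃ G ∈ D, G.card + 1 = d
  acyclic : Acyclic B
  acyclic_antistar : ∀ s ∈ D, s.Nonempty → Acyclic (antistar B s)
  acyclic_bdry_antistar : ∀ s ∈ D, s.Nonempty → Acyclic (antistar D s)

lemma acyclic_empty : Acyclic (∅ : Set (Finset ℕ)) := by
  intro z hz _
  have : z = 0 := by simpa [chains] using hz
  exact ⟨0, Submodule.zero_mem _, by simp [this]⟩

lemma antistar_empty (K : Set (Finset ℕ)) : antistar K ∅ = ∅ := by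
  ext; simp [antistar]

lemma exists_add_of_mem_chains_union {A B : Set (Finset ℕ)} {z : OChain}
    (hz : z ∈ chains (A ∪ B)) : ∃ a ∈ chains A, ∃ b ∈ chains B, a + b = z := by
  rw [chains, Finsupp.supported_union] at hz
  exact Submodule.mem_sup.mp hz

namespace BallPair

variable {d : ℕ} {B D : Set (Finset ℕ)}

lemma acyclic_antistar' (h : BallPair d B D) {s : Finset ℕ} (hs : s ∈ D) :
    Acyclic (antistar B s) := by
  rcases s.eq_empty_or_nonempty with rfl | hne
  · rw [antistar_empty]; exact acyclic_empty
  · exact h.acyclic_antistar s hs hne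

lemma acyclic_bdry_antistar' (h : BallPair d B D) {s : Finset ℕ} (hs : s ∈ D) :
    Acyclic (antistar D s) := by
  rcases s.eq_empty_or_nonempty with rfl | hne
  · rw [antistar_empty]; exact acyclic_empty
  · exact h.acyclic_bdry_antistar s hs hne

/-- A cycle relative to `D` and the antistar of `t` can be corrected in the antistar to a cycle
relative to `D`. -/
lemma exists_sub_bd_mem (h : BallPair d B D) {t : Finset ℕ} (ht : t ∈ D) {m : ℕ} {z : OChain}
    (hz : z ∈ chains (sized B (m + 1))) (hdz : bd 1 z ∈ chains (D ∪ antistar B t)) :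
    ∃ a ∈ chains (sized (antistar B t) (m + 1)), bd 1 (z - a) ∈ chains (sized D m) := by
  have hz0 : bd 1 z ∈ chains (sized D m ∪ sized (antistar B t) m) := by
    refine chains_mono ?_ (mem_chains_inter hdz (h.isComplex.bd_mem_sized 1 hz))
    rintro s ⟨hs | hs, hs'⟩
    · exact Or.inl ⟨hs, hs'.2⟩
    · exact Or.inr ⟨hs, hs'.2⟩
  obtain ⟨b, hb, a, ha, hba⟩ := exists_add_of_mem_chains_union hz0
  have hsum : bd 1 b + bd 1 a = 0 := by rw [← map_add, hba, bd_bd_self]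
  have key : ∃ b' ∈ chains (sized (antistar D t) m), bd 1 b' = bd 1 b := by
    rcases m with _ | m
    · refine ⟨0, Submodule.zero_mem _, ?_⟩
      rw [map_zero]
      refine (eq_zero_of_mem_chains (K := ∅)
        (bd_mem_chains 1 (fun s hs v hv => ?_) hb) (by simp)).symm
      have := hs.2
      simp at this
      simp [this] at hv
    · refine (h.acyclic_bdry_antistar' ht).exists_sized ?_ (bd_bd_self _ _)
      have h1 : bd 1 b ∈ chains (sized D m) := h.isComplex_bdry.bd_mem_sized 1 hb
      have h2 : bd 1 b ∈ chains (sized (antistar B t) m) := by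
        rw [eq_neg_of_add_eq_zero_left hsum]
        exact Submodule.neg_mem _ ((h.isComplex.isComplex_antistar t).bd_mem_sized 1 ha)
      refine chains_mono ?_ (mem_chains_inter h1 h2)
      rintro s ⟨hs, hs'⟩
      exact ⟨⟨hs.1, hs'.1.2⟩, hs.2⟩
  obtain ⟨b', hb_mem, hbb'⟩ := key
  have hab : a + b' ∈ chains (sized (antistar B t) m) :=
    Submodule.add_mem _ ha (chains_mono (sized_mono (antistar_mono h.subset t) m) hb_mem)
  obtain ⟨a', ha', haa'⟩ := (h.acyclic_antistar' ht).exists_sized hab (by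
    rw [map_add, hbb', add_comm, hsum])
  refine ⟨a', ha', ?_⟩
  rw [map_sub, haa', ← hba, show b + a - (a + b') = b - b' by abel]
  exact Submodule.sub_mem _ hb (chains_mono (sized_mono (antistar_subset D t) m) hb_mem)

/-- The relative homology of the star of `t` modulo the boundary vanishes below the top. -/
lemma exists_bd_sub_mem (h : BallPair d B D) {t : Finset ℕ} (ht : t ∈ D) {m : ℕ}
    (hm : m + 1 < d) {z : OChain}
    (hz : z ∈ chains (sized B (m + 1))) (hdz : bd 1 z ∈ chains (D ∪ antistar B t)) :
    ∃ w ∈ chains B, z - bd 1 w ∈ chains (D ∪ antistar B t) := by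
  obtain ⟨a, ha, hza⟩ := h.exists_sub_bd_mem ht hz hdz
  obtain ⟨G, hG, hGd⟩ := h.exists_top
  have h1 : bd 1 (z - a) ∈ chains (antistar D G) := by
    refine chains_mono (K := sized D m) (L := antistar D G) (fun s hs => ⟨hs.1, fun hGs => ?_⟩) hza
    have := Finset.card_le_card hGs
    have := hs.2
    omega
  obtain ⟨e, he, hde⟩ := h.acyclic_bdry_antistar' hG _ h1 (bd_bd_self _ _)
  have he' : e ∈ chains D := chains_mono (fun s hs => hs.1) he
  have haB : a ∈ chains (antistar B t) := chains_mono (fun s hs => hs.1) ha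
  obtain ⟨w, hw, hdw⟩ := h.acyclic (z - a - e) (by
    refine Submodule.sub_mem _ (Submodule.sub_mem _ (chains_mono (fun s hs => hs.1) hz)
      (chains_mono (fun s hs => hs.1) haB)) (chains_mono h.subset he')) (by
    rw [map_sub, hde, sub_self])
  refine ⟨w, hw, ?_⟩
  rw [hdw, show z - (z - a - e) = e + a by abel]
  exact Submodule.add_mem _ (chains_mono Set.subset_union_left he')
    (chains_mono Set.subset_union_right haB)

/-- The relative fundamental cycle spans the relative cycles of top dimension. -/
lemma exists_fundamental (h : BallPair d B D) :
    ∃ ζ ∈ chains (sized B d), bd 1 ζ ∈ chains D ∧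
      ∀ ζ' ∈ chains (sized B d), bd 1 ζ' ∈ chains D → ∃ c : ℝ, ζ' = c • ζ := by
  obtain ⟨G, hG, hGd⟩ := h.exists_top
  have inj : ∀ ζ ∈ chains (sized B d), bd 1 ζ ∈ chains D → bd 1 ζ G = 0 → ζ = 0 := by
    intro ζ hζ hd h0
    have h1 : bd 1 ζ ∈ chains (sized (antistar D G) (d - 1)) := by
      have h2 : bd 1 ζ ∈ chains (sized B (d - 1)) := by
        apply h.isComplex.bd_mem_sized 1
        rwa [show d - 1 + 1 = d by omega]
      rw [chains, Finsupp.mem_supported]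
      intro s hs
      have hsD : s ∈ D := hd hs
      have hsc : s.card = d - 1 := (h2 hs).2
      refine ⟨⟨hsD, fun hGs => ?_⟩, hsc⟩
      have : G = s := Finset.eq_of_subset_of_card_le hGs (by omega)
      subst this
      exact (Finsupp.mem_support_iff.mp hs) h0
    obtain ⟨e, he, hde⟩ := (h.acyclic_bdry_antistar' hG).exists_sized h1 (bd_bd_self _ _)
    have he0 : e = 0 := by
      have : e ∈ chains (∅ : Set (Finset ℕ)) := by
        refine chains_mono (fun s hs => ?_) he
        have := h.card_lt s hs.1.1
        have := hs.2
        omega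
      simpa [chains] using this
    rw [he0, map_zero] at hde
    obtain ⟨w, hw, hdw⟩ := h.acyclic.exists_sized hζ hde.symm
    have hw0 : w = 0 := by
      have : w ∈ chains (∅ : Set (Finset ℕ)) := by
        refine chains_mono (fun s hs => ?_) hw
        have := h.card_le s hs.1
        have := hs.2
        omega
      simpa [chains] using this
    rw [← hdw, hw0, map_zero]
  by_cases hex : ∃ ζ ∈ chains (sized B d), bd 1 ζ ∈ chains D ∧ bd 1 ζ G ≠ 0
  · obtain ⟨ζ, hζ, hd, hne⟩ := hex
    refine ⟨ζ, hζ, hd, fun ζ' hζ' hd' => ⟨bd 1 ζ' G / bd 1 ζ G, ?_⟩⟩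
    refine sub_eq_zero.mp (inj _ (Submodule.sub_mem _ hζ' (Submodule.smul_mem _ _ hζ)) ?_ ?_)
    · rw [map_sub, map_smul]
      exact Submodule.sub_mem _ hd' (Submodule.smul_mem _ _ hd)
    · rw [map_sub, map_smul, Finsupp.sub_apply, Finsupp.smul_apply, smul_eq_mul,
        div_mul_cancel₀ _ hne, sub_self]
  · push Not at hex
    refine ⟨0, Submodule.zero_mem _, by simp, fun ζ' hζ' hd' => ⟨0, ?_⟩⟩
    rw [inj ζ' hζ' hd' (hex ζ' hζ' hd'), smul_zero]

/-- A cochain on the interior faces containing `t` that vanishes on boundaries and on relative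
cycles of top dimension is a coboundary. -/
lemma exists_cochain (h : BallPair d B D) {t : Finset ℕ} (ht : t ∈ D) {m : ℕ}
    {f : Finset ℕ → ℝ}
    (hf : ∀ s, f s ≠ 0 → s ∈ B ∧ s ∉ D ∧ t ⊆ s ∧ s.card = m + 1)
    (hcl : ∀ w ∈ chains B, Finsupp.linearCombination ℝ f (bd 1 w) = 0)
    (htop : ∀ ζ ∈ chains (sized B d), bd 1 ζ ∈ chains D → Finsupp.linearCombination ℝ f ζ = 0) :
    ∃ g : Finset ℕ → ℝ, (∀ s, g s ≠ 0 → s ∈ B ∧ s ∉ D ∧ t ⊆ s ∧ s.card = m) ∧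
      ∀ s ∈ B, t ⊆ s → s ∉ D → s.card = m + 1 →
        f s = Finsupp.linearCombination ℝ g (bd 1 (Finsupp.single s 1)) := by
  classical
  set R : Set (Finset ℕ) := {s | s ∈ B ∧ s ∉ D ∧ t ⊆ s} with hR
  have hvan : ∀ z ∈ chains (D ∪ antistar B t), Finsupp.linearCombination ℝ f z = 0 := by
    intro z hz
    rw [Finsupp.linearCombination_apply, Finsupp.sum]
    refine Finset.sum_eq_zero fun s hs => ?_
    have : f s = 0 := by
      by_contra hne
      obtain ⟨_, h2, h3, _⟩ := hf s hne
      rcases hz hs with hs | hs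
      · exact h2 hs
      · exact hs.2 h3
    rw [this, smul_zero]
  let π : OChain →ₗ[ℝ] OChain :=
    Finsupp.linearCombination ℝ (fun s => if s ∈ R then Finsupp.single s 1 else 0)
  have hπ : ∀ z ∈ chains B, z - π z ∈ chains (D ∪ antistar B t) := by
    intro z hz
    have := chains_induction (f := LinearMap.id - π) (S := chains (D ∪ antistar B t)) (K := B) ?_ hz
    · simpa using this
    · intro s hs
      simp only [LinearMap.sub_apply, LinearMap.id_apply, π, Finsupp.linearCombination_single,
        one_smul]
      by_cases hsR : s ∈ R
      · simp [hsR]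
      · rw [if_neg hsR, sub_zero]
        refine Finsupp.single_mem_supported ℝ _ ?_
        by_cases hsD : s ∈ D
        · exact Or.inl hsD
        · exact Or.inr ⟨hs, fun hts => hsR ⟨hs, hsD, hts⟩⟩
  obtain ⟨g', hg'⟩ := exists_comp_eqOn (chains (sized R (m + 1))) (φ := π ∘ₗ bd 1)
      (F := Finsupp.linearCombination ℝ f) (by
    intro z hz hφ
    rw [LinearMap.comp_apply] at hφ
    have hzB : z ∈ chains (sized B (m + 1)) := chains_mono (sized_mono (fun s hs => hs.1) _) hz
    have hdz : bd 1 z ∈ chains (D ∪ antistar B t) := by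
      have := hπ (bd 1 z) (h.isComplex.bd_mem 1 (chains_mono (fun s hs => hs.1) hzB))
      rwa [hφ, sub_zero] at this
    rcases lt_trichotomy (m + 1) d with hlt | heq | hgt
    · obtain ⟨w, hw, hzw⟩ := h.exists_bd_sub_mem ht hlt hzB hdz
      have := hvan _ hzw
      rwa [map_sub, hcl w hw, sub_zero] at this
    · obtain ⟨a, ha, hza⟩ := h.exists_sub_bd_mem ht hzB hdz
      have h1 := htop (z - a) (by
        rw [← heq]
        exact Submodule.sub_mem _ hzB (chains_mono (sized_mono (antistar_subset B t) _) ha))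
        (chains_mono (fun s hs => hs.1) hza)
      have h2 := hvan a (chains_mono (fun s hs => Or.inr hs.1) ha)
      rw [map_sub, h2, sub_zero] at h1
      exact h1
    · have : z ∈ chains (∅ : Set (Finset ℕ)) := by
        refine chains_mono (fun s hs => ?_) hzB
        have := h.card_le s hs.1
        have := hs.2
        omega
      have hz0 : z = 0 := by simpa [chains] using this
      rw [hz0, map_zero])
  refine ⟨fun s => if s ∈ R ∧ s.card = m then g' (Finsupp.single s 1) else 0, ?_, ?_⟩
  · intro s hs
    have : s ∈ R ∧ s.card = m := by
      by_contra hc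
      simp only [if_neg hc, ne_eq, not_true] at hs
    exact ⟨this.1.1, this.1.2.1, this.1.2.2, this.2⟩
  · intro s hsB hts hsD hsc
    have h1 := hg' (Finsupp.single s 1) (Finsupp.single_mem_supported ℝ _ ⟨⟨hsB, hsD, hts⟩, hsc⟩)
    rw [Finsupp.linearCombination_single, one_smul] at h1
    rw [← h1, LinearMap.comp_apply]
    rw [bd_single subset_rfl]
    simp only [map_sum, map_smul]
    refine Finset.sum_congr rfl fun v hv => ?_
    rw [del_single, if_pos hv]
    simp only [π, Finsupp.linearCombination_single]
    have hc : (s.erase v).card = m := by rw [Finset.card_erase_of_mem hv, hsc]; rfl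
    by_cases hR' : s.erase v ∈ R
    · rw [if_pos hR', smul_smul, one_mul, smul_eq_mul, if_pos ⟨hR', hc⟩]
      rw [← smul_eq_mul, map_smul]; simp
    · simp [hR']

end BallPair

/-- Chains on `i`-element subsets of `σ` whose first `a` moments vanish. -/
noncomputable def momentChains (a i : ℕ) (σ : Finset ℕ) : Submodule ℝ OChain where
  carrier := {c | c ∈ chains {t | t ⊆ σ ∧ t.card = i} ∧ ∀ j < a, bd (fun v => (v : ℝ) ^ j) c = 0}
  add_mem' := fun hx hy => ⟨Submodule.add_mem _ hx.1 hy.1, fun j hj => by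
    rw [map_add, hx.2 j hj, hy.2 j hj, add_zero]⟩
  zero_mem' := ⟨Submodule.zero_mem _, fun _ _ => map_zero _⟩
  smul_mem' := fun c _ hx => ⟨Submodule.smul_mem _ c hx.1, fun j hj => by
    rw [map_smul, hx.2 j hj, smul_zero]⟩

lemma momentChains_mono (a i : ℕ) {σ τ : Finset ℕ} (h : σ ⊆ τ) :
    momentChains a i σ ≤ momentChains a i τ :=
  fun _ hx => ⟨chains_mono (K := {t | t ⊆ σ ∧ t.card = i}) (L := {t | t ⊆ τ ∧ t.card = i})
    (fun _ ht => ⟨ht.1.trans h, ht.2⟩) hx.1, hx.2⟩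

lemma momentChains_anti {a b : ℕ} (h : a ≤ b) (i : ℕ) (σ : Finset ℕ) :
    momentChains b i σ ≤ momentChains a i σ :=
  fun _ hx => ⟨hx.1, fun j hj => hx.2 j (hj.trans_le h)⟩

lemma mem_momentChains_succ {a i : ℕ} {σ : Finset ℕ} {c : OChain} : c ∈ momentChains (a + 1) i σ ↔
    c ∈ momentChains a i σ ∧ bd (fun v => (v : ℝ) ^ a) c = 0 := by
  refine ⟨fun h => ⟨momentChains_anti (Nat.le_succ a) i σ h, h.2 a (Nat.lt_succ_self a)⟩,
    fun h => ⟨h.1.1, fun j hj => ?_⟩⟩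
  rcases Nat.lt_succ_iff_lt_or_eq.mp hj with hj | rfl
  · exact h.1.2 j hj
  · exact h.2

lemma bd_eq_zero_of_card {u : ℕ → ℝ} {σ : Finset ℕ} {c : OChain}
    (hc : c ∈ chains {t | t ⊆ σ ∧ t.card = 0}) : bd u c = 0 := by
  refine eq_zero_of_mem_chains (K := ∅) (bd_mem_chains u (fun s hs v hv => ?_) hc) (by simp)
  have := hs.2
  simp at this
  simp [this] at hv

lemma bd_mem_momentChains {a i : ℕ} {σ : Finset ℕ} {c : OChain}
    (hc : c ∈ momentChains a (i + 1) σ) :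
    bd (fun v => (v : ℝ) ^ a) c ∈ momentChains (a + 1) i σ := by
  refine mem_momentChains_succ.mpr ⟨⟨bd_mem_chains
    (B := {t | t ⊆ σ ∧ t.card = i}) _ (fun s hs v hv => ⟨?_, ?_⟩) hc.1, ?_⟩,
    bd_bd_self _ _⟩
  · exact (Finset.erase_subset v s).trans hs.1
  · rw [Finset.card_erase_of_mem hv, hs.2]; rfl
  · intro j hj
    rw [bd_bd, hc.2 j hj, map_zero, neg_zero]

lemma wedge_mem_chains {i : ℕ} {σ : Finset ℕ} {c : OChain} {v : ℕ} (hv : v ∈ σ)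
    (hc : c ∈ chains {t | t ⊆ σ ∧ t.card = i}) :
    wedge v c ∈ chains {t | t ⊆ σ ∧ t.card = i + 1} := by
  refine chains_induction (fun s hs => ?_) hc
  rw [wedge_single]
  split_ifs with h
  · exact Submodule.zero_mem _
  · exact Finsupp.single_mem_supported ℝ _
      ⟨Finset.insert_subset hv hs.1, by rw [Finset.card_insert_of_notMem h, hs.2]⟩

lemma exists_moment_weights {a : ℕ} {σ : Finset ℕ} (h : a < σ.card) :
    ∃ w : ℕ → ℝ, ∀ j ≤ a, ∑ v ∈ σ, w v * (v : ℝ) ^ j = if j = a then 1 else 0 := by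
  refine ⟨fun v => (Lagrange.basis σ (fun v : ℕ => (v : ℝ)) v).coeff a, fun j hj => ?_⟩
  have h1 := Lagrange.eq_interpolate (s := σ) (v := fun v : ℕ => (v : ℝ))
    (f := (Polynomial.X : Polynomial ℝ) ^ j) (fun x _ y _ hxy => by simpa using hxy) (by
      rw [Polynomial.degree_X_pow]; exact_mod_cast hj.trans_lt h)
  have h2 := congrArg (fun p => Polynomial.coeff p a) h1
  simp only [Lagrange.interpolate_apply, Polynomial.finsetSum_coeff, Polynomial.coeff_C_mul,
    Polynomial.coeff_X_pow, Polynomial.eval_pow, Polynomial.eval_X] at h2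
  rw [eq_comm, show (if j = a then (1 : ℝ) else 0) = if a = j then 1 else 0 by simp [eq_comm], h2]
  exact Finset.sum_congr rfl fun v _ => mul_comm _ _

lemma exists_bd_eq {a i : ℕ} {σ : Finset ℕ} (h : a < σ.card) {c : OChain}
    (hc : c ∈ momentChains (a + 1) i σ) :
    ∃ b ∈ momentChains a (i + 1) σ, bd (fun v => (v : ℝ) ^ a) b = c := by
  obtain ⟨w, hw⟩ := exists_moment_weights h
  have key : ∀ j ≤ a, bd (fun v => (v : ℝ) ^ j) (∑ v ∈ σ, w v • wedge v c) =
      if j = a then c else 0 := by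
    intro j hj
    rw [map_sum]
    have : ∀ v ∈ σ, bd (fun v => (v : ℝ) ^ j) (w v • wedge v c) = (w v * (v : ℝ) ^ j) • c := by
      intro v _
      rw [map_smul, bd_wedge, hc.2 j (by omega), map_zero, sub_zero, smul_smul]
    rw [Finset.sum_congr rfl this, ← Finset.sum_smul, hw j hj]
    split_ifs <;> simp
  refine ⟨∑ v ∈ σ, w v • wedge v c, ⟨?_, fun j hj => ?_⟩, ?_⟩
  · exact Submodule.sum_mem _ fun v hv => Submodule.smul_mem _ _ (wedge_mem_chains hv hc.1)
  · rw [key j hj.le, if_neg hj.ne]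
  · rw [key a le_rfl, if_pos rfl]

lemma linearCombination_bd_single {M : Type*} [AddCommGroup M] [Module ℝ M] (y : Finset ℕ → M)
    (σ : Finset ℕ) : Finsupp.linearCombination ℝ y (bd 1 (Finsupp.single σ 1)) =
      ∑ v ∈ σ, placeSign v σ • y (σ.erase v) := by
  rw [bd_single subset_rfl, map_sum]
  refine Finset.sum_congr rfl fun v hv => ?_
  rw [del_single, if_pos hv]
  simp

open Classical in
/-- The coboundary of a family of chains indexed by the faces in `I`. -/
noncomputable def cobd (I : Set (Finset ℕ)) (y : Finset ℕ → OChain) (σ : Finset ℕ) : OChain :=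
  if σ ∈ I then Finsupp.linearCombination ℝ y (bd 1 (Finsupp.single σ 1)) else 0

lemma cobd_of_mem {I : Set (Finset ℕ)} {σ : Finset ℕ} (h : σ ∈ I) (y : Finset ℕ → OChain) :
    cobd I y σ = ∑ v ∈ σ, placeSign v σ • y (σ.erase v) := by
  rw [cobd, if_pos h, linearCombination_bd_single]

lemma cobd_of_notMem {I : Set (Finset ℕ)} {σ : Finset ℕ} (h : σ ∉ I) (y : Finset ℕ → OChain) :
    cobd I y σ = 0 := if_neg h

lemma map_cobd (I : Set (Finset ℕ)) (L : OChain →ₗ[ℝ] OChain) (y : Finset ℕ → OChain)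
    (σ : Finset ℕ) : L (cobd I y σ) = cobd I (fun s => L (y s)) σ := by
  by_cases h : σ ∈ I
  · simp [cobd_of_mem h]
  · simp [cobd_of_notMem h]

lemma cobd_sub (I : Set (Finset ℕ)) (y z : Finset ℕ → OChain) (σ : Finset ℕ) :
    cobd I (fun s => y s - z s) σ = cobd I y σ - cobd I z σ := by
  by_cases h : σ ∈ I
  · simp [cobd_of_mem h, smul_sub]
  · simp [cobd_of_notMem h]

/-- Families of chains with `a` vanishing moments on `i`-subsets, indexed by `s`-element faces. -/
structure IsFamily (I : Set (Finset ℕ)) (a i s : ℕ) (x : Finset ℕ → OChain) : Prop where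
  mem : ∀ σ, x σ ∈ momentChains a i σ
  eq_zero : ∀ σ, x σ ≠ 0 → σ ∈ I ∧ σ.card = s

namespace IsFamily

variable {I : Set (Finset ℕ)} {a i s : ℕ} {x : Finset ℕ → OChain}

lemma cobd (h : IsFamily I a i s x) : IsFamily I a i (s + 1) (cobd I x) where
  mem σ := by
    by_cases hσ : σ ∈ I
    · rw [cobd_of_mem hσ]
      exact Submodule.sum_mem _ fun v hv => Submodule.smul_mem _ _
        (momentChains_mono a i (Finset.erase_subset v σ) (h.mem _))
    · rw [cobd_of_notMem hσ]; exact Submodule.zero_mem _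
  eq_zero σ hne := by
    by_cases hσ : σ ∈ I
    · refine ⟨hσ, ?_⟩
      rw [cobd_of_mem hσ] at hne
      obtain ⟨v, hv, hne⟩ := Finset.exists_ne_zero_of_sum_ne_zero hne
      have := (h.eq_zero _ (fun h0 => hne (by rw [h0, smul_zero]))).2
      rw [← Finset.card_erase_add_one hv, this]
    · exact absurd (cobd_of_notMem hσ x) hne

lemma zero : IsFamily I a i s (fun _ => 0) :=
  ⟨fun _ => Submodule.zero_mem _, fun _ h => absurd rfl h⟩

lemma sub {y : Finset ℕ → OChain} (hx : IsFamily I a i s x) (hy : IsFamily I a i s y) :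
    IsFamily I a i s (fun σ => x σ - y σ) where
  mem σ := Submodule.sub_mem _ (hx.mem σ) (hy.mem σ)
  eq_zero σ hne := by
    by_cases h : x σ = 0
    · exact hy.eq_zero σ fun h' => hne (by rw [h, h', sub_zero])
    · exact hx.eq_zero σ h

end IsFamily

namespace BallPair

variable {d : ℕ} {B D : Set (Finset ℕ)}

lemma linearCombination_cobd (h : BallPair d B D) {a i s : ℕ} {x : Finset ℕ → OChain}
    (hx : IsFamily (B \ D) a i s x) {w : OChain} (hw : w ∈ chains B) :
    Finsupp.linearCombination ℝ (cobd (B \ D) x) w = Finsupp.linearCombination ℝ x (bd 1 w) := by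
  rw [← Finsupp.sum_single w, Finsupp.sum, map_sum, map_sum, map_sum]
  refine Finset.sum_congr rfl fun σ hσ => ?_
  rw [show Finsupp.single σ (w σ) = w σ • Finsupp.single σ (1 : ℝ) by simp, map_smul, map_smul,
    map_smul, Finsupp.linearCombination_single, one_smul]
  congr 1
  by_cases hI : σ ∈ B \ D
  · rw [cobd_of_mem hI, linearCombination_bd_single]
  · rw [cobd_of_notMem hI, linearCombination_bd_single]
    refine (Finset.sum_eq_zero fun v _ => ?_).symm
    have hσD : σ ∈ D := by
      by_contra hD
      exact hI ⟨hw hσ, hD⟩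
    have : x (σ.erase v) = 0 := by
      by_contra hne
      exact (hx.eq_zero _ hne).1.2 (h.isComplex_bdry σ hσD _ (Finset.erase_subset v σ))
    rw [this, smul_zero]

lemma cobd_cobd (h : BallPair d B D) {a i s : ℕ} {x : Finset ℕ → OChain}
    (hx : IsFamily (B \ D) a i s x) (σ : Finset ℕ) : cobd (B \ D) (cobd (B \ D) x) σ = 0 := by
  by_cases hσ : σ ∈ B \ D
  · have hB : Finsupp.single σ (1 : ℝ) ∈ chains B := Finsupp.single_mem_supported ℝ _ hσ.1
    rw [cobd, if_pos hσ, h.linearCombination_cobd hx (h.isComplex.bd_mem 1 hB), bd_bd_self,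
      map_zero]
  · exact cobd_of_notMem hσ _

/-- Exactness without moment conditions. -/
lemma exists_cobd_eq_zero (h : BallPair d B D) {k : ℕ} (hk : ∀ s ∈ B, s.card ≤ k → s ∈ D)
    {i s : ℕ} (hi : i ≤ k) {x : Finset ℕ → OChain} (hx : IsFamily (B \ D) 0 i (s + 1) x)
    (hcl : ∀ σ, cobd (B \ D) x σ = 0)
    (htop : ∀ ζ ∈ chains (sized B d), bd 1 ζ ∈ chains D → Finsupp.linearCombination ℝ x ζ = 0) :
    ∃ y, IsFamily (B \ D) 0 i s y ∧ ∀ σ, cobd (B \ D) y σ = x σ := by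
  have happ : ∀ (y : Finset ℕ → OChain) (τ : Finset ℕ) (w : OChain),
      Finsupp.linearCombination ℝ (fun σ => y σ τ) w = Finsupp.linearCombination ℝ y w τ := by
    intro y τ w
    rw [← Finsupp.lapply_apply (R := ℝ) τ, Finsupp.apply_linearCombination]
    rfl
  have hsupp : ∀ σ τ, x σ τ ≠ 0 → σ ∈ B \ D ∧ σ.card = s + 1 ∧ τ ⊆ σ ∧ τ.card = i := by
    intro σ τ hne
    have h1 := hx.eq_zero σ (fun h0 => hne (by rw [h0]; rfl))
    have h2 := (hx.mem σ).1 (Finsupp.mem_support_iff.mpr hne)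
    exact ⟨h1.1, h1.2, h2⟩
  have hex : ∀ τ : Finset ℕ, ∃ g : Finset ℕ → ℝ,
      (∀ ρ, g ρ ≠ 0 → ρ ∈ B \ D ∧ τ ⊆ ρ ∧ ρ.card = s ∧ τ.card = i) ∧
      ∀ σ ∈ B \ D, x σ τ = Finsupp.linearCombination ℝ g (bd 1 (Finsupp.single σ 1)) := by
    intro τ
    by_cases hτ : τ ∈ D ∧ τ.card = i
    · obtain ⟨g, hg, hgx⟩ := h.exists_cochain hτ.1 (m := s) (f := fun σ => x σ τ)
        (fun σ hσ => by
          obtain ⟨h1, h2, h3, _⟩ := hsupp σ τ hσ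
          exact ⟨h1.1, h1.2, h3, h2⟩)
        (fun w hw => by
          rw [happ, ← h.linearCombination_cobd hx hw,
            show cobd (B \ D) x = 0 from funext hcl]
          simp)
        (fun ζ hζ hd => by rw [happ, htop ζ hζ hd]; rfl)
      refine ⟨g, fun ρ hρ => ?_, fun σ hσ => ?_⟩
      · obtain ⟨h1, h2, h3, h4⟩ := hg ρ hρ
        exact ⟨⟨h1, h2⟩, h3, h4, hτ.2⟩
      · by_cases hσ' : τ ⊆ σ ∧ σ.card = s + 1
        · exact hgx σ hσ.1 hσ'.1 hσ.2 hσ'.2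
        · have h0 : x σ τ = 0 := by
            by_contra hne
            exact hσ' ⟨(hsupp σ τ hne).2.2.1, (hsupp σ τ hne).2.1⟩
          rw [h0, linearCombination_bd_single]
          refine (Finset.sum_eq_zero fun v hv => ?_).symm
          have : g (σ.erase v) = 0 := by
            by_contra hne
            obtain ⟨_, _, h3, h4⟩ := hg _ hne
            refine hσ' ⟨h3.trans (Finset.erase_subset v σ), ?_⟩
            rw [← Finset.card_erase_add_one hv, h4]
          rw [this, smul_zero]
    · refine ⟨fun _ => 0, fun ρ hρ => absurd rfl hρ, fun σ hσ => ?_⟩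
      have h0 : x σ τ = 0 := by
        by_contra hne
        obtain ⟨h1, h2, h3, h4⟩ := hsupp σ τ hne
        exact hτ ⟨hk τ (h.isComplex σ h1.1 τ h3) (h4.trans_le hi), h4⟩
      rw [h0, linearCombination_bd_single]
      simp
  choose g hg hgx using hex
  have hyapp : ∀ ρ τ, (∑ τ' ∈ ρ.powerset, Finsupp.single τ' (g τ' ρ)) τ = g τ ρ := by
    intro ρ τ
    rw [Finsupp.finsetSum_apply]
    simp only [Finsupp.single_apply]
    rw [Finset.sum_ite_eq']
    split_ifs with hτ
    · rfl
    · by_contra hne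
      exact hτ (Finset.mem_powerset.mpr (hg τ ρ (Ne.symm hne)).2.1)
  refine ⟨fun ρ => ∑ τ' ∈ ρ.powerset, Finsupp.single τ' (g τ' ρ), ⟨fun ρ => ⟨?_, by simp⟩, ?_⟩, ?_⟩
  · intro τ hτ
    have := hg τ ρ (by rw [← hyapp ρ τ]; exact Finsupp.mem_support_iff.mp hτ)
    exact ⟨this.2.1, this.2.2.2⟩
  · intro ρ hne
    obtain ⟨τ, hτ⟩ := Finsupp.ne_iff.mp hne
    have := hg τ ρ (by rw [← hyapp ρ τ]; exact hτ)
    exact ⟨this.1, this.2.2.1⟩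
  · intro σ
    by_cases hσ : σ ∈ B \ D
    · ext τ
      rw [cobd, if_pos hσ, ← happ, hgx τ σ hσ]
      simp only [hyapp]
    · rw [cobd_of_notMem hσ]
      by_contra hne
      exact hσ (hx.eq_zero σ (Ne.symm hne)).1

/-- Exactness with moment conditions. -/
lemma exists_cobd_eq (h : BallPair d B D) {k : ℕ} (hk : ∀ s ∈ B, s.card ≤ k → s ∈ D)
    {a i s : ℕ} (ha : a ≤ k + 1) (hi : i ≤ k) {x : Finset ℕ → OChain}
    (hx : IsFamily (B \ D) a i (s + 1) x)
    (hcl : ∀ σ, cobd (B \ D) x σ = 0)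
    (htop : ∀ ζ ∈ chains (sized B d), bd 1 ζ ∈ chains D → Finsupp.linearCombination ℝ x ζ = 0) :
    ∃ y, IsFamily (B \ D) a i s y ∧ ∀ σ, cobd (B \ D) y σ = x σ := by
  induction a generalizing i s x with
  | zero => exact h.exists_cobd_eq_zero hk hi hx hcl htop
  | succ a iha =>
    induction i generalizing s x with
    | zero =>
      obtain ⟨y, hy, hyx⟩ := iha (by omega) hi
        ⟨fun σ => momentChains_anti (Nat.le_succ a) _ σ (hx.mem σ), hx.eq_zero⟩ hcl htop
      exact ⟨y, ⟨fun σ => mem_momentChains_succ.mpr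
        ⟨hy.mem σ, bd_eq_zero_of_card (hy.mem σ).1⟩, hy.eq_zero⟩, hyx⟩
    | succ i ihi =>
      obtain ⟨y, hy, hyx⟩ := iha (by omega) hi
        ⟨fun σ => momentChains_anti (Nat.le_succ a) _ σ (hx.mem σ), hx.eq_zero⟩ hcl htop
      by_cases hsd : d < s + 1
      · refine ⟨_, IsFamily.zero, fun σ => ?_⟩
        have : x σ = 0 := by
          by_contra hne
          have h1 := hx.eq_zero σ hne
          have := h.card_le σ h1.1.1
          omega
        rw [this]
        by_cases hσ : σ ∈ B \ D
        · simp [cobd_of_mem hσ]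
        · exact cobd_of_notMem hσ _
      rcases s with _ | s
      · refine ⟨y, ⟨fun σ => ?_, hy.eq_zero⟩, hyx⟩
        have : y σ = 0 := by
          by_contra hne
          have h1 := hy.eq_zero σ hne
          exact h1.1.2 (hk σ h1.1.1 (by omega))
        rw [this]
        exact Submodule.zero_mem _
      have hy' : IsFamily (B \ D) (a + 1) i (s + 1) (fun σ => bd (fun v => (v : ℝ) ^ a) (y σ)) :=
        ⟨fun σ => bd_mem_momentChains (hy.mem σ),
          fun σ hne => hy.eq_zero σ fun h0 => hne (by rw [h0, map_zero])⟩
      obtain ⟨z, hz, hzy⟩ := ihi (by omega) hy' (fun σ => by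
          rw [← map_cobd, hyx]
          exact (hx.mem σ).2 a (Nat.lt_succ_self a)) (fun ζ hζ _ => by
          rw [Finsupp.linearCombination_apply, Finsupp.sum]
          refine Finset.sum_eq_zero fun σ hσ => ?_
          have : bd (fun v => (v : ℝ) ^ a) (y σ) = 0 := by
            by_contra hne
            have h1 := (hy'.eq_zero σ hne).2
            have h2 : σ.card = d := (hζ hσ).2
            omega
          rw [this, smul_zero])
      have hex : ∀ σ, ∃ b ∈ momentChains a (i + 1) σ, bd (fun v => (v : ℝ) ^ a) b = z σ ∧
          (b ≠ 0 → z σ ≠ 0) := by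
        intro σ
        by_cases h0 : z σ = 0
        · exact ⟨0, Submodule.zero_mem _, by rw [h0, map_zero], fun h => absurd rfl h⟩
        · have h1 := (hz.eq_zero σ h0).1
          have h2 : a < σ.card := by
            by_contra hlt
            exact h1.2 (hk σ h1.1 (by omega))
          obtain ⟨b, hb, hbz⟩ := exists_bd_eq h2 (hz.mem σ)
          exact ⟨b, hb, hbz, fun _ => h0⟩
      choose b hb hbz hb0 using hex
      have hbf : IsFamily (B \ D) a (i + 1) s b := ⟨hb, fun σ hne => hz.eq_zero σ (hb0 σ hne)⟩
      have hsub := hy.sub hbf.cobd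
      refine ⟨_, ⟨fun σ => mem_momentChains_succ.mpr ⟨hsub.mem σ, ?_⟩, hsub.eq_zero⟩, fun σ => ?_⟩
      · rw [map_sub, map_cobd]
        simp only [hbz]
        rw [hzy, sub_self]
      · rw [cobd_sub, h.cobd_cobd hbf, sub_zero, hyx]

end BallPair

lemma wedge_apply (v : ℕ) (x : OChain) (t : Finset ℕ) :
    wedge v x t = if v ∈ t then placeSign v t * x (t.erase v) else 0 := by
  have hlin : Finsupp.lapply t ∘ₗ wedge v =
      (if v ∈ t then placeSign v t • Finsupp.lapply (t.erase v) else 0 : OChain →ₗ[ℝ] ℝ) := by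
    apply Finsupp.lhom_ext'
    intro s
    ext1
    simp only [LinearMap.comp_apply, Finsupp.lsingle_apply, Finsupp.lapply_apply, wedge_single]
    by_cases hvt : v ∈ t
    · by_cases hvs : v ∈ s
      · have : s ≠ t.erase v := by rintro rfl; simp at hvs
        simp [hvt, hvs, this]
      · by_cases hst : s = t.erase v
        · subst hst
          simp [hvt, placeSign_erase]
        · have : insert v s ≠ t := by
            rintro rfl; exact hst (Finset.erase_insert hvs).symm
          simp [hvt, hvs, this, hst]
    · have : insert v s ≠ t := by rintro rfl; simp at hvt
      by_cases hvs : v ∈ s <;> simp [hvt, hvs, this]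
  have := LinearMap.congr_fun hlin x
  simp only [LinearMap.comp_apply, Finsupp.lapply_apply] at this
  rw [this]
  split_ifs <;> simp

lemma bd_eval_eq_zero {a i : ℕ} {V : Finset ℕ} {x : OChain} (hx : x ∈ momentChains a i V)
    {p : Polynomial ℝ} (hp : p.natDegree < a) : bd (fun v => p.eval (v : ℝ)) x = 0 := by
  have hV : ∀ s ∈ x.support, s ⊆ V := fun s hs => (hx.1 hs).1
  have h1 : bd (fun v => p.eval (v : ℝ)) x =
      ∑ j ∈ Finset.range a, p.coeff j • bd (fun v => (v : ℝ) ^ j) x := by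
    simp only [bd_eq_sum hV, Polynomial.eval_eq_sum_range' hp, Finset.sum_smul, Finset.smul_sum,
      smul_smul]
    exact Finset.sum_comm
  rw [h1]
  refine Finset.sum_eq_zero fun j hj => ?_
  rw [hx.2 j (Finset.mem_range.mp hj), smul_zero]

lemma natCast_injOn (T : Finset ℕ) : Set.InjOn (fun v : ℕ => (v : ℝ)) T :=
  fun x _ y _ hxy => by simpa using hxy

/-- A chain with `a` vanishing moments is determined by its values off `a` given vertices. -/
lemma eq_zero_of_mem_momentChains {a i : ℕ} {V T : Finset ℕ} (hT : T.card = a)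
    {x : OChain} (hx : x ∈ momentChains a i V)
    (h0 : ∀ τ ⊆ V \ T, τ.card = i → x τ = 0) : x = 0 := by
  have hV : ∀ s ∈ x.support, s ⊆ V := fun s hs => (hx.1 hs).1
  have key : ∀ m, ∀ σ ⊆ V, (σ ∩ T).card = m → x σ = 0 := by
    intro m
    induction m with
    | zero =>
      intro σ hσ hm
      by_contra hne
      have hc := hx.1 (Finsupp.mem_support_iff.mpr hne)
      refine hne (h0 σ (fun v hv => Finset.mem_sdiff.mpr ⟨hσ hv, fun hvT => ?_⟩) hc.2)
      rw [Finset.card_eq_zero] at hm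
      have := Finset.mem_inter.mpr ⟨hv, hvT⟩
      rw [hm] at this
      simp at this
    | succ m ih =>
      intro σ hσ hm
      obtain ⟨t, ht⟩ : (σ ∩ T).Nonempty := Finset.card_pos.mp (by omega)
      obtain ⟨htσ, htT⟩ := Finset.mem_inter.mp ht
      have hdeg : (Lagrange.basis T (fun v : ℕ => (v : ℝ)) t).natDegree < a := by
        have h1 := Lagrange.degree_basis (natCast_injOn T) htT
        have h2 := Polynomial.natDegree_eq_of_degree_eq_some h1
        have : 0 < T.card := Finset.card_pos.mpr ⟨t, htT⟩
        omega
      have h1 := DFunLike.congr_fun (bd_eval_eq_zero hx hdeg) (σ.erase t)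
      rw [bd_apply hV, Finset.sum_eq_single t] at h1
      · rw [Lagrange.eval_basis_self (natCast_injOn T) htT, Finset.insert_erase htσ, one_mul] at h1
        exact (mul_eq_zero.mp h1).resolve_left (placeSign_ne_zero _ _)
      · intro v hv hvt
        obtain ⟨hvV, hvσ⟩ := Finset.mem_sdiff.mp hv
        by_cases hvT : v ∈ T
        · rw [Lagrange.eval_basis_of_ne hvt.symm hvT]; simp
        · rw [ih (insert v (σ.erase t)) (Finset.insert_subset hvV
            ((Finset.erase_subset t σ).trans hσ)), mul_zero]
          rw [Finset.insert_inter_of_notMem hvT, Finset.erase_inter, Finset.card_erase_of_mem ht,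
            hm]
          rfl
      · intro hn
        exact absurd (Finset.mem_sdiff.mpr ⟨hσ htσ, Finset.notMem_erase t σ⟩) hn
  ext σ
  by_contra hne
  exact hne (key _ σ (hV σ (Finsupp.mem_support_iff.mpr hne)) rfl)

/-- There is a chain with `a` vanishing moments on `τ ∪ T` that does not vanish at `τ`. -/
lemma exists_mem_momentChains {a : ℕ} {T : Finset ℕ} (hT : T.card = a) (τ : Finset ℕ)
    (hτ : Disjoint τ T) : ∃ x ∈ momentChains a τ.card (τ ∪ T), x τ ≠ 0 := by
  induction τ using Finset.induction_on with
  | empty =>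
    refine ⟨Finsupp.single ∅ 1, ⟨Finsupp.single_mem_supported ℝ _ ⟨by simp, rfl⟩, fun j _ => ?_⟩,
      by simp⟩
    rw [bd_single subset_rfl]; simp
  | insert v τ hv ih =>
    rw [Finset.disjoint_insert_left] at hτ
    obtain ⟨x, hx, hne⟩ := ih hτ.2
    have hsub : τ ∪ T ⊆ insert v τ ∪ T :=
      Finset.union_subset_union (Finset.subset_insert v τ) subset_rfl
    have hx' := momentChains_mono a τ.card hsub hx
    refine ⟨wedge v x - ∑ t ∈ T, (Lagrange.basis T (fun v : ℕ => (v : ℝ)) t).eval (v : ℝ) •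
      wedge t x, ⟨?_, fun j hj => ?_⟩, ?_⟩
    · rw [Finset.card_insert_of_notMem hv]
      refine Submodule.sub_mem _ (wedge_mem_chains (by simp) hx'.1)
        (Submodule.sum_mem _ fun t ht => Submodule.smul_mem _ _
          (wedge_mem_chains (by simp [ht]) hx'.1))
    · have h1 := Lagrange.eq_interpolate (s := T) (v := fun v : ℕ => (v : ℝ))
        (f := (Polynomial.X : Polynomial ℝ) ^ j) (natCast_injOn T) (by
          rw [Polynomial.degree_X_pow, hT]; exact_mod_cast hj)
      have h2 := congrArg (fun p => Polynomial.eval (v : ℝ) p) h1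
      simp only [Lagrange.interpolate_apply, Polynomial.eval_finsetSum, Polynomial.eval_mul,
        Polynomial.eval_C, Polynomial.eval_pow, Polynomial.eval_X] at h2
      simp only [map_sub, map_sum, map_smul, bd_wedge, hx.2 j hj, map_zero, sub_zero, smul_smul]
      rw [h2, ← Finset.sum_smul, ← sub_smul, ← Finset.sum_sub_distrib,
        Finset.sum_eq_zero, zero_smul]
      intro t _
      ring
    · rw [Finsupp.sub_apply, Finsupp.finsetSum_apply, Finset.sum_eq_zero, sub_zero, wedge_apply,
        if_pos (Finset.mem_insert_self v τ), Finset.erase_insert hv]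
      · exact mul_ne_zero (placeSign_ne_zero _ _) hne
      · intro t ht
        rw [Finsupp.smul_apply, wedge_apply, if_neg, smul_zero]
        intro h
        rcases Finset.mem_insert.mp h with rfl | h
        · exact hτ.1 ht
        · exact Finset.disjoint_left.mp hτ.2 h ht

/-- Enough linearly independent vectors of `M` span it. -/
lemma submodule_le_of_card_le {V ι κ : Type*} [AddCommGroup V] [Module ℝ V] [Fintype ι]
    [Fintype κ] {M N : Submodule ℝ V} (ev : V →ₗ[ℝ] (κ → ℝ)) (hev : ∀ x ∈ M, ev x = 0 → x = 0)
    (hcard : Fintype.card κ ≤ Fintype.card ι) {g : ι → V} (hgM : ∀ i, g i ∈ M)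
    (hgN : ∀ i, g i ∈ N) (hli : ∀ c : ι → ℝ, ∑ i, c i • g i = 0 → ∀ i, c i = 0) : M ≤ N := by
  have hinj : Function.Injective (ev.domRestrict M) := by
    rw [← LinearMap.ker_eq_bot, LinearMap.ker_eq_bot']
    exact fun x h => Subtype.ext (hev x x.2 h)
  have := FiniteDimensional.of_injective _ hinj
  have hle := LinearMap.finrank_le_finrank_of_injective hinj
  rw [Module.finrank_fintype_fun_eq_card] at hle
  let G : ι → M := fun i => ⟨g i, hgM i⟩
  have hG : LinearIndependent ℝ G := by
    rw [Fintype.linearIndependent_iff]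
    intro c hc
    refine hli c ?_
    have := congrArg Subtype.val hc
    simpa [G] using this
  have hspan := hG.span_eq_top_of_card_eq_finrank'
    (le_antisymm hG.fintype_card_le_finrank (hle.trans hcard))
  intro x hx
  have hxs : (⟨x, hx⟩ : M) ∈ Submodule.span ℝ (Set.range G) := by
    rw [hspan]; trivial
  have hsub : Submodule.span ℝ (Set.range G) ≤ N.comap M.subtype := by
    rw [Submodule.span_le]
    rintro _ ⟨i, rfl⟩
    exact hgN i
  exact hsub hxs

namespace BallPair

variable {B D : Set (Finset ℕ)}

/-- A top-dimensional family in the kernel of the fundamental cycle vanishes. -/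
lemma family_eq_zero {k : ℕ} (hk2 : 2 ≤ k) (h : BallPair (2 * k) B D)
    (hk : ∀ s ∈ B, s.card ≤ k → s ∈ D) {x : Finset ℕ → OChain}
    (hx : IsFamily (B \ D) (k + 1) (k - 1) (2 * k) x) {ζ : OChain}
    (hζ : ∀ ζ' ∈ chains (sized B (2 * k)), bd 1 ζ' ∈ chains D → ∃ c : ℝ, ζ' = c • ζ)
    (hxζ : Finsupp.linearCombination ℝ x ζ = 0) (σ : Finset ℕ) : x σ = 0 := by
  have hx' : IsFamily (B \ D) (k + 1) (k - 1) (2 * k - 1 + 1) x := by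
    rwa [show 2 * k - 1 + 1 = 2 * k by omega]
  obtain ⟨y, hy, hyx⟩ := h.exists_cobd_eq hk le_rfl (by omega) hx' (fun σ => by
      by_contra hne
      have h1 := hx.cobd.eq_zero σ hne
      have := h.card_le σ h1.1.1
      omega) (fun ζ' hζ' hd => by
      obtain ⟨c, rfl⟩ := hζ ζ' hζ' hd
      rw [map_smul, hxζ, smul_zero])
  have hy0 : ∀ ρ, y ρ = 0 := by
    intro ρ
    by_contra hne
    have hρ := (hy.eq_zero ρ hne).2
    obtain ⟨T, hTρ, hT⟩ := Finset.exists_subset_card_eq (s := ρ) (n := k + 1) (by omega)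
    refine hne (eq_zero_of_mem_momentChains hT (hy.mem ρ) fun τ hτ hτk => ?_)
    have h1 := Finset.card_le_card hτ
    rw [Finset.card_sdiff_of_subset hTρ] at h1
    omega
  rw [← hyx σ]
  by_cases hσ : σ ∈ B \ D
  · simp [cobd_of_mem hσ, hy0]
  · exact cobd_of_notMem hσ y

/-- With as few facets as the rank bound allows, the boundary conditions are supported on `B`. -/
lemma momentChains_le_chains {k : ℕ} (hk2 : 2 ≤ k) (h : BallPair (2 * k) B D)
    (hk : ∀ s ∈ B, s.card ≤ k → s ∈ D) (hfin : B.Finite) {V : Finset ℕ}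
    (hV : ∀ s ∈ B, s ⊆ V) (hn : 2 * k ≤ V.card)
    (hfac : fnum B (2 * k) = (V.card - k - 1).choose (k - 1)) :
    momentChains (k + 1) (k - 1) V ≤ chains B := by
  classical
  obtain ⟨ζ, -, -, hζ⟩ := h.exists_fundamental
  have hex : ∀ F : Finset ℕ, F.card = 2 * k →
      ∃ g ∈ momentChains (k + 1) (k - 1) F, g ≠ 0 := by
    intro F hF
    obtain ⟨T, hTF, hT⟩ := Finset.exists_subset_card_eq (s := F) (n := k + 1) (by omega)
    obtain ⟨x, hx, hne⟩ := exists_mem_momentChains hT (F \ T) Finset.sdiff_disjoint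
    rw [Finset.sdiff_union_of_subset hTF, Finset.card_sdiff_of_subset hTF, hT, hF,
      show 2 * k - (k + 1) = k - 1 by omega] at hx
    exact ⟨x, hx, fun h0 => hne (by rw [h0]; rfl)⟩
  choose! g hg hg0 using hex
  let Φ : Set (Finset ℕ) := {s | s ∈ B ∧ s.card = 2 * k}
  have hΦfin : Φ.Finite := hfin.subset fun s hs => hs.1
  have : Fintype Φ := hΦfin.fintype
  have hΦ : ∀ F ∈ Φ, F ∈ B \ D := fun F hF => ⟨hF.1, fun hD => by
    have := h.card_lt F hD
    have : F.card = 2 * k := hF.2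
    omega⟩
  have hfam : ∀ c : Finset ℕ → ℝ,
      IsFamily (B \ D) (k + 1) (k - 1) (2 * k) (fun F => if F ∈ Φ then c F • g F else 0) := by
    intro c
    refine ⟨fun F => ?_, fun F hne => ?_⟩
    · split_ifs with hF
      · exact Submodule.smul_mem _ _ (hg F hF.2)
      · exact Submodule.zero_mem _
    · by_cases hF : F ∈ Φ
      · exact ⟨hΦ F hF, hF.2⟩
      · exact absurd (if_neg hF) hne
  have hlc : ∀ c : Finset ℕ → ℝ, Finsupp.linearCombination ℝ
      (fun F => if F ∈ Φ then c F • g F else 0) ζ = ∑ F : Φ, (ζ F * c F) • g F := by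
    intro c
    rw [Finsupp.linearCombination_apply,
      Finsupp.sum_of_support_subset ζ (s := ζ.support ∪ hΦfin.toFinset)
        Finset.subset_union_left _ (by simp)]
    rw [← Finset.sum_subset (Finset.subset_union_right : hΦfin.toFinset ⊆ _)]
    · rw [← Finset.sum_subtype hΦfin.toFinset (p := fun F => F ∈ Φ) (by simp)
        (fun F => (ζ F * c F) • g F)]
      refine Finset.sum_congr rfl fun F hF => ?_
      rw [if_pos (by simpa using hF), smul_smul]
    · intro F _ hF
      rw [if_neg (by simpa using hF), smul_zero]
  have hζ0 : ∀ F ∈ Φ, ζ F ≠ 0 := by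
    intro F hF h0
    have := h.family_eq_zero hk2 hk (hfam fun G => if G = F then 1 else 0) hζ (by
      rw [hlc]
      refine Finset.sum_eq_zero fun G _ => ?_
      by_cases hG : (G : Finset ℕ) = F
      · rw [hG, h0, zero_mul, zero_smul]
      · rw [if_neg hG, mul_zero, zero_smul]) F
    rw [if_pos hF, if_pos rfl, one_smul] at this
    exact hg0 F hF.2 this
  obtain ⟨T, hTV, hT⟩ := Finset.exists_subset_card_eq (s := V) (n := k + 1) (by omega)
  refine submodule_le_of_card_le (ι := Φ) (κ := Finset.powersetCard (k - 1) (V \ T))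
    (LinearMap.pi fun τ => Finsupp.lapply (τ : Finset ℕ)) (fun x hx h0 => ?_) ?_
    (g := fun F => g F) (fun F => momentChains_mono _ _ (hV F F.2.1) (hg F F.2.2)) (fun F => ?_)
    (fun c hc F => ?_)
  · exact eq_zero_of_mem_momentChains hT hx fun τ hτ hτi =>
      congrFun h0 ⟨τ, Finset.mem_powersetCard.mpr ⟨hτ, hτi⟩⟩
  · rw [Fintype.card_coe, Finset.card_powersetCard, Finset.card_sdiff_of_subset hTV, hT,
      ← Nat.card_eq_fintype_card, ← Nat.sub_sub]
    exact hfac.ge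
  · exact chains_mono (K := {t | t ⊆ (F : Finset ℕ) ∧ t.card = k - 1})
      (fun t ht => h.isComplex F F.2.1 t ht.1) (hg F F.2.2).1
  · have := h.family_eq_zero hk2 hk
      (hfam fun F => if hF : F ∈ Φ then c ⟨F, hF⟩ / ζ F else 0) hζ (by
      rw [hlc, ← hc]
      refine Finset.sum_congr rfl fun F _ => ?_
      rw [dif_pos F.2, mul_div_cancel₀ _ (hζ0 F F.2)]) F
    rw [if_pos F.2, dif_pos F.2, smul_eq_zero] at this
    have h1 := this.resolve_right (hg0 F F.2.2)
    exact (div_eq_zero_iff.mp h1).resolve_right (hζ0 F F.2)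

lemma nbrly {k : ℕ} (hk2 : 2 ≤ k) (h : BallPair (2 * k) B D)
    (hk : ∀ s ∈ B, s.card ≤ k → s ∈ D) (hfin : B.Finite) {V : Finset ℕ}
    (hV : ↑V = vertexSet B) (hn : 2 * k ≤ V.card)
    (hfac : fnum B (2 * k) = (V.card - k - 1).choose (k - 1)) :
    Nbrly (k - 1) (vertexSet B) B := by
  intro τ hτ hτk
  rw [← hV, Finset.coe_subset] at hτ
  obtain ⟨τ', hττ', hτ'V, hτ'⟩ := Finset.exists_subsuperset_card_eq hτ hτk (by omega)
  obtain ⟨T, hTV, hT⟩ := Finset.exists_subset_card_eq (s := V \ τ') (n := k + 1) (by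
    rw [Finset.card_sdiff_of_subset hτ'V]; omega)
  have hdisj : Disjoint τ' T :=
    Finset.disjoint_left.mpr fun v hv hvT => (Finset.mem_sdiff.mp (hTV hvT)).2 hv
  obtain ⟨x, hx, hne⟩ := exists_mem_momentChains hT τ' hdisj
  rw [hτ'] at hx
  have hxV := momentChains_mono _ _
    (Finset.union_subset hτ'V (hTV.trans Finset.sdiff_subset)) hx
  have hVB : ∀ s ∈ B, s ⊆ V := by
    intro s hs v hv
    have : v ∈ vertexSet B := h.isComplex s hs _ (Finset.singleton_subset_iff.mpr hv)
    rwa [← hV] at this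
  have := h.momentChains_le_chains hk2 hk hfin hVB hn hfac hxV
  exact h.isComplex τ' (this (Finsupp.mem_support_iff.mpr hne)) τ hττ'

end BallPair

/-- Ordered chains: formal real combinations of lists. -/
abbrev LChain (α : Type*) := List α →₀ ℝ

lemma map_mem_of_mem_supported {ι M : Type*} [AddCommGroup M] [Module ℝ M] {K : Set ι}
    {S : Submodule ℝ M} {f : (ι →₀ ℝ) →ₗ[ℝ] M} (h : ∀ s ∈ K, f (Finsupp.single s 1) ∈ S)
    {x : ι →₀ ℝ} (hx : x ∈ Finsupp.supported ℝ ℝ K) : f x ∈ S := by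
  have : Finsupp.supported ℝ ℝ K ≤ S.comap f := by
    rw [Finsupp.supported_eq_span_single, Submodule.span_le]
    rintro _ ⟨s, hs, rfl⟩
    exact h s hs
  exact this hx

section ListChains

variable {α β : Type*}

/-- Ordered chains supported on a set of lists. -/
noncomputable abbrev lchains (P : Set (List α)) : Submodule ℝ (LChain α) := Finsupp.supported ℝ ℝ P

/-- Prepending the vertex `v`. -/
noncomputable def cone (v : α) : LChain α →ₗ[ℝ] LChain α :=
  Finsupp.linearCombination ℝ fun l => Finsupp.single (v :: l) 1

/-- The boundary of a list. -/
noncomputable def listBd : List α → LChain α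
  | [] => 0
  | v :: l => Finsupp.single l 1 - cone v (listBd l)

/-- The boundary operator on ordered chains. -/
noncomputable def lbd : LChain α →ₗ[ℝ] LChain α := Finsupp.linearCombination ℝ listBd

/-- Applying a map of vertices. -/
noncomputable def lmap (f : α → β) : LChain α →ₗ[ℝ] LChain β :=
  Finsupp.linearCombination ℝ fun l => Finsupp.single (l.map f) 1

/-- The prism over a list. -/
noncomputable def listPrism (f g : α → β) : List α → LChain β
  | [] => 0
  | v :: l => Finsupp.single (f v :: g v :: l.map g) 1 - cone (f v) (listPrism f g l)

/-- The prism operator between two vertex maps. -/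
noncomputable def prism (f g : α → β) : LChain α →ₗ[ℝ] LChain β :=
  Finsupp.linearCombination ℝ (listPrism f g)

lemma cone_single (v : α) (l : List α) :
    cone v (Finsupp.single l (1 : ℝ)) = Finsupp.single (v :: l) 1 := by
  simp [cone]

lemma lbd_single (l : List α) : lbd (Finsupp.single l (1 : ℝ)) = listBd l := by
  simp [lbd]

lemma lmap_single (f : α → β) (l : List α) :
    lmap f (Finsupp.single l (1 : ℝ)) = Finsupp.single (l.map f) 1 := by
  simp [lmap]

lemma prism_single (f g : α → β) (l : List α) :
    prism f g (Finsupp.single l (1 : ℝ)) = listPrism f g l := by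
  simp [prism]

lemma lchain_single_hom_ext {M : Type*} [AddCommGroup M] [Module ℝ M] {f g : LChain α →ₗ[ℝ] M}
    (h : ∀ l, f (Finsupp.single l 1) = g (Finsupp.single l 1)) (x : LChain α) : f x = g x := by
  have : f = g := by
    apply Finsupp.lhom_ext'
    intro s
    ext1
    simpa using h s
  rw [this]

lemma lchain_hom_ext {M : Type*} [AddCommGroup M] [Module ℝ M] {f g : LChain α →ₗ[ℝ] M}
    (h0 : f (Finsupp.single [] 1) = g (Finsupp.single [] 1))
    (h : ∀ v l, f (Finsupp.single l 1) = g (Finsupp.single l 1) →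
      f (cone v (Finsupp.single l 1)) = g (cone v (Finsupp.single l 1))) (x : LChain α) :
    f x = g x := by
  refine lchain_single_hom_ext (fun l => ?_) x
  induction l with
  | nil => exact h0
  | cons v l ih => rw [← cone_single]; exact h v l ih

lemma lbd_cone (v : α) (x : LChain α) : lbd (cone v x) = x - cone v (lbd x) := by
  refine lchain_single_hom_ext (f := lbd ∘ₗ cone v) (g := LinearMap.id - cone v ∘ₗ lbd)
    (fun l => ?_) x
  simp [cone_single, lbd_single, listBd]

lemma lmap_cone (f : α → β) (v : α) (x : LChain α) :
    lmap f (cone v x) = cone (f v) (lmap f x) := by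
  refine lchain_single_hom_ext (f := lmap f ∘ₗ cone v) (g := cone (f v) ∘ₗ lmap f)
    (fun l => ?_) x
  simp [cone_single, lmap_single]

lemma lbd_lmap (f : α → β) (x : LChain α) : lbd (lmap f x) = lmap f (lbd x) := by
  refine lchain_hom_ext (f := lbd ∘ₗ lmap f) (g := lmap f ∘ₗ lbd) ?_ (fun v l ih => ?_) x
  · simp [lmap_single, lbd_single, listBd]
  · simp only [LinearMap.comp_apply] at ih ⊢
    rw [lmap_cone, lbd_cone, lbd_cone, ih, map_sub, lmap_cone]

lemma prism_cone (f g : α → β) (v : α) (x : LChain α) : prism f g (cone v x) =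
    cone (f v) (cone (g v) (lmap g x)) - cone (f v) (prism f g x) := by
  refine lchain_single_hom_ext (f := prism f g ∘ₗ cone v)
    (g := cone (f v) ∘ₗ cone (g v) ∘ₗ lmap g - cone (f v) ∘ₗ prism f g) (fun l => ?_) x
  simp [cone_single, prism_single, lmap_single, listPrism]

lemma lbd_prism (f g : α → β) (x : LChain α) :
    lbd (prism f g x) = lmap g x - lmap f x - prism f g (lbd x) := by
  refine lchain_hom_ext (f := lbd ∘ₗ prism f g) (g := lmap g - lmap f - prism f g ∘ₗ lbd)
    ?_ (fun v l ih => ?_) x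
  · simp [prism_single, lbd_single, lmap_single, listBd, listPrism]
  · simp only [LinearMap.comp_apply, LinearMap.sub_apply] at ih ⊢
    simp only [prism_cone, lbd_cone, map_sub, ih, lmap_cone, lbd_lmap]
    abel

lemma cone_mem_lchains {P Q : Set (List α)} {v : α} (h : ∀ l ∈ P, v :: l ∈ Q) {x : LChain α}
    (hx : x ∈ lchains P) : cone v x ∈ lchains Q := by
  refine map_mem_of_mem_supported (fun l hl => ?_) hx
  rw [cone_single]
  exact Finsupp.single_mem_supported ℝ _ (h l hl)

lemma lmap_mem_lchains {P : Set (List α)} {Q : Set (List β)} {f : α → β}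
    (h : ∀ l ∈ P, l.map f ∈ Q) {x : LChain α} (hx : x ∈ lchains P) : lmap f x ∈ lchains Q := by
  refine map_mem_of_mem_supported (fun l hl => ?_) hx
  rw [lmap_single]
  exact Finsupp.single_mem_supported ℝ _ (h l hl)

lemma listPrism_mem (f g : α → β) (l : List α) : listPrism f g l ∈
    lchains {m | m.length = l.length + 1 ∧ ∀ q ∈ m, ∃ p ∈ l, q = f p ∨ q = g p} := by
  induction l with
  | nil => exact Submodule.zero_mem _
  | cons v l ih =>
    refine Submodule.sub_mem _ (Finsupp.single_mem_supported ℝ _ ⟨by simp, ?_⟩)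
      (cone_mem_lchains (P := {m | m.length = l.length + 1 ∧ ∀ q ∈ m, ∃ p ∈ l, q = f p ∨ q = g p})
        (Q := {m | m.length = (v :: l).length + 1 ∧ ∀ q ∈ m, ∃ p ∈ v :: l, q = f p ∨ q = g p})
        (fun m hm => ⟨by simpa using hm.1, ?_⟩) ih)
    · intro q hq
      simp only [List.mem_cons, List.mem_map] at hq
      rcases hq with rfl | rfl | ⟨p, hp, rfl⟩
      · exact ⟨v, by simp, Or.inl rfl⟩
      · exact ⟨v, by simp, Or.inr rfl⟩
      · exact ⟨p, by simp [hp], Or.inr rfl⟩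
    · intro q hq
      rcases List.mem_cons.mp hq with rfl | hq
      · exact ⟨v, by simp, Or.inl rfl⟩
      · obtain ⟨p, hp, h⟩ := hm.2 q hq
        exact ⟨p, by simp [hp], h⟩

lemma prism_mem_lchains {P : Set (List α)} {Q : Set (List β)} {f g : α → β}
    (h : ∀ l ∈ P, ∀ m : List β, m.length = l.length + 1 →
      (∀ q ∈ m, ∃ p ∈ l, q = f p ∨ q = g p) → m ∈ Q)
    {x : LChain α} (hx : x ∈ lchains P) : prism f g x ∈ lchains Q := by
  refine map_mem_of_mem_supported (fun l hl => ?_) hx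
  rw [prism_single]
  exact Finsupp.supported_mono (fun m hm => h l hl m hm.1 hm.2) (listPrism_mem f g l)

/-- The homotopy from the identity to a map of chains carried by the lists themselves. -/
noncomputable def listCarry (φ : LChain α →ₗ[ℝ] LChain α) : List α → LChain α
  | [] => 0
  | v :: l => cone v (φ (Finsupp.single (v :: l) 1)) - cone v (listCarry φ l)

noncomputable def carry (φ : LChain α →ₗ[ℝ] LChain α) : LChain α →ₗ[ℝ] LChain α :=
  Finsupp.linearCombination ℝ (listCarry φ)

lemma carry_single (φ : LChain α →ₗ[ℝ] LChain α) (l : List α) :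
    carry φ (Finsupp.single l (1 : ℝ)) = listCarry φ l := by
  simp [carry]

lemma carry_cone (φ : LChain α →ₗ[ℝ] LChain α) (v : α) (x : LChain α) :
    carry φ (cone v x) = cone v (φ (cone v x)) - cone v (carry φ x) := by
  refine lchain_single_hom_ext (f := carry φ ∘ₗ cone v)
    (g := cone v ∘ₗ φ ∘ₗ cone v - cone v ∘ₗ carry φ) (fun l => ?_) x
  simp [cone_single, carry_single, listCarry]

lemma lbd_carry {φ : LChain α →ₗ[ℝ] LChain α} (h0 : φ (Finsupp.single [] 1) = Finsupp.single [] 1)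
    (hφ : ∀ x, lbd (φ x) = φ (lbd x)) (x : LChain α) :
    lbd (carry φ x) = φ x - x - carry φ (lbd x) := by
  refine lchain_hom_ext (f := lbd ∘ₗ carry φ) (g := φ - LinearMap.id - carry φ ∘ₗ lbd)
    ?_ (fun v l ih => ?_) x
  · simp [carry_single, lbd_single, listBd, listCarry, h0]
  · simp only [LinearMap.comp_apply, LinearMap.sub_apply, LinearMap.id_apply] at ih ⊢
    simp only [carry_cone, lbd_cone, map_sub, ih, hφ]
    abel

lemma listCarry_mem {φ : LChain α →ₗ[ℝ] LChain α}
    (hφ : ∀ l, φ (Finsupp.single l 1) ∈ lchains {m | m.length = l.length ∧ m ⊆ l}) (l : List α) :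
    listCarry φ l ∈ lchains {m | m.length = l.length + 1 ∧ m ⊆ l} := by
  induction l with
  | nil => exact Submodule.zero_mem _
  | cons v l ih =>
    refine Submodule.sub_mem _
      (cone_mem_lchains (P := {m | m.length = (v :: l).length ∧ m ⊆ v :: l})
        (Q := {m | m.length = (v :: l).length + 1 ∧ m ⊆ v :: l})
        (fun m hm => ⟨by simpa using hm.1, ?_⟩) (hφ _))
      (cone_mem_lchains (P := {m | m.length = l.length + 1 ∧ m ⊆ l})
        (Q := {m | m.length = (v :: l).length + 1 ∧ m ⊆ v :: l})
        (fun m hm => ⟨by simpa using hm.1, ?_⟩) ih)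
    · exact List.cons_subset.mpr ⟨by simp, hm.2⟩
    · exact List.cons_subset.mpr ⟨by simp, fun x hx => List.mem_cons_of_mem v (hm.2 hx)⟩

end ListChains

/-- The oriented simplex of a list. -/
noncomputable def listOrient : List ℕ → OChain
  | [] => Finsupp.single ∅ 1
  | v :: l => wedge v (listOrient l)

noncomputable def orient : LChain ℕ →ₗ[ℝ] OChain := Finsupp.linearCombination ℝ listOrient

lemma orient_single (l : List ℕ) : orient (Finsupp.single l (1 : ℝ)) = listOrient l := by
  simp [orient]

lemma orient_cone (v : ℕ) (x : LChain ℕ) : orient (cone v x) = wedge v (orient x) := by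
  refine lchain_single_hom_ext (f := orient ∘ₗ cone v) (g := wedge v ∘ₗ orient) (fun l => ?_) x
  simp [cone_single, orient_single, listOrient]

lemma orient_lbd (x : LChain ℕ) : orient (lbd x) = bd 1 (orient x) := by
  refine lchain_hom_ext (f := orient ∘ₗ lbd) (g := bd 1 ∘ₗ orient) ?_ (fun v l ih => ?_) x
  · simp only [LinearMap.comp_apply, orient_single, lbd_single, listBd, map_zero, listOrient]
    rw [bd_single subset_rfl]; simp
  · simp only [LinearMap.comp_apply] at ih ⊢
    simp [orient_cone, lbd_cone, bd_wedge, ih]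

lemma listOrient_mem (l : List ℕ) :
    listOrient l ∈ chains {s | s = l.toFinset ∧ s.card = l.length} := by
  induction l with
  | nil => exact Finsupp.single_mem_supported ℝ _ ⟨rfl, rfl⟩
  | cons v l ih =>
    refine chains_induction (fun s hs => ?_) ih
    rw [wedge_single]
    split_ifs with h
    · exact Submodule.zero_mem _
    · refine Finsupp.single_mem_supported ℝ _ ⟨by rw [hs.1]; simp, ?_⟩
      rw [Finset.card_insert_of_notMem h, hs.2]; rfl

lemma orient_mem_chains {P : Set (List ℕ)} {K : Set (Finset ℕ)}
    (h : ∀ l ∈ P, l.toFinset.card = l.length → l.toFinset ∈ K) {x : LChain ℕ}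
    (hx : x ∈ lchains P) : orient x ∈ chains K := by
  refine map_mem_of_mem_supported (fun l hl => ?_) hx
  rw [orient_single]
  refine chains_mono (fun s hs => ?_) (listOrient_mem l)
  have hs1 : s = l.toFinset := hs.1
  have hs2 : s.card = l.length := hs.2
  subst hs1
  exact h l hl hs2

/-- The ordered chain of an oriented chain. -/
noncomputable def order : OChain →ₗ[ℝ] LChain ℕ :=
  Finsupp.linearCombination ℝ fun s => Finsupp.single (s.sort (· ≤ ·)) 1

lemma order_single (s : Finset ℕ) (c : ℝ) :
    order (Finsupp.single s c) = Finsupp.single (s.sort (· ≤ ·)) c := by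
  simp [order]

lemma sort_insert_min {v : ℕ} {s : Finset ℕ} (h : ∀ w ∈ s, v < w) :
    (insert v s).sort (· ≤ ·) = v :: s.sort (· ≤ ·) :=
  Finset.sort_insert _ (fun w hw => (h w hw).le) (fun hv => lt_irrefl v (h v hv))

lemma placeSign_of_min {v : ℕ} {s : Finset ℕ} (h : ∀ w ∈ s, v < w) : placeSign v s = 1 := by
  unfold placeSign
  rw [Finset.filter_false_of_mem (fun w hw => not_lt_of_gt (h w hw))]
  simp

lemma wedge_single_of_min {v : ℕ} {s : Finset ℕ} (h : ∀ w ∈ s, v < w) (c : ℝ) :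
    wedge v (Finsupp.single s c) = Finsupp.single (insert v s) c := by
  rw [wedge_single, if_neg (fun hv => lt_irrefl v (h v hv)), placeSign_of_min h, mul_one]

lemma order_wedge {v : ℕ} {x : OChain} (hx : x ∈ chains {s | ∀ w ∈ s, v < w}) :
    order (wedge v x) = cone v (order x) := by
  have := map_mem_of_mem_supported (f := order ∘ₗ wedge v - cone v ∘ₗ order) (S := ⊥) (K := _)
    (fun s hs => ?_) hx
  · exact sub_eq_zero.mp (by simpa using this)
  · have hs : ∀ w ∈ s, v < w := hs
    simp [wedge_single_of_min hs, order_single, cone_single, sort_insert_min hs]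

lemma single_mem_chains_gt {v : ℕ} {s : Finset ℕ} (h : ∀ w ∈ s, v < w) :
    Finsupp.single s (1 : ℝ) ∈ chains {s | ∀ w ∈ s, v < w} :=
  Finsupp.single_mem_supported ℝ _ h

lemma orient_order (x : OChain) : orient (order x) = x := by
  refine ochain_hom_ext (f := orient ∘ₗ order) (g := LinearMap.id) (fun s => ?_) x
  induction s using Finset.induction_on_min with
  | empty => simp [order_single, orient_single, listOrient]
  | insert v s h ih =>
    simp only [LinearMap.comp_apply, LinearMap.id_apply] at ih ⊢
    rw [← wedge_single_of_min h, order_wedge (single_mem_chains_gt h), orient_cone, ih]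

lemma lbd_order (x : OChain) : lbd (order x) = order (bd 1 x) := by
  have h0 : ∀ s : Finset ℕ, lbd (order (Finsupp.single s 1)) =
      order (bd 1 (Finsupp.single s 1)) := by
    intro s
    induction s using Finset.induction_on_min with
    | empty =>
      rw [bd_single subset_rfl]
      simp [order_single, lbd_single, listBd]
    | insert v s h ih =>
      have hb : bd 1 (Finsupp.single s 1) ∈ chains {s | ∀ w ∈ s, v < w} :=
        bd_mem_chains (A := {s | ∀ w ∈ s, v < w}) (B := {s | ∀ w ∈ s, v < w}) 1
          (fun t (ht : ∀ w ∈ t, v < w) u _ =>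
          (fun w hw => ht w (Finset.mem_of_mem_erase hw) : ∀ w ∈ t.erase u, v < w))
          (single_mem_chains_gt h)
      rw [← wedge_single_of_min h, order_wedge (single_mem_chains_gt h), lbd_cone, ih, bd_wedge,
        map_sub, order_wedge hb]
      simp
  have : lbd ∘ₗ order = order ∘ₗ bd 1 := by
    apply Finsupp.lhom_ext'
    intro s
    ext1
    simpa using h0 s
  exact LinearMap.congr_fun this x

/-- The closed geometric simplex on `s`. -/
def face (s : Finset ℕ) : Set (ℕ → ℝ) :=
  {x | (∀ i, 0 ≤ x i) ∧ (∀ i, x i ≠ 0 → i ∈ s) ∧ ∑ i ∈ s, x i = 1}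

lemma mem_spaceOf {K : Set (Finset ℕ)} {x : ℕ → ℝ} : x ∈ spaceOf K ↔ ∃ s ∈ K, x ∈ face s :=
  ⟨fun ⟨h0, s, hs, h1, h2⟩ => ⟨s, hs, h0, h1, h2⟩, fun ⟨s, hs, h0, h1, h2⟩ => ⟨h0, s, hs, h1, h2⟩⟩

lemma face_mono {s t : Finset ℕ} (h : s ⊆ t) : face s ⊆ face t := by
  rintro x ⟨h0, h1, h2⟩
  refine ⟨h0, fun i hi => h (h1 i hi), ?_⟩
  rw [← h2]
  refine (Finset.sum_subset h fun i _ hi => ?_).symm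
  by_contra hx
  exact hi (h1 i hx)

lemma face_le_one {s : Finset ℕ} {x : ℕ → ℝ} (hx : x ∈ face s) (i : ℕ) : x i ≤ 1 := by
  by_cases hi : i ∈ s
  · rw [← hx.2.2]
    exact Finset.single_le_sum (fun j _ => hx.1 j) hi
  · by_contra h
    exact hi (hx.2.1 i (by intro h0; rw [h0] at h; norm_num at h))

lemma convex_face (s : Finset ℕ) : Convex ℝ (face s) := by
  rintro x ⟨h0, h1, h2⟩ y ⟨k0, k1, k2⟩ a b ha hb hab
  refine ⟨fun i => ?_, fun i hi => ?_, ?_⟩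
  · simpa using add_nonneg (mul_nonneg ha (h0 i)) (mul_nonneg hb (k0 i))
  · by_contra his
    have hx : x i = 0 := by_contra fun h => his (h1 i h)
    have hy : y i = 0 := by_contra fun h => his (k1 i h)
    simp [hx, hy] at hi
  · simp only [Pi.add_apply, Pi.smul_apply, smul_eq_mul]
    rw [Finset.sum_add_distrib, ← Finset.mul_sum, ← Finset.mul_sum, h2, k2, mul_one, mul_one, hab]

lemma single_mem_face {v : ℕ} {s : Finset ℕ} (h : v ∈ s) : (Pi.single v 1 : ℕ → ℝ) ∈ face s := by
  refine ⟨fun i => ?_, fun i hi => ?_, ?_⟩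
  · by_cases hi : i = v
    · subst hi; simp
    · simp [hi]
  · by_cases hi' : i = v
    · rwa [hi']
    · simp [hi'] at hi
  · simp [Finset.sum_pi_single', h]

lemma exists_ne_zero_of_mem_face {s : Finset ℕ} {x : ℕ → ℝ} (hx : x ∈ face s) : ∃ i, x i ≠ 0 := by
  by_contra! h
  simpa [h] using hx.2.2

lemma isCompact_face (s : Finset ℕ) : IsCompact (face s) := by
  have hc : IsCompact (Set.univ.pi fun _ : ℕ => Set.Icc (0 : ℝ) 1) :=
    isCompact_univ_pi fun _ => isCompact_Icc
  refine hc.of_isClosed_subset ?_ fun x hx i _ => ⟨hx.1 i, face_le_one hx i⟩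
  have : face s = (⋂ i, {x : ℕ → ℝ | 0 ≤ x i}) ∩ ((⋂ i, ⋂ (_ : i ∉ s), {x : ℕ → ℝ | x i = 0}) ∩
      {x : ℕ → ℝ | ∑ i ∈ s, x i = 1}) := by
    ext x
    simp only [face, Set.mem_inter_iff, Set.mem_iInter, Set.mem_ofPred_eq]
    refine and_congr Iff.rfl (and_congr (forall_congr' fun i => ?_) Iff.rfl)
    tauto
  rw [this]
  refine (isClosed_iInter fun i => isClosed_le continuous_const (continuous_apply i)).inter
    ((isClosed_iInter fun i => isClosed_iInter fun _ =>
      isClosed_eq (continuous_apply i) continuous_const).inter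
    (isClosed_eq (continuous_finsetSum _ fun i _ => continuous_apply i) continuous_const))

lemma isCompact_spaceOf {K : Set (Finset ℕ)} (hK : K.Finite) : IsCompact (spaceOf K) := by
  have : spaceOf K = ⋃ s ∈ K, face s := by
    ext x
    simp [mem_spaceOf]
  rw [this]
  exact hK.isCompact_biUnion fun s _ => isCompact_face s

/-- Moving towards the vertex `v`. -/
noncomputable def toward (v : ℕ) (t : ℝ) (x : ℕ → ℝ) : ℕ → ℝ :=
  (1 - t) • x + t • Pi.single v 1

lemma toward_zero (v : ℕ) : toward v 0 = id := by
  ext x i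
  simp [toward]

lemma toward_one (v : ℕ) : toward v 1 = fun _ => Pi.single v 1 := by
  ext x i
  simp [toward]

lemma toward_mem_face {v : ℕ} {s : Finset ℕ} (hv : v ∈ s) {x : ℕ → ℝ} (hx : x ∈ face s) {t : ℝ}
    (h0 : 0 ≤ t) (h1 : t ≤ 1) : toward v t x ∈ face s :=
  convex_face s hx (single_mem_face hv) (by linarith) h0 (by ring)

lemma abs_toward_sub_le {v : ℕ} {s : Finset ℕ} (hv : v ∈ s) {x y : ℕ → ℝ}
    (hy : y ∈ face s) {t u d e : ℝ} (h0 : 0 ≤ t) (h1 : t ≤ 1)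
    (htu : |t - u| ≤ e) {i : ℕ} (hd : |x i - y i| ≤ d) :
    |toward v t x i - toward v u y i| ≤ d + e := by
  have hs := single_mem_face hv
  have h2 : |y i - (Pi.single v 1 : ℕ → ℝ) i| ≤ 1 := by
    rw [abs_le]
    constructor <;> linarith [hy.1 i, hs.1 i, face_le_one hy i, face_le_one hs i]
  have h3 : toward v t x i - toward v u y i =
      (1 - t) * (x i - y i) + (u - t) * (y i - (Pi.single v 1 : ℕ → ℝ) i) := by
    simp only [toward, Pi.add_apply, Pi.smul_apply, smul_eq_mul]
    ring
  rw [h3]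
  refine (abs_add_le _ _).trans (add_le_add ?_ ?_)
  · rw [abs_mul, abs_of_nonneg (by linarith : 0 ≤ 1 - t)]
    nlinarith [abs_nonneg (x i - y i)]
  · rw [abs_mul, abs_sub_comm]
    nlinarith [abs_nonneg (t - u), abs_nonneg (y i - (Pi.single v 1 : ℕ → ℝ) i)]

/-- The subdivided join of the vertex `v` with a chain, cut into `M` layers. -/
noncomputable def layers (M : ℕ) (v : ℕ) : LChain (ℕ → ℝ) →ₗ[ℝ] LChain (ℕ → ℝ) :=
  cone (Pi.single v 1) ∘ₗ lmap (fun _ => Pi.single v 1) -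
    ∑ j ∈ Finset.range M, prism (toward v (j / M)) (toward v ((j + 1 : ℕ) / M))

/-- A subdivision of the simplex spanned by a list of vertices. -/
noncomputable def listSub (M : ℕ) : List ℕ → LChain (ℕ → ℝ)
  | [] => Finsupp.single [] 1
  | v :: l => layers M v (listSub M l)

/-- The subdivision operator. -/
noncomputable def subdiv (M : ℕ) : LChain ℕ →ₗ[ℝ] LChain (ℕ → ℝ) :=
  Finsupp.linearCombination ℝ (listSub M)

lemma subdiv_single (M : ℕ) (l : List ℕ) :
    subdiv M (Finsupp.single l (1 : ℝ)) = listSub M l := by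
  simp [subdiv]

lemma lmap_id {α : Type*} (x : LChain α) : lmap id x = x := by
  refine lchain_single_hom_ext (f := lmap id) (g := LinearMap.id) (fun l => ?_) x
  simp [lmap_single]

lemma lbd_sum_prism {α β : Type*} (f : ℕ → α → β) (T : ℕ) (x : LChain α) :
    lbd (∑ j ∈ Finset.range T, prism (f j) (f (j + 1)) x) =
      lmap (f T) x - lmap (f 0) x - ∑ j ∈ Finset.range T, prism (f j) (f (j + 1)) (lbd x) := by
  rw [map_sum, ← Finset.sum_range_sub (fun j => lmap (f j) x), ← Finset.sum_sub_distrib]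
  exact Finset.sum_congr rfl fun j _ => lbd_prism _ _ x

lemma lbd_layers {M : ℕ} (hM : 0 < M) (v : ℕ) (x : LChain (ℕ → ℝ)) :
    lbd (layers M v x) = x - layers M v (lbd x) := by
  have h := lbd_sum_prism (fun j : ℕ => toward v (j / M)) M x
  have hM' : (M : ℝ) ≠ 0 := by positivity
  simp only [Nat.cast_zero, zero_div, div_self hM', toward_zero, toward_one, lmap_id] at h
  simp only [layers, LinearMap.sub_apply, LinearMap.comp_apply, LinearMap.sum_apply, map_sub,
    lbd_cone, h, lbd_lmap]
  abel

lemma lbd_subdiv {M : ℕ} (hM : 0 < M) (x : LChain ℕ) : lbd (subdiv M x) = subdiv M (lbd x) := by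
  have hc : ∀ v x, subdiv M (cone v x) = layers M v (subdiv M x) := fun v x => by
    refine lchain_single_hom_ext (f := subdiv M ∘ₗ cone v) (g := layers M v ∘ₗ subdiv M)
      (fun l => ?_) x
    simp [cone_single, subdiv_single, listSub]
  refine lchain_hom_ext (f := lbd ∘ₗ subdiv M) (g := subdiv M ∘ₗ lbd) ?_ (fun v l ih => ?_) x
  · simp [subdiv_single, lbd_single, listBd, listSub]
  · simp only [LinearMap.comp_apply] at ih ⊢
    rw [hc, lbd_layers hM, ih, lbd_cone, map_sub, hc]

/-- Lists of points spanning a small simplex inside a given simplex. -/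
def smallLists (s : Finset ℕ) (m : ℕ) (d : ℝ) : Set (List (ℕ → ℝ)) :=
  {L | L.length = m ∧ (∀ p ∈ L, p ∈ face s) ∧ ∀ p ∈ L, ∀ q ∈ L, ∀ i, |p i - q i| ≤ d}

lemma listSub_mem {M : ℕ} (hM : 0 < M) (l : List ℕ) :
    listSub M l ∈ lchains (smallLists l.toFinset l.length (l.length / M)) := by
  induction l with
  | nil => exact Finsupp.single_mem_supported ℝ _ ⟨rfl, by simp, by simp⟩
  | cons v l ih =>
    have hM' : (0 : ℝ) < M := by positivity
    have hv : v ∈ (v :: l).toFinset := by simp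
    have hl : face l.toFinset ⊆ face (v :: l).toFinset := face_mono (by simp)
    simp only [listSub, layers, LinearMap.sub_apply, LinearMap.comp_apply, LinearMap.sum_apply]
    refine Submodule.sub_mem _ ?_ (Submodule.sum_mem _ fun j hj => ?_)
    · have h1 : lmap (fun _ => (Pi.single v 1 : ℕ → ℝ)) (listSub M l) ∈
          lchains {L | L.length = l.length ∧ ∀ p ∈ L, p = Pi.single v 1} :=
        lmap_mem_lchains (P := smallLists l.toFinset l.length (l.length / M))
          (Q := {L | L.length = l.length ∧ ∀ p ∈ L, p = Pi.single v 1})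
          (fun L hL => ⟨by simpa using hL.1, by simp⟩) ih
      refine cone_mem_lchains (P := {L | L.length = l.length ∧ ∀ p ∈ L, p = Pi.single v 1})
        (Q := smallLists (v :: l).toFinset (v :: l).length ((v :: l).length / M))
        (fun L hL => ?_) h1
      have h2 : ∀ p ∈ Pi.single v 1 :: L, p = (Pi.single v 1 : ℕ → ℝ) := by
        simpa using hL.2
      refine ⟨by simp [hL.1], fun p hp => ?_, fun p hp q hq i => ?_⟩
      · rw [h2 p hp]; exact single_mem_face hv
      · rw [h2 p hp, h2 q hq, sub_self, abs_zero]; positivity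
    · rw [Finset.mem_range] at hj
      have hb : ∀ u : ℝ, u = j / M ∨ u = (j + 1 : ℕ) / M → 0 ≤ u ∧ u ≤ 1 := by
        rintro u (rfl | rfl)
        · exact ⟨by positivity, by rw [div_le_one hM']; exact_mod_cast hj.le⟩
        · exact ⟨by positivity, by rw [div_le_one hM']; exact_mod_cast hj⟩
      have hbb : ∀ u w : ℝ, u = j / M ∨ u = (j + 1 : ℕ) / M → w = j / M ∨ w = (j + 1 : ℕ) / M →
          |u - w| ≤ 1 / M := by
        have h5 : ((j + 1 : ℕ) : ℝ) / M - j / M = 1 / M := by push_cast; ring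
        have h6 : (0 : ℝ) ≤ 1 / M := by positivity
        rintro u w (rfl | rfl) (rfl | rfl)
        · simp
        · rw [abs_sub_comm, h5, abs_of_nonneg h6]
        · rw [h5, abs_of_nonneg h6]
        · simp
      refine prism_mem_lchains (P := smallLists l.toFinset l.length (l.length / M))
        (fun L hL m hm hmL => ?_) ih
      have h3 : ∀ q ∈ m, ∃ p ∈ L, ∃ u : ℝ, (u = j / M ∨ u = (j + 1 : ℕ) / M) ∧
          q = toward v u p := by
        intro q hq
        obtain ⟨p, hp, h | h⟩ := hmL q hq
        · exact ⟨p, hp, _, Or.inl rfl, h⟩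
        · exact ⟨p, hp, _, Or.inr rfl, h⟩
      refine ⟨by rw [hm, hL.1]; rfl, fun q hq => ?_, fun q hq r hr i => ?_⟩
      · obtain ⟨p, hp, u, hu, rfl⟩ := h3 q hq
        exact toward_mem_face hv (hl (hL.2.1 p hp)) (hb u hu).1 (hb u hu).2
      · obtain ⟨p, hp, u, hu, rfl⟩ := h3 q hq
        obtain ⟨p', hp', u', hu', rfl⟩ := h3 r hr
        refine (abs_toward_sub_le hv (hl (hL.2.1 p' hp')) (hb u hu).1 (hb u hu).2
          (hbb u u' hu hu') (hL.2.2 p hp p' hp' i)).trans (le_of_eq ?_)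
        rw [List.length_cons]; push_cast; ring

/-- A vertex whose coordinate is positive, and at least `ε` if possible. -/
lemma exists_big_coord (ε : ℝ) (hε : 0 < ε) :
    ∃ a : (ℕ → ℝ) → ℕ, ∀ x : ℕ → ℝ, (∃ i, x i ≠ 0) →
      x (a x) ≠ 0 ∧ ((∃ i, ε ≤ x i) → ε ≤ x (a x)) := by
  have : ∀ x : ℕ → ℝ, ∃ v, (∃ i, x i ≠ 0) → x v ≠ 0 ∧ ((∃ i, ε ≤ x i) → ε ≤ x v) := by
    intro x
    by_cases h : ∃ i, ε ≤ x i
    · obtain ⟨i, hi⟩ := h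
      exact ⟨i, fun _ => ⟨by linarith, fun _ => hi⟩⟩
    · by_cases h' : ∃ i, x i ≠ 0
      · obtain ⟨i, hi⟩ := h'
        exact ⟨i, fun _ => ⟨hi, fun h'' => (h h'').elim⟩⟩
      · exact ⟨0, fun h'' => (h' h'').elim⟩
  choose a ha using this
  exact ⟨a, ha⟩

lemma exists_coord_ge {s : Finset ℕ} {x : ℕ → ℝ} (hx : x ∈ face s) {N : ℕ} (hN : s.card ≤ N) :
    ∃ i, 1 / (N : ℝ) ≤ x i := by
  have hs : s.Nonempty := by
    rw [Finset.nonempty_iff_ne_empty]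
    rintro rfl
    simpa using hx.2.2
  have hN0 : (0 : ℝ) < N := by exact_mod_cast hs.card_pos.trans_le hN
  by_contra! h
  have h1 := Finset.sum_lt_sum_of_nonempty hs fun i _ => h i
  rw [hx.2.2, Finset.sum_const, nsmul_eq_mul, mul_one_div, lt_div_iff₀ hN0, one_mul] at h1
  exact absurd (Nat.cast_lt.mp h1) (not_lt.mpr hN)

lemma lbd_sub_eq {M : ℕ} (hM : 0 < M) (a : (ℕ → ℝ) → ℕ) (y : LChain ℕ) :
    lbd (carry (lmap a ∘ₗ subdiv M) y) =
      lmap a (subdiv M y) - y - carry (lmap a ∘ₗ subdiv M) (lbd y) := by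
  refine lbd_carry (φ := lmap a ∘ₗ subdiv M) ?_ (fun x => ?_) y
  · simp [subdiv_single, listSub, lmap_single]
  · simp only [LinearMap.comp_apply]
    rw [lbd_lmap, lbd_subdiv hM]

lemma lmap_subdiv_mem {M : ℕ} (hM : 0 < M) {a : (ℕ → ℝ) → ℕ}
    (ha : ∀ s, ∀ x ∈ face s, x (a x) ≠ 0) (l : List ℕ) :
    lmap a (subdiv M (Finsupp.single l 1)) ∈ lchains {m | m.length = l.length ∧ m ⊆ l} := by
  rw [subdiv_single]
  refine lmap_mem_lchains (P := smallLists l.toFinset l.length (l.length / M))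
    (Q := {m | m.length = l.length ∧ m ⊆ l})
    (fun L hL => ⟨by simpa using hL.1, fun v hv => ?_⟩) (listSub_mem hM l)
  obtain ⟨p, hp, rfl⟩ := List.mem_map.mp hv
  have hp' := hL.2.1 p hp
  simpa using hp'.2.1 _ (ha _ p hp')

lemma exists_uniform_modulus {X : Set (ℕ → ℝ)} (hX : IsCompact X) {Y : Type*}
    [PseudoMetricSpace Y] {F : unitInterval × X → Y} (hF : Continuous F) {ε : ℝ} (hε : 0 < ε) :
    ∃ m : ℕ, ∀ (s t : unitInterval) (p q : X), |(s : ℝ) - t| ≤ 1 / (m + 1) →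
      (∀ i, |(p : ℕ → ℝ) i - (q : ℕ → ℝ) i| ≤ 1 / (m + 1)) → dist (F (s, p)) (F (t, q)) < ε := by
  by_contra! h
  choose s t p q hst hpq hd using h
  have := isCompact_iff_compactSpace.mp hX
  have hu := CompactSpace.uniformContinuous_of_continuous hF
  have h0 : Filter.Tendsto (fun m : ℕ => 1 / ((m : ℝ) + 1)) Filter.atTop (nhds 0) :=
    tendsto_one_div_add_atTop_nhds_zero_nat
  have h1 : Filter.Tendsto (fun m => ((s m, p m), (t m, q m))) Filter.atTop
      (uniformity (unitInterval × X)) := by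
    rw [uniformity_prod, Filter.tendsto_inf]
    constructor
    · rw [Filter.tendsto_comap_iff, uniformity_subtype, Filter.tendsto_comap_iff]
      refine tendsto_uniformity_iff_dist_tendsto_zero.mpr ?_
      exact squeeze_zero (fun _ => dist_nonneg) (fun m => hst m) h0
    · rw [Filter.tendsto_comap_iff, uniformity_subtype, Filter.tendsto_comap_iff, Pi.uniformity,
        Filter.tendsto_iInf]
      intro i
      rw [Filter.tendsto_comap_iff]
      refine tendsto_uniformity_iff_dist_tendsto_zero.mpr ?_
      exact squeeze_zero (fun _ => dist_nonneg) (fun m => hpq m i) h0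
  have h2 := tendsto_uniformity_iff_dist_tendsto_zero.mp (Filter.Tendsto.comp hu h1)
  obtain ⟨m, hm⟩ := (h2.eventually (gt_mem_nhds hε)).exists
  exact absurd hm (not_lt.mpr (hd m))

lemma exists_vertex_bound {K : Set (Finset ℕ)} (hK : K.Finite) :
    ∃ V : Finset ℕ, ∀ s ∈ K, s ⊆ V := by
  refine ⟨hK.toFinset.sup id, fun s hs => ?_⟩
  exact Finset.le_sup (f := id) (hK.mem_toFinset.mpr hs)

lemma exists_uniform_modulus_coord {X : Set (ℕ → ℝ)} (hX : IsCompact X) {V : Finset ℕ}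
    (hV : ∀ x ∈ X, ∀ i, x i ≠ 0 → i ∈ V) {F : unitInterval × X → X} (hF : Continuous F) {ε : ℝ}
    (hε : 0 < ε) :
    ∃ m : ℕ, ∀ (s t : unitInterval) (p q : X), |(s : ℝ) - t| ≤ 1 / (m + 1) →
      (∀ i, |(p : ℕ → ℝ) i - (q : ℕ → ℝ) i| ≤ 1 / (m + 1)) →
      ∀ i, |(F (s, p) : ℕ → ℝ) i - (F (t, q) : ℕ → ℝ) i| < ε := by
  have hc : Continuous fun z => fun v : V => (F z : ℕ → ℝ) v :=
    continuous_pi fun v => (continuous_apply (v : ℕ)).comp (continuous_subtype_val.comp hF)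
  obtain ⟨m, hm⟩ := exists_uniform_modulus hX hc hε
  refine ⟨m, fun s t p q hst hpq i => ?_⟩
  by_cases hi : i ∈ V
  · exact (dist_le_pi_dist _ _ (⟨i, hi⟩ : V)).trans_lt (hm s t p q hst hpq)
  · have h1 : (F (s, p) : ℕ → ℝ) i = 0 := by_contra fun h => hi (hV _ (F (s, p)).2 i h)
    have h2 : (F (t, q) : ℕ → ℝ) i = 0 := by_contra fun h => hi (hV _ (F (t, q)).2 i h)
    rw [h1, h2]
    simpa using hε

lemma support_subset_of_mem_spaceOf {K : Set (Finset ℕ)} {V : Finset ℕ} (hV : ∀ s ∈ K, s ⊆ V)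
    {x : ℕ → ℝ} (hx : x ∈ spaceOf K) (i : ℕ) (hi : x i ≠ 0) : i ∈ V := by
  obtain ⟨s, hs, hxs⟩ := mem_spaceOf.mp hx
  exact hV s hs (hxs.2.1 i hi)

lemma subset_of_forall_ne_zero {K : Set (Finset ℕ)} (hK : IsComplex K) {x : ℕ → ℝ}
    (hx : x ∈ spaceOf K) {t : Finset ℕ} (ht : ∀ i ∈ t, x i ≠ 0) : t ∈ K := by
  obtain ⟨s, hs, hxs⟩ := mem_spaceOf.mp hx
  exact hK s hs t fun i hi => hxs.2.1 i (ht i hi)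

lemma order_mem_lchains {K : Set (Finset ℕ)} {x : OChain} (hx : x ∈ chains K) :
    order x ∈ lchains {l | l.toFinset ∈ K ∧ l.length = l.toFinset.card} := by
  refine map_mem_of_mem_supported (fun s hs => ?_) hx
  rw [order_single]
  exact Finsupp.single_mem_supported ℝ _ ⟨by simpa using hs, by simp⟩

lemma orient_lmap_subdiv_order {M : ℕ} (hM : 0 < M) {a : (ℕ → ℝ) → ℕ}
    (ha : ∀ s, ∀ x ∈ face s, x (a x) ≠ 0) (x : OChain) :
    orient (lmap a (subdiv M (order x))) = x := by
  have h0 : ∀ x, orient (carry (lmap a ∘ₗ subdiv M) (order x)) = 0 := by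
    intro x
    have hx : x ∈ chains Set.univ := by simp [chains]
    have : carry (lmap a ∘ₗ subdiv M) (order x) ∈ lchains {m | m.toFinset.card ≠ m.length} := by
      refine map_mem_of_mem_supported (fun l hl => ?_) (order_mem_lchains hx)
      rw [carry_single]
      have hl2 : l.length = l.toFinset.card := hl.2
      have : {m : List ℕ | m.length = l.length + 1 ∧ m ⊆ l} ⊆
          {m | m.toFinset.card ≠ m.length} := by
        rintro m ⟨hm1, hm2⟩ hm
        have := Finset.card_le_card (s := m.toFinset) (t := l.toFinset)
          (fun i hi => by simpa using hm2 (by simpa using hi))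
        omega
      exact Finsupp.supported_mono this (listCarry_mem (lmap_subdiv_mem hM ha) l)
    exact eq_zero_of_mem_chains (K := ∅) (orient_mem_chains
      (P := {m | m.toFinset.card ≠ m.length}) (fun l hl h => (hl h).elim) this) (by simp)
  have h1 := congrArg orient (lbd_sub_eq hM a (order x))
  rw [orient_lbd, h0, map_zero, map_sub, map_sub, lbd_order, h0, orient_order, sub_zero] at h1
  exact (sub_eq_zero.mp h1.symm)

/-- Lists of points of the realization of `K` within distance `d` of each other. -/
def closeLists (K : Set (Finset ℕ)) (d : ℝ) : Set (List (ℕ → ℝ)) :=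
  {L | (∀ p ∈ L, p ∈ spaceOf K) ∧ ∀ p ∈ L, ∀ q ∈ L, ∀ i, |p i - q i| ≤ d}

lemma closeLists_mono (K : Set (Finset ℕ)) {d e : ℝ} (h : d ≤ e) :
    closeLists K d ⊆ closeLists K e :=
  fun _ hL => ⟨hL.1, fun p hp q hq i => (hL.2 p hp q hq i).trans h⟩

lemma subdiv_order_mem {K : Set (Finset ℕ)} {V : Finset ℕ} (hV : ∀ s ∈ K, s ⊆ V) {M : ℕ}
    (hM : 0 < M) {x : OChain} (hx : x ∈ chains K) :
    subdiv M (order x) ∈ lchains (closeLists K (V.card / M)) := by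
  refine map_mem_of_mem_supported (fun l hl => ?_) (order_mem_lchains hx)
  have hl1 : l.toFinset ∈ K := hl.1
  have hl2 : l.length = l.toFinset.card := hl.2
  rw [subdiv_single]
  have hlV : l.length ≤ V.card := hl2 ▸ Finset.card_le_card (hV _ hl1)
  have : smallLists l.toFinset l.length (l.length / M) ⊆ closeLists K (V.card / M) :=
    fun L hL => ⟨fun p hp => mem_spaceOf.mpr ⟨_, hl1, hL.2.1 p hp⟩,
      fun p hp q hq i => (hL.2.2 p hp q hq i).trans (by gcongr)⟩
  exact Finsupp.supported_mono this (listSub_mem hM l)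

theorem acyclic_of_contractible {K : Set (Finset ℕ)} (hK : IsComplex K) (hf : K.Finite)
    [ContractibleSpace (spaceOf K)] : Acyclic K := by
  intro z hz h0
  obtain ⟨x₀, ⟨H⟩⟩ := id_nullhomotopic (spaceOf K)
  obtain ⟨V, hV⟩ := exists_vertex_bound hf
  have hVx := fun x hx => support_subset_of_mem_spaceOf (x := x) hV hx
  set N : ℕ := V.card + 1 with hN
  have hN0 : (0 : ℝ) < 1 / N := by positivity
  obtain ⟨a, ha⟩ := exists_big_coord (1 / (N : ℝ)) hN0
  have haf : ∀ s, ∀ x ∈ face s, x (a x) ≠ 0 := fun s x hx =>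
    (ha x (exists_ne_zero_of_mem_face hx)).1
  have haK : ∀ x ∈ spaceOf K, 1 / (N : ℝ) ≤ x (a x) := by
    intro x hx
    obtain ⟨s, hs, hxs⟩ := mem_spaceOf.mp hx
    exact (ha x (exists_ne_zero_of_mem_face hxs)).2
      (exists_coord_ge hxs ((Finset.card_le_card (hV s hs)).trans (Nat.le_succ _)))
  obtain ⟨m, hm⟩ := exists_uniform_modulus_coord (isCompact_spaceOf hf) hVx (F := H)
    H.continuous hN0
  set T : ℕ := m + 1 with hT
  have hT0 : (0 : ℝ) < T := by positivity
  set M : ℕ := N * T with hMdef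
  have hM : 0 < M := by positivity
  set P : Set (List (ℕ → ℝ)) := closeLists K (1 / (m + 1)) with hP
  set y := order z with hy
  have hby : lbd y = 0 := by rw [hy, lbd_order, h0, map_zero]
  have hSy : subdiv M y ∈ lchains P := by
    refine Finsupp.supported_mono (closeLists_mono K ?_) (subdiv_order_mem hV hM hz)
    rw [hMdef, div_le_div_iff₀ (by positivity) (by positivity), hT, hN]
    push_cast
    nlinarith [(Nat.cast_nonneg m : (0 : ℝ) ≤ m), (Nat.cast_nonneg V.card : (0 : ℝ) ≤ V.card)]
  have hbS : lbd (subdiv M y) = 0 := by rw [lbd_subdiv hM, hby, map_zero]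
  classical
  let G : ℝ → (ℕ → ℝ) → spaceOf K := fun t x =>
    if h : x ∈ spaceOf K then H (Set.projIcc 0 1 zero_le_one t, ⟨x, h⟩) else x₀
  let f : ℕ → (ℕ → ℝ) → ℕ := fun j x => a (G (j / T) x)
  have hf0 : lmap (f 0) (subdiv M y) = lmap a (subdiv M y) := by
    refine sub_eq_zero.mp ((Submodule.mem_bot ℝ).mp (map_mem_of_mem_supported
      (f := lmap (f 0) - lmap a) (fun L hL => ?_) hSy))
    have : L.map (f 0) = L.map a := List.map_congr_left fun x hx => by
      simp [f, G, hL.1 x hx]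
    simp [lmap_single, this]
  have hfT : lmap (f T) (subdiv M y) = lmap (fun _ => a x₀) (subdiv M y) := by
    refine sub_eq_zero.mp ((Submodule.mem_bot ℝ).mp (map_mem_of_mem_supported
      (f := lmap (f T) - lmap (fun _ => a x₀)) (fun L hL => ?_) hSy))
    have : L.map (f T) = L.map (fun _ => a x₀) := List.map_congr_left fun x hx => by
      simp [f, G, hL.1 x hx]
    simp only [LinearMap.sub_apply, lmap_single, this, sub_self, Submodule.mem_bot]
  set R := ∑ j ∈ Finset.range T, prism (f j) (f (j + 1)) (subdiv M y) with hR
  have hbR : lbd R = lmap (fun _ => a x₀) (subdiv M y) - lmap a (subdiv M y) := by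
    rw [hR, lbd_sum_prism, hbS, hf0, hfT]
    simp
  have hRK : R ∈ lchains {l | l.toFinset ∈ K} := by
    refine Submodule.sum_mem _ fun j hj => prism_mem_lchains (P := P) (Q := {l | l.toFinset ∈ K})
      (fun L hL l hl hlL => ?_) hSy
    cases L with
    | nil =>
      obtain ⟨q, rfl⟩ := List.length_eq_one_iff.mp hl
      obtain ⟨p, hp, -⟩ := hlL q (by simp)
      simp at hp
    | cons p L =>
      have hp : p ∈ spaceOf K := hL.1 p (by simp)
      refine subset_of_forall_ne_zero hK (G (j / T) p).2 fun i hi => ?_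
      have hclose : ∀ q ∈ p :: L, ∀ j', (j' = j ∨ j' = j + 1) → ∀ i,
          |(G (j / T) p : ℕ → ℝ) i - (G (j' / T : ℝ) q : ℕ → ℝ) i| < 1 / N := by
        intro q hq j' hj' i
        have hq' : q ∈ spaceOf K := hL.1 q hq
        simp only [G, hp, hq', dif_pos]
        refine hm _ _ _ _ ?_ (fun i => hL.2 p (by simp) q hq i) i
        refine (Set.abs_projIcc_sub_projIcc _).trans ?_
        rcases hj' with rfl | rfl
        · simp; positivity
        · rw [abs_sub_comm, ← sub_div]
          push_cast
          rw [add_sub_cancel_left, abs_of_nonneg (by positivity), hT]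
          push_cast
          rfl
      obtain ⟨q, hq, h⟩ := hlL i (by simpa using hi)
      obtain ⟨j', hj', rfl⟩ : ∃ j', (j' = j ∨ j' = j + 1) ∧ i = f j' q := by
        rcases h with h | h
        · exact ⟨j, Or.inl rfl, h⟩
        · exact ⟨j + 1, Or.inr rfl, h⟩
      have h1 := hclose q hq j' hj' (f j' q)
      have h2 := haK _ (G (j' / T) q).2
      change 1 / (N : ℝ) ≤ (G (j' / T : ℝ) q : ℕ → ℝ) (f j' q) at h2
      intro h3
      rw [h3, zero_sub, abs_neg] at h1
      linarith [le_abs_self ((G (j' / T : ℝ) q : ℕ → ℝ) (f j' q))]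
  set C := cone (a x₀) (lmap (fun _ => a x₀) (subdiv M y)) with hC
  have hbC : lbd C = lmap (fun _ => a x₀) (subdiv M y) := by
    rw [hC, lbd_cone, lbd_lmap, hbS]
    simp
  have hCK : C ∈ lchains {l | l.toFinset ∈ K} := by
    have h1 : lmap (fun _ => a x₀) (subdiv M y) ∈ lchains {l | ∀ i ∈ l, i = a x₀} :=
      lmap_mem_lchains (P := P) (Q := {l | ∀ i ∈ l, i = a x₀}) (fun L _ => by simp) hSy
    refine cone_mem_lchains (P := {l | ∀ i ∈ l, i = a x₀}) (Q := {l | l.toFinset ∈ K})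
      (fun l hl => subset_of_forall_ne_zero hK x₀.2 fun i hi => ?_) h1
    have hi' : i = a x₀ := by
      rcases List.mem_cons.mp (List.mem_toFinset.mp hi) with h | h
      · exact h
      · exact hl i h
    rw [hi']
    exact (lt_of_lt_of_le hN0 (haK _ x₀.2)).ne'
  refine ⟨orient (C - R), orient_mem_chains (P := {l | l.toFinset ∈ K}) (fun l hl _ => hl)
    (Submodule.sub_mem _ hCK hRK), ?_⟩
  rw [← orient_lbd, map_sub, hbC, hbR, sub_sub_cancel, orient_lmap_subdiv_order hM haf]

/-- Shifts of the integer lattice avoiding a point. -/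
lemma exists_shift {d : ℕ} (y : Fin d → ℝ) :
    ∃ j : Fin (d + 1), ∀ i, ∀ m : ℤ,
      1 / (2 * ((d : ℝ) + 1)) ≤ |y i + (j : ℕ) / ((d : ℝ) + 1) - m| := by
  by_contra! h
  choose i m him using h
  obtain ⟨j, j', hjj, hi⟩ := Fintype.exists_ne_map_eq_of_card_lt i (by simp)
  have h1 := him j
  have h2 := him j'
  rw [← hi] at h2
  have hd : (0 : ℝ) < (d : ℝ) + 1 := by positivity
  have h3 : |((j : ℕ) : ℝ) - (j' : ℕ) - (m j - m j') * ((d : ℝ) + 1)| < 1 := by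
    have h4 : ((j : ℕ) : ℝ) - (j' : ℕ) - (m j - m j') * ((d : ℝ) + 1) =
        ((y (i j) + (j : ℕ) / ((d : ℝ) + 1) - m j) -
          (y (i j) + (j' : ℕ) / ((d : ℝ) + 1) - m j')) * ((d : ℝ) + 1) := by
      field_simp
      ring
    rw [h4, abs_mul, abs_of_pos hd, ← lt_div_iff₀ hd]
    refine (abs_sub _ _).trans_lt ((add_lt_add h1 h2).trans_eq ?_)
    field_simp
    norm_num
  have h5 : |((j : ℕ) : ℤ) - (j' : ℕ) - (m j - m j') * ((d : ℤ) + 1)| < 1 := by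
    exact_mod_cast h3
  rw [Int.abs_lt_one_iff] at h5
  have h6 : ((j : ℕ) : ℤ) ≡ (j' : ℕ) [ZMOD ((d : ℤ) + 1)] := by
    rw [Int.modEq_comm, Int.modEq_iff_dvd]
    exact ⟨m j - m j', by linarith⟩
  have h7 : (j : ℕ) ≡ j' [MOD (d + 1)] := by
    rw [← Int.natCast_modEq_iff]
    exact_mod_cast h6
  exact hjj (Fin.ext (Nat.ModEq.eq_of_lt_of_lt h7 j.2 j'.2))

lemma floor_eq_of_far {δ u w : ℝ} (hu : ∀ m : ℤ, δ ≤ |u - m|) (hw : ∀ m : ℤ, δ ≤ |w - m|)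
    (h : |u - w| < 2 * δ) : ⌊u⌋ = ⌊w⌋ := by
  have key : ∀ u w : ℝ, (∀ m : ℤ, δ ≤ |u - m|) → (∀ m : ℤ, δ ≤ |w - m|) →
      |u - w| < 2 * δ → ¬ ⌊u⌋ < ⌊w⌋ := by
    intro u w hu hw h hlt
    have h1 : u < ⌊w⌋ := Int.floor_lt.mp hlt
    have h2 := Int.floor_le w
    have h3 := hu ⌊w⌋
    have h4 := hw ⌊w⌋
    rw [abs_of_nonpos (by linarith)] at h3
    rw [abs_of_nonneg (by linarith)] at h4
    rw [abs_lt] at h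
    linarith
  exact le_antisymm (not_lt.mp (key w u hw hu (by rwa [abs_sub_comm])))
    (not_lt.mp (key u w hu hw h))

/-- A decomposition of Euclidean space into small cells with `d + 1` colours such that nearby
points of the same colour lie in the same cell. -/
lemma exists_cells (d : ℕ) {η : ℝ} (hη : 0 < η) :
    ∃ (ι : Type) (cell : EuclideanSpace ℝ (Fin d) → ι) (colour : ι → Fin (d + 1)) (ε : ℝ),
      0 < ε ∧ (∀ y z, cell y = cell z → dist y z < η) ∧
      ∀ y z, dist y z < ε → colour (cell y) = colour (cell z) → cell y = cell z := by
  set e : ℝ := η / (d + 1) with he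
  have hd : (0 : ℝ) < (d : ℝ) + 1 := by positivity
  have he0 : 0 < e := by positivity
  choose c hc using fun y : EuclideanSpace ℝ (Fin d) => exists_shift (fun i => y i / e)
  refine ⟨Fin (d + 1) × (Fin d → ℤ),
    fun y => (c y, fun i => ⌊y i / e + (c y : ℕ) / ((d : ℝ) + 1)⌋), Prod.fst, e / (d + 1),
    by positivity, fun y z h => ?_, fun y z h hcol => ?_⟩
  · rw [Prod.ext_iff] at h
    have h1 : c y = c z := h.1
    have h2 : ∀ i, |y i - z i| ≤ e := by
      intro i
      have h3 : ⌊y i / e + (c y : ℕ) / ((d : ℝ) + 1)⌋ = ⌊z i / e + (c y : ℕ) / ((d : ℝ) + 1)⌋ := by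
        have := congrFun h.2 i
        simpa only [← h1] using this
      have h4 := Int.abs_sub_lt_one_of_floor_eq_floor h3
      rw [add_sub_add_right_eq_sub, ← sub_div, abs_div, abs_of_pos he0, div_lt_one he0] at h4
      exact h4.le
    rw [EuclideanSpace.dist_eq, Real.sqrt_lt' hη]
    have h5 : ∑ i, dist (y i) (z i) ^ 2 ≤ ∑ _i : Fin d, e ^ 2 :=
      Finset.sum_le_sum fun i _ => pow_le_pow_left₀ dist_nonneg (h2 i) 2
    refine h5.trans_lt ?_
    have h6 : η = e * (d + 1) := by rw [he]; field_simp
    rw [Finset.sum_const, Finset.card_univ, Fintype.card_fin, nsmul_eq_mul, h6, mul_pow]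
    have h7 : (d : ℝ) < ((d : ℝ) + 1) ^ 2 := by nlinarith [(Nat.cast_nonneg d : (0 : ℝ) ≤ d)]
    nlinarith [pow_pos he0 2]
  · have hcol : c y = c z := hcol
    refine Prod.ext hcol (funext fun i => ?_)
    simp only [← hcol]
    refine floor_eq_of_far (δ := 1 / (2 * ((d : ℝ) + 1))) (hc y i) ?_ ?_
    · have := hc z i
      rwa [← hcol] at this
    · rw [add_sub_add_right_eq_sub, ← sub_div, abs_div, abs_of_pos he0, div_lt_iff₀ he0]
      have h1 : |y i - z i| ≤ dist y z := by
        rw [dist_eq_norm]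
        exact PiLp.norm_apply_le (y - z) i
      refine (h1.trans_lt h).trans_eq ?_
      field_simp

theorem card_le_of_homeomorph {d : ℕ} {K : Set (Finset ℕ)} (hf : K.Finite)
    (h : spaceOf K ≃ₜ Metric.closedBall (0 : EuclideanSpace ℝ (Fin d)) 1) {s : Finset ℕ}
    (hs : s ∈ K) : s.card ≤ d + 1 := by
  classical
  by_contra! hsd
  obtain ⟨V, hV⟩ := exists_vertex_bound hf
  have hVx := fun x hx => support_subset_of_mem_spaceOf (x := x) hV hx
  set N : ℕ := V.card + 1 with hN
  have hN0 : (0 : ℝ) < 1 / N := by positivity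
  obtain ⟨a, ha⟩ := exists_big_coord (1 / (N : ℝ)) hN0
  have haK : ∀ x ∈ spaceOf K, 1 / (N : ℝ) ≤ x (a x) := by
    intro x hx
    obtain ⟨s, hs, hxs⟩ := mem_spaceOf.mp hx
    exact (ha x (exists_ne_zero_of_mem_face hxs)).2
      (exists_coord_ge hxs ((Finset.card_le_card (hV s hs)).trans (Nat.le_succ _)))
  have : CompactSpace (spaceOf K) := isCompact_iff_compactSpace.mp (isCompact_spaceOf hf)
  obtain ⟨η, hη, hinv⟩ : ∃ η > 0, ∀ x y : spaceOf K, dist (h x) (h y) < η →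
      ∀ i, |(x : ℕ → ℝ) i - (y : ℕ → ℝ) i| < 1 / N := by
    have hc : Continuous fun z => fun v : V => (h.symm z : ℕ → ℝ) v :=
      continuous_pi fun v => (continuous_apply (v : ℕ)).comp
        (continuous_subtype_val.comp h.symm.continuous)
    have := isCompact_iff_compactSpace.mp
      (isCompact_closedBall (0 : EuclideanSpace ℝ (Fin d)) 1)
    obtain ⟨η, hη, hη'⟩ := Metric.uniformContinuous_iff.mp
      (CompactSpace.uniformContinuous_of_continuous hc) _ hN0
    refine ⟨η, hη, fun x y hxy i => ?_⟩
    by_cases hi : i ∈ V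
    · simpa [Real.dist_eq] using (dist_le_pi_dist _ _ (⟨i, hi⟩ : V)).trans_lt (hη' hxy)
    · have h1 : (x : ℕ → ℝ) i = 0 := by_contra fun h => hi (hVx _ x.2 i h)
      have h2 : (y : ℕ → ℝ) i = 0 := by_contra fun h => hi (hVx _ y.2 i h)
      rw [h1, h2]
      simpa using hN0
  obtain ⟨ι, cell, colour, ε, hε, hcell, hcolour⟩ := exists_cells d hη
  obtain ⟨m, hm⟩ := exists_uniform_modulus (isCompact_spaceOf hf) (F := fun z => h z.2)
    (h.continuous.comp continuous_snd) hε
  set M : ℕ := N * (m + 1) with hMdef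
  have hM : 0 < M := by positivity
  have hne : Nonempty (spaceOf K) := ⟨h.symm ⟨0, by simp⟩⟩
  set g : spaceOf K → ι := fun x => cell (h x) with hg
  set b : (ℕ → ℝ) → ℕ := fun x => if hx : x ∈ spaceOf K then
    a (Function.invFun g (g ⟨x, hx⟩) : spaceOf K) else a x with hb
  have hbf : ∀ s, ∀ x ∈ face s, x (b x) ≠ 0 := by
    intro s x hx
    by_cases hxK : x ∈ spaceOf K
    · simp only [hb, hxK, dif_pos]
      set r := Function.invFun g (g ⟨x, hxK⟩) with hr
      have h1 : g r = g ⟨x, hxK⟩ := Function.invFun_eq ⟨_, rfl⟩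
      have h2 := hinv r ⟨x, hxK⟩ (hcell _ _ h1) (a r)
      have h3 := haK r r.2
      intro h4
      simp only [h4, sub_zero] at h2
      linarith [le_abs_self ((r : ℕ → ℝ) (a r))]
    · simp only [hb, hxK, dif_neg, not_false_eq_true]
      exact (ha x (exists_ne_zero_of_mem_face hx)).1
  have h1 := orient_lmap_subdiv_order hM hbf (Finsupp.single s 1)
  have h2 : orient (lmap b (subdiv M (order (Finsupp.single s 1)))) = 0 := by
    refine eq_zero_of_mem_chains (K := ∅) ?_ (by simp)
    refine orient_mem_chains (P := {l | l.toFinset.card ≠ l.length})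
      (fun l hl h => (hl h).elim) ?_
    rw [order_single, subdiv_single]
    refine lmap_mem_lchains (P := smallLists (s.sort (· ≤ ·)).toFinset (s.sort (· ≤ ·)).length
      ((s.sort (· ≤ ·)).length / M)) (Q := {l | l.toFinset.card ≠ l.length}) (fun L hL => ?_)
      (listSub_mem hM _)
    obtain ⟨hL1, hL2, hL3⟩ := hL
    simp only [Finset.length_sort, Finset.sort_toFinset] at hL1 hL2 hL3
    have hLK : ∀ p ∈ L, p ∈ spaceOf K := fun p hp => mem_spaceOf.mpr ⟨s, hs, hL2 p hp⟩
    have hLd : ∀ p ∈ L, ∀ q ∈ L, ∀ i, |p i - q i| ≤ 1 / (m + 1) := by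
      intro p hp q hq i
      refine (hL3 p hp q hq i).trans ?_
      have hsV : (s.card : ℝ) ≤ V.card := by exact_mod_cast Finset.card_le_card (hV s hs)
      rw [hMdef, div_le_div_iff₀ (by positivity) (by positivity), hN]
      push_cast
      nlinarith [(Nat.cast_nonneg m : (0 : ℝ) ≤ m)]
    choose! w hwL hwb using fun (i : ℕ) (hi : i ∈ (L.map b).toFinset) =>
      List.mem_map.mp (List.mem_toFinset.mp hi)
    let col : ℕ → Fin (d + 1) := fun i =>
      if hi : w i ∈ spaceOf K then colour (g ⟨w i, hi⟩) else 0
    have hinj : Set.InjOn col (L.map b).toFinset := by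
      intro i hi j hj hij
      have hi' := hLK _ (hwL i hi)
      have hj' := hLK _ (hwL j hj)
      simp only [col, hi', hj', dif_pos] at hij
      have h3 := hcolour _ _ (hm 0 0 ⟨w i, hi'⟩ ⟨w j, hj'⟩ (by simp; positivity)
        (hLd _ (hwL i hi) _ (hwL j hj))) hij
      rw [← hwb i hi, ← hwb j hj]
      simp only [hb, hi', hj', dif_pos]
      rw [show g ⟨w i, hi'⟩ = g ⟨w j, hj'⟩ from h3]
    have h4 := Finset.card_le_card_of_injOn (t := Finset.univ) col (fun _ _ => by simp) hinj
    rw [Finset.card_univ, Fintype.card_fin] at h4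
    simp only [Set.mem_ofPred_eq, List.length_map, hL1]
    omega
  rw [h1] at h2
  simp at h2

/-- A space that is dominated up to homotopy by a contractible space is contractible. -/
lemma contractibleSpace_of_dominated {E Y : Type*} [TopologicalSpace E] [TopologicalSpace Y]
    [ContractibleSpace Y] {A : Set E} {f : A → Y} (hf : Continuous f) {g : Y → A}
    (hg : Continuous g) {G : unitInterval × A → E} (hG : Continuous G) (hGA : ∀ z, G z ∈ A)
    (h0 : ∀ x, G (0, x) = x) (h1 : ∀ x, G (1, x) = g (f x)) : ContractibleSpace A := by
  rw [contractible_iff_id_nullhomotopic]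
  have hn : (ContinuousMap.comp ⟨g, hg⟩ ⟨f, hf⟩ : C(A, A)).Nullhomotopic := by
    have := ((id_nullhomotopic Y).comp_left (⟨f, hf⟩ : C(A, Y))).comp_right (⟨g, hg⟩ : C(Y, A))
    simpa using this
  obtain ⟨a, ha⟩ := hn
  refine ⟨a, ContinuousMap.Homotopic.trans ?_ ha⟩
  exact ⟨{
    toFun := fun z => ⟨G z, hGA z⟩
    continuous_toFun := hG.subtype_mk _
    map_zero_left := fun x => Subtype.ext (h0 x)
    map_one_left := fun x => Subtype.ext (h1 x) }⟩

lemma contractibleSpace_of_leftInverse {E Y : Type*} [TopologicalSpace E] [TopologicalSpace Y]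
    [ContractibleSpace Y] {A : Set E} {f : A → Y} (hf : Continuous f) {g : Y → A}
    (hg : Continuous g) (h : ∀ x, g (f x) = x) : ContractibleSpace A :=
  contractibleSpace_of_dominated hf hg (G := fun z => z.2) (by fun_prop) (fun z => z.2.2)
    (fun _ => rfl) (fun x => by rw [h])

lemma contractibleSpace_punctured {E F : Type*} [TopologicalSpace E] [TopologicalSpace F]
    {X : Set E} {Y : Set F} (h : X ≃ₜ Y) (p : X)
    [ContractibleSpace ↥(Y \ {(h p : F)})] : ContractibleSpace ↥(X \ {(p : E)}) := by
  have hf : ∀ x : ↥(X \ {(p : E)}), (h ⟨x, x.2.1⟩ : F) ∈ Y \ {(h p : F)} := fun x =>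
    ⟨(h _).2, fun hx => x.2.2 (congrArg Subtype.val (h.injective (Subtype.ext hx)))⟩
  have hg : ∀ y : ↥(Y \ {(h p : F)}), (h.symm ⟨y, y.2.1⟩ : E) ∈ X \ {(p : E)} := by
    refine fun y => ⟨(h.symm _).2, fun hy => y.2.2 ?_⟩
    have : h.symm ⟨y, y.2.1⟩ = p := Subtype.ext hy
    exact (congrArg Subtype.val (h.apply_symm_apply ⟨y, y.2.1⟩)).symm.trans
      (congrArg (fun x => (h x : F)) this)
  have hfc : Continuous fun x : ↥(X \ {(p : E)}) => (h ⟨x, x.2.1⟩ : F) :=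
    continuous_subtype_val.comp (h.continuous.comp (continuous_subtype_val.subtype_mk _))
  have hgc : Continuous fun y : ↥(Y \ {(h p : F)}) => (h.symm ⟨y, y.2.1⟩ : E) :=
    continuous_subtype_val.comp (h.symm.continuous.comp (continuous_subtype_val.subtype_mk _))
  exact contractibleSpace_of_leftInverse (hfc.subtype_mk hf) (hgc.subtype_mk hg)
    (fun x => by simp)

section Ball

variable {E : Type*} [NormedAddCommGroup E] [NormedSpace ℝ E]

lemma contractibleSpace_closedBall_diff_of_norm_eq {q : E} (hq : ‖q‖ = 1) :
    ContractibleSpace ↥(Metric.closedBall (0 : E) 1 \ {q}) := by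
  have h0 : (0 : E) ∈ Metric.closedBall (0 : E) 1 \ {q} := by
    refine ⟨by simp, fun h => ?_⟩
    rw [← Set.mem_singleton_iff.mp h, norm_zero] at hq
    exact zero_ne_one hq
  refine StarConvex.contractibleSpace (x := 0) ?_ ⟨0, h0⟩
  rintro y ⟨hy, hyq⟩ a b ha hb hab
  rw [mem_closedBall_zero_iff] at hy
  have hn : ‖a • (0 : E) + b • y‖ = b * ‖y‖ := by
    rw [smul_zero, zero_add, norm_smul, Real.norm_of_nonneg hb]
  refine ⟨?_, fun h => hyq ?_⟩
  · rw [mem_closedBall_zero_iff, hn]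
    nlinarith [norm_nonneg y]
  · have h := Set.mem_singleton_iff.mp h
    rw [h, hq] at hn
    have hb1 : b = 1 := by nlinarith [norm_nonneg y]
    rw [Set.mem_singleton_iff, ← h, hb1]
    simp

/-- The radial projection onto the sphere of radius `ε` about `q` after translation from `p`. -/
noncomputable def radial (p q : E) (ε : ℝ) (x : E) : E := q + (ε / ‖x - p‖) • (x - p)

lemma radial_sub {p q : E} {ε : ℝ} {x : E} : radial p q ε x - q = (ε / ‖x - p‖) • (x - p) := by
  simp [radial]

lemma norm_radial_sub {p q : E} {ε : ℝ} (hε : 0 ≤ ε) {x : E} (hx : x ≠ p) :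
    ‖radial p q ε x - q‖ = ε := by
  have : ‖x - p‖ ≠ 0 := by simpa [sub_eq_zero] using hx
  rw [radial_sub, norm_smul, norm_div, norm_norm, Real.norm_of_nonneg hε, div_mul_cancel₀ _ this]

lemma radial_mem {p q : E} (hq : ‖q‖ < 1) {x : E} (hx : x ≠ p) :
    radial p q (1 - ‖q‖) x ∈ Metric.closedBall (0 : E) 1 \ {q} := by
  have h := norm_radial_sub (q := q) (sub_pos.mpr hq).le hx
  refine ⟨?_, fun h' => ?_⟩
  · rw [mem_closedBall_zero_iff]
    have := norm_le_norm_add_norm_sub' (radial p q (1 - ‖q‖) x) q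
    linarith
  · rw [Set.mem_singleton_iff.mp h', sub_self, norm_zero] at h
    linarith

lemma continuous_radial (p q : E) (ε : ℝ) {A : Set E} (hA : p ∉ A) :
    Continuous fun x : A => radial p q ε x := by
  unfold radial
  have : ∀ x : A, ‖(x : E) - p‖ ≠ 0 := fun x h => hA (by
    rw [norm_eq_zero, sub_eq_zero] at h
    exact h ▸ x.2)
  fun_prop (disch := assumption)

lemma contractibleSpace_closedBall_diff_of_norm_lt {p q : E} (hp : ‖p‖ < 1) (hq : ‖q‖ < 1)
    [ContractibleSpace ↥(Metric.closedBall (0 : E) 1 \ {q})] :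
    ContractibleSpace ↥(Metric.closedBall (0 : E) 1 \ {p}) := by
  set δ := 1 - ‖p‖ with hδ
  set ε := 1 - ‖q‖ with hε
  have hδ0 : 0 < δ := sub_pos.mpr hp
  have hε0 : 0 < ε := sub_pos.mpr hq
  have hpn : p ∉ Metric.closedBall (0 : E) 1 \ {p} := by simp
  have hqn : q ∉ Metric.closedBall (0 : E) 1 \ {q} := by simp
  refine contractibleSpace_of_dominated (Y := ↥(Metric.closedBall (0 : E) 1 \ {q}))
    (f := fun x => ⟨radial p q ε x, radial_mem hq x.2.2⟩)
    (g := fun y => ⟨radial q p δ y, radial_mem hp y.2.2⟩)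
    (G := fun z => (1 - (z.1 : ℝ)) • (z.2 : E) + (z.1 : ℝ) • radial p p δ z.2)
    ((continuous_radial p q ε hpn).subtype_mk _) ((continuous_radial q p δ hqn).subtype_mk _)
    ?_ ?_ ?_ ?_
  · have := (continuous_radial p p δ hpn).comp
      (continuous_snd (X := unitInterval) (Y := ↥(Metric.closedBall (0 : E) 1 \ {p})))
    simp only [Function.comp_def] at this
    fun_prop
  · rintro ⟨t, x, hx, hxp⟩
    have hxp : x ≠ p := hxp
    refine ⟨convex_closedBall 0 1 hx (radial_mem hp hxp).1 (sub_nonneg.mpr t.2.2) t.2.1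
      (by ring), fun h => ?_⟩
    have h := Set.mem_singleton_iff.mp h
    have hpos : 0 < ‖x - p‖ := norm_pos_iff.mpr (sub_ne_zero.mpr hxp)
    have h1 : ((1 - (t : ℝ)) + t * (δ / ‖x - p‖)) • (x - p) = 0 := by
      rw [← sub_eq_zero] at h
      rw [← h, radial, add_smul, mul_smul, smul_add, sub_smul, sub_smul, one_smul, one_smul,
        smul_sub (t : ℝ) x p]
      abel
    rcases smul_eq_zero.mp h1 with h2 | h2
    · have h3 : 0 < δ / ‖x - p‖ := by positivity
      have h4 := t.2.1
      have h5 := t.2.2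
      rcases h4.eq_or_lt with h6 | h6
      · rw [← h6] at h2; norm_num at h2
      · nlinarith [mul_pos h6 h3]
    · exact hxp (sub_eq_zero.mp h2)
  · intro x; simp
  · intro x
    have hxp : (x : E) ≠ p := x.2.2
    have hpos : ‖(x : E) - p‖ ≠ 0 := norm_ne_zero_iff.mpr (sub_ne_zero.mpr hxp)
    simp only [Set.Icc.coe_one, sub_self, zero_smul, one_smul, zero_add]
    have h1 : radial q p δ (radial p q ε x) = p + (δ / ε) • (radial p q ε x - q) := by
      conv_lhs => rw [radial]
      rw [norm_radial_sub hε0.le hxp]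
    rw [h1, radial_sub, smul_smul, radial]
    congr 2
    field_simp

lemma contractibleSpace_sphere_diff {q : E} (hq : ‖q‖ = 1) :
    ContractibleSpace ↥(Metric.sphere (0 : E) 1 \ {q}) := by
  have hq' : -q ∈ Metric.sphere (0 : E) 1 \ {q} := by
    refine ⟨by simpa using hq, fun h => ?_⟩
    have h1 : (2 : ℝ) • q = 0 := by
      rw [two_smul]
      nth_rewrite 1 [← Set.mem_singleton_iff.mp h]
      simp
    rw [(smul_eq_zero.mp h1).resolve_left two_ne_zero, norm_zero] at hq
    exact zero_ne_one hq
  let w : unitInterval × ↥(Metric.sphere (0 : E) 1 \ {q}) → E :=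
    fun z => (1 - (z.1 : ℝ)) • (z.2 : E) - (z.1 : ℝ) • q
  have hw : ∀ z, ∀ c : ℝ, 0 ≤ c → w z ≠ c • q := by
    rintro ⟨t, x, hx, hxq⟩ c hc h
    have hx1 : ‖x‖ = 1 := by simpa using hx
    have h1 : (1 - (t : ℝ)) • x = (c + t) • q := by
      rw [add_smul, ← h]; simp [w]
    have h2 := congrArg norm h1
    rw [norm_smul, norm_smul, hx1, hq, Real.norm_of_nonneg (sub_nonneg.mpr t.2.2),
      Real.norm_of_nonneg (add_nonneg hc t.2.1), mul_one, mul_one] at h2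
    rw [← h2] at h1
    rcases eq_or_ne (1 - (t : ℝ)) 0 with h3 | h3
    · linarith
    · exact hxq (smul_right_injective E h3 h1)
  have hw0 : ∀ z, ‖w z‖ ≠ 0 := fun z h => hw z 0 le_rfl (by rw [norm_eq_zero.mp h, zero_smul])
  have hwc : Continuous w := by fun_prop
  refine contractibleSpace_of_dominated (Y := Unit) (f := fun _ => ()) (g := fun _ => ⟨-q, hq'⟩)
    (G := fun z => ‖w z‖⁻¹ • w z) (by fun_prop) (by fun_prop) ?_ ?_ ?_ ?_
  · exact (hwc.norm.inv₀ hw0).smul hwc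
  · intro z
    refine ⟨?_, fun h => ?_⟩
    · rw [mem_sphere_zero_iff_norm, norm_smul, norm_inv, norm_norm, inv_mul_cancel₀ (hw0 z)]
    · refine hw z ‖w z‖ (norm_nonneg _) ?_
      rw [← Set.mem_singleton_iff.mp h, smul_smul, mul_inv_cancel₀ (hw0 z), one_smul]
  · rintro ⟨x, hx, hxq⟩
    have hx1 : ‖x‖ = 1 := by simpa using hx
    simp [w, hx1]
  · intro x
    simp [w, hq]

end Ball

lemma mem_face_of_sum_eq_one {s V : Finset ℕ} {x : ℕ → ℝ} (hsV : s ⊆ V) (h0 : ∀ i, 0 ≤ x i)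
    (h1 : ∀ i, x i ≠ 0 → i ∈ s) (h2 : ∑ i ∈ V, x i = 1) : x ∈ face s := by
  refine ⟨h0, h1, ?_⟩
  rw [← h2]
  exact Finset.sum_subset hsV fun i _ hi => by_contra fun h => hi (h1 i h)

/-- The barycenter of the simplex on `s`. -/
noncomputable def bary (s : Finset ℕ) : ℕ → ℝ := fun i => if i ∈ s then 1 / (s.card : ℝ) else 0

lemma bary_ne_zero {s : Finset ℕ} {i : ℕ} : bary s i ≠ 0 ↔ i ∈ s := by
  unfold bary
  split_ifs with h
  · have : (s.card : ℝ) ≠ 0 := by exact_mod_cast (Finset.card_pos.mpr ⟨i, h⟩).ne'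
    simpa [h] using Finset.ne_empty_of_mem h
  · simp [h]

lemma bary_mem_face {s : Finset ℕ} (hs : s.Nonempty) : bary s ∈ face s := by
  refine ⟨fun i => ?_, fun i hi => bary_ne_zero.mp hi, ?_⟩
  · unfold bary; positivity
  · have : (s.card : ℝ) ≠ 0 := by exact_mod_cast hs.card_pos.ne'
    rw [Finset.sum_congr rfl (g := fun _ => 1 / (s.card : ℝ)) fun i hi => by simp [bary, hi]]
    simp [this]

section MinCoord

variable {σ : Finset ℕ} (hσ : σ.Nonempty)

/-- The smallest barycentric coordinate of `x` on `σ`. -/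
noncomputable def minCoord (x : ℕ → ℝ) : ℝ := σ.inf' hσ x

lemma minCoord_le (x : ℕ → ℝ) {i : ℕ} (hi : i ∈ σ) : minCoord hσ x ≤ x i := Finset.inf'_le x hi

lemma exists_eq_minCoord (x : ℕ → ℝ) : ∃ i ∈ σ, minCoord hσ x = x i :=
  Finset.exists_mem_eq_inf' hσ x

lemma minCoord_nonneg {x : ℕ → ℝ} (hx : ∀ i, 0 ≤ x i) : 0 ≤ minCoord hσ x := by
  obtain ⟨i, -, h⟩ := exists_eq_minCoord hσ x
  rw [h]; exact hx i

lemma continuous_minCoord : Continuous (minCoord hσ) :=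
  Continuous.finset_inf'_apply hσ fun i _ => continuous_apply i

lemma minCoord_eq_zero {x : ℕ → ℝ} {s : Finset ℕ} (hx : x ∈ face s) (h : ¬ σ ⊆ s) :
    minCoord hσ x = 0 := by
  obtain ⟨i, hi, his⟩ := Finset.not_subset.mp h
  refine le_antisymm ((minCoord_le hσ x hi).trans_eq ?_) (minCoord_nonneg hσ hx.1)
  by_contra h'
  exact his (hx.2.1 i h')

lemma sum_indicator_eq_card {V : Finset ℕ} (h : σ ⊆ V) :
    ∑ i ∈ V, (if i ∈ σ then (1 : ℝ) else 0) = σ.card := by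
  rw [Finset.sum_ite_mem, Finset.inter_eq_right.mpr h]
  simp

lemma card_mul_minCoord_lt_one {x : ℕ → ℝ} {s : Finset ℕ} (hx : x ∈ face s) (hne : x ≠ bary σ) :
    (σ.card : ℝ) * minCoord hσ x < 1 := by
  have hx' := face_mono (Finset.subset_union_left (s₁ := s) (s₂ := σ)) hx
  have hc : (0 : ℝ) < σ.card := by exact_mod_cast hσ.card_pos
  have h1 : ∑ i ∈ σ, x i ≤ 1 := by
    rw [← hx'.2.2]
    exact Finset.sum_le_sum_of_subset_of_nonneg Finset.subset_union_right fun i _ _ => hx.1 i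
  have h2 : (σ.card : ℝ) * minCoord hσ x ≤ ∑ i ∈ σ, x i := by
    rw [← nsmul_eq_mul]
    exact Finset.card_nsmul_le_sum _ _ _ fun i hi => minCoord_le hσ x hi
  by_contra! h
  refine hne (funext fun i => ?_)
  have h3 : ∑ i ∈ σ, x i = 1 := by linarith
  have h4 : ∑ i ∈ σ, (x i - minCoord hσ x) = 0 := by
    rw [Finset.sum_sub_distrib, Finset.sum_const, nsmul_eq_mul]
    linarith
  have h5 := (Finset.sum_eq_zero_iff_of_nonneg fun i hi =>
    sub_nonneg.mpr (minCoord_le hσ x hi)).mp h4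
  by_cases hi : i ∈ σ
  · have h6 := h5 i hi
    simp only [bary, hi, if_true]
    rw [eq_div_iff hc.ne']
    have h7 : (σ.card : ℝ) * minCoord hσ x = 1 := by linarith
    rw [sub_eq_zero.mp h6, mul_comm, h7]
  · simp only [bary, hi, if_false]
    by_contra h6
    have h7 : insert i σ ⊆ s ∪ σ := Finset.insert_subset
      (Finset.mem_union_left _ (hx.2.1 i h6)) Finset.subset_union_right
    have h8 := Finset.sum_le_sum_of_subset_of_nonneg (f := x) h7 fun i _ _ => hx.1 i
    rw [Finset.sum_insert hi, h3, hx'.2.2] at h8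
    exact h6 (le_antisymm (by linarith) (hx.1 i))

/-- Projection away from the barycenter of `σ`. -/
noncomputable def awayFrom (x : ℕ → ℝ) : ℕ → ℝ := fun i =>
  (x i - minCoord hσ x * (if i ∈ σ then 1 else 0)) / (1 - σ.card * minCoord hσ x)

lemma awayFrom_mem {K : Set (Finset ℕ)} (hK : IsComplex K) {x : ℕ → ℝ} (hx : x ∈ spaceOf K)
    (hne : x ≠ bary σ) : awayFrom hσ x ∈ spaceOf (antistar K σ) := by
  obtain ⟨s, hs, hxs⟩ := mem_spaceOf.mp hx
  have hD : 0 < 1 - (σ.card : ℝ) * minCoord hσ x :=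
    sub_pos.mpr (card_mul_minCoord_lt_one hσ hxs hne)
  obtain ⟨v, hv, hvx⟩ := exists_eq_minCoord hσ x
  refine mem_spaceOf.mpr ⟨s.erase v, ⟨hK s hs _ (Finset.erase_subset v s),
    fun h => Finset.notMem_erase v s (h hv)⟩, ?_⟩
  refine mem_face_of_sum_eq_one (V := s ∪ σ)
    ((Finset.erase_subset v s).trans Finset.subset_union_left) (fun i => ?_) (fun i hi => ?_) ?_
  · refine div_nonneg ?_ hD.le
    split_ifs with h
    · have := minCoord_le hσ x h
      linarith
    · simpa using hxs.1 i
  · refine Finset.mem_erase.mpr ⟨?_, ?_⟩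
    · rintro rfl
      simp [awayFrom, hv, hvx] at hi
    · by_contra his
      have hxi : x i = 0 := by_contra fun h => his (hxs.2.1 i h)
      by_cases hiσ : i ∈ σ
      · have h1 := minCoord_eq_zero hσ hxs fun h => his (h hiσ)
        simp [awayFrom, hxi, h1] at hi
      · simp [awayFrom, hxi, hiσ] at hi
  · have hx' := face_mono (Finset.subset_union_left (s₁ := s) (s₂ := σ)) hxs
    unfold awayFrom
    rw [← Finset.sum_div, Finset.sum_sub_distrib, ← Finset.mul_sum, hx'.2.2,
      sum_indicator_eq_card Finset.subset_union_right, mul_comm]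
    exact div_self hD.ne'

lemma contractibleSpace_antistar {σ : Finset ℕ} (hσ : σ.Nonempty)
    {K : Set (Finset ℕ)} (hK : IsComplex K) [ContractibleSpace ↥(spaceOf K \ {bary σ})] :
    ContractibleSpace ↥(spaceOf (antistar K σ)) := by
  have hf : ∀ x : ↥(spaceOf (antistar K σ)), (x : ℕ → ℝ) ∈ spaceOf K \ {bary σ} := by
    rintro ⟨x, hx⟩
    obtain ⟨t, ht, hxt⟩ := mem_spaceOf.mp hx
    refine ⟨mem_spaceOf.mpr ⟨t, ht.1, hxt⟩, ?_⟩
    rintro rfl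
    exact ht.2 fun i hi => hxt.2.1 i (bary_ne_zero.mpr hi)
  have hgc : Continuous fun x : ↥(spaceOf K \ {bary σ}) => awayFrom hσ x := by
    refine continuous_pi fun i => ?_
    have hm : Continuous fun x : ↥(spaceOf K \ {bary σ}) => minCoord hσ x :=
      (continuous_minCoord hσ).comp continuous_subtype_val
    refine Continuous.div (((continuous_apply i).comp continuous_subtype_val).sub
      (hm.mul continuous_const)) (continuous_const.sub (continuous_const.mul hm)) fun x => ?_
    obtain ⟨s, -, hxs⟩ := mem_spaceOf.mp x.2.1
    exact (sub_pos.mpr (card_mul_minCoord_lt_one hσ hxs x.2.2)).ne'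
  refine contractibleSpace_of_leftInverse (continuous_subtype_val.subtype_mk hf)
    (hgc.subtype_mk fun x => awayFrom_mem hσ hK x.2.1 x.2.2) ?_
  rintro ⟨x, hx⟩
  obtain ⟨t, ht, hxt⟩ := mem_spaceOf.mp hx
  ext i
  simp [awayFrom, minCoord_eq_zero hσ hxt ht.2]

/-- Moving weight from `ρ` to the vertex `w`. -/
noncomputable def slide {ρ : Finset ℕ} (hρ : ρ.Nonempty) (w : ℕ) (t : ℝ) (x : ℕ → ℝ) : ℕ → ℝ :=
  fun i => x i - t * minCoord hρ x * (if i ∈ ρ then 1 else 0) +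
    t * minCoord hρ x * (if i = w then ρ.card else 0)

lemma slide_mem {K : Set (Finset ℕ)} {ρ : Finset ℕ} (hρ : ρ.Nonempty) {w : ℕ}
    (hwK : insert w ρ ∈ K) (hfree : ∀ t ∈ K, ρ ⊆ t → t ⊆ insert w ρ) {t : ℝ} (h0 : 0 ≤ t)
    (h1 : t ≤ 1) {x : ℕ → ℝ} (hx : x ∈ spaceOf K) : slide hρ w t x ∈ spaceOf K := by
  obtain ⟨s, hs, hxs⟩ := mem_spaceOf.mp hx
  by_cases hρs : ρ ⊆ s
  · have hxF := face_mono (hfree s hs hρs) hxs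
    have hm := minCoord_nonneg hρ hxs.1
    refine mem_spaceOf.mpr ⟨_, hwK, fun i => ?_, fun i hi => ?_, ?_⟩
    · refine add_nonneg ?_ (mul_nonneg (mul_nonneg h0 hm) (by split_ifs <;> positivity))
      split_ifs with hi
      · have := minCoord_le hρ x hi
        nlinarith
      · simpa using hxs.1 i
    · by_contra hiF
      have hxi : x i = 0 := by_contra fun h => hiF (hxF.2.1 i h)
      simp only [Finset.mem_insert, not_or] at hiF
      simp [slide, hxi, hiF.1, hiF.2] at hi
    · unfold slide
      rw [Finset.sum_add_distrib, Finset.sum_sub_distrib, ← Finset.mul_sum, ← Finset.mul_sum,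
        hxF.2.2, sum_indicator_eq_card (Finset.subset_insert w ρ)]
      simp
  · have : slide hρ w t x = x := by
      ext i
      simp [slide, minCoord_eq_zero hρ hxs hρs]
    rwa [this]

lemma mul_minCoord_eq_zero_of_slide_eq {ρ : Finset ℕ} (hρ : ρ.Nonempty) {w : ℕ} (hw : w ∉ ρ)
    {t : ℝ} (h0 : 0 ≤ t) {x : ℕ → ℝ} (hx : ∀ i, 0 ≤ x i) (h : slide hρ w t x = bary ρ) :
    t * minCoord hρ x = 0 := by
  have h1 := congrFun h w
  simp only [slide, hw, bary, if_false, mul_zero, sub_zero, if_true] at h1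
  have hc : (0 : ℝ) < ρ.card := by exact_mod_cast hρ.card_pos
  have h2 := mul_nonneg h0 (minCoord_nonneg hρ hx)
  have h3 := hx w
  by_contra h4
  have := mul_pos (lt_of_le_of_ne h2 (Ne.symm h4)) hc
  linarith

lemma contractibleSpace_diff_bary_of_free {K : Set (Finset ℕ)} {ρ : Finset ℕ} (hρ : ρ.Nonempty)
    {w : ℕ} (hw : w ∉ ρ) (hwK : insert w ρ ∈ K) (hfree : ∀ t ∈ K, ρ ⊆ t → t ⊆ insert w ρ)
    [ContractibleSpace (spaceOf K)] : ContractibleSpace ↥(spaceOf K \ {bary ρ}) := by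
  have hpos : ∀ x ∈ spaceOf K, ∀ i, 0 ≤ x i := fun x hx => hx.1
  have hg : ∀ x : spaceOf K, slide hρ w 1 x ∈ spaceOf K \ {bary ρ} := by
    refine fun x => ⟨slide_mem hρ hwK hfree zero_le_one le_rfl x.2, fun h => ?_⟩
    have h1 := mul_minCoord_eq_zero_of_slide_eq hρ hw zero_le_one (hpos x x.2) h
    have h1' : minCoord hρ x = 0 := by simpa using h1
    have h2 : slide hρ w 1 x = x := by ext i; simp [slide, h1']
    have h3 : (x : ℕ → ℝ) = bary ρ := h2.symm.trans h
    obtain ⟨i, hi, him⟩ := exists_eq_minCoord hρ (x : ℕ → ℝ)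
    rw [one_mul, him, h3] at h1
    exact bary_ne_zero.mpr hi h1
  have hc : Continuous fun z : ℝ × (ℕ → ℝ) => slide hρ w z.1 z.2 := by
    refine continuous_pi fun i => ?_
    have hm : Continuous fun z : ℝ × (ℕ → ℝ) => minCoord hρ z.2 :=
      (continuous_minCoord hρ).comp continuous_snd
    unfold slide
    fun_prop
  refine contractibleSpace_of_dominated (Y := spaceOf K) (f := fun x => ⟨x, x.2.1⟩)
    (g := fun x => ⟨_, hg x⟩) (G := fun z => slide hρ w z.1 z.2)
    (continuous_subtype_val.subtype_mk _) ?_ ?_ ?_ ?_ ?_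
  · exact (hc.comp (continuous_const.prodMk continuous_subtype_val)).subtype_mk _
  · exact hc.comp ((continuous_subtype_val.comp continuous_fst).prodMk
      (continuous_subtype_val.comp continuous_snd))
  · rintro ⟨t, x, hx, hne⟩
    refine ⟨slide_mem hρ hwK hfree t.2.1 t.2.2 hx, fun h => hne ?_⟩
    have h1 := mul_minCoord_eq_zero_of_slide_eq hρ hw t.2.1 (hpos x hx) h
    have h2 : slide hρ w t x = x := by ext i; simp [slide, h1]
    exact h2.symm.trans h
  · intro x
    ext i
    simp [slide]
  · intro x
    rfl

end MinCoord

/-- Rescaling barycentric coordinates. -/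
noncomputable def rescale (V : Finset ℕ) (c x : ℕ → ℝ) : ℕ → ℝ :=
  fun i => c i * x i / ∑ j ∈ V, c j * x j

section Rescale

variable {V : Finset ℕ} {K : Set (Finset ℕ)}

lemma sum_eq_one_of_mem_spaceOf (hV : ∀ s ∈ K, s ⊆ V) {x : ℕ → ℝ} (hx : x ∈ spaceOf K) :
    ∑ j ∈ V, x j = 1 := by
  obtain ⟨s, hs, hxs⟩ := mem_spaceOf.mp hx
  exact (face_mono (hV s hs) hxs).2.2

lemma sum_mul_pos (hV : ∀ s ∈ K, s ⊆ V) {c : ℕ → ℝ} (hc : ∀ i, 0 < c i)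
    {x : ℕ → ℝ} (hx : x ∈ spaceOf K) :
    0 < ∑ j ∈ V, c j * x j := by
  refine (Finset.sum_nonneg fun j _ => mul_nonneg (hc j).le (hx.1 j)).lt_of_ne fun h => ?_
  have h1 := (Finset.sum_eq_zero_iff_of_nonneg
    fun j _ => mul_nonneg (hc j).le (hx.1 j)).mp h.symm
  have h2 : ∑ j ∈ V, x j = 0 := Finset.sum_eq_zero fun j hj =>
    (mul_eq_zero.mp (h1 j hj)).resolve_left (hc j).ne'
  rw [sum_eq_one_of_mem_spaceOf hV hx] at h2
  exact one_ne_zero h2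

lemma rescale_mem (hV : ∀ s ∈ K, s ⊆ V) {c : ℕ → ℝ} (hc : ∀ i, 0 < c i)
    {x : ℕ → ℝ} (hx : x ∈ spaceOf K) :
    rescale V c x ∈ spaceOf K := by
  have hS := sum_mul_pos hV hc hx
  obtain ⟨s, hs, hxs⟩ := mem_spaceOf.mp hx
  refine mem_spaceOf.mpr ⟨s, hs, mem_face_of_sum_eq_one (hV s hs)
    (fun i => div_nonneg (mul_nonneg (hc i).le (hx.1 i)) hS.le) (fun i hi => ?_) ?_⟩
  · refine hxs.2.1 i fun h => hi ?_
    simp [rescale, h]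
  · unfold rescale
    rw [← Finset.sum_div, div_self hS.ne']

lemma rescale_rescale (hV : ∀ s ∈ K, s ⊆ V) {c c' : ℕ → ℝ} (hc : ∀ i, 0 < c i)
    (hcc : ∀ i, c' i * c i = 1)
    {x : ℕ → ℝ} (hx : x ∈ spaceOf K) : rescale V c' (rescale V c x) = x := by
  have hS := sum_mul_pos hV hc hx
  have h1 : ∀ i, c' i * rescale V c x i = x i / ∑ j ∈ V, c j * x j := fun i => by
    unfold rescale
    rw [← mul_div_assoc, ← mul_assoc, hcc, one_mul]
  ext i
  unfold rescale at h1 ⊢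
  simp only [h1]
  rw [← Finset.sum_div, sum_eq_one_of_mem_spaceOf hV hx]
  field_simp

lemma contractibleSpace_diff_of_support_eq (hV : ∀ s ∈ K, s ⊆ V) {p q : ℕ → ℝ} (hp : p ∈ spaceOf K)
    (hq : q ∈ spaceOf K) (hpq : ∀ i, p i = 0 ↔ q i = 0) [ContractibleSpace ↥(spaceOf K \ {p})] :
    ContractibleSpace ↥(spaceOf K \ {q}) := by
  classical
  let c : ℕ → ℝ := fun i => if p i = 0 then 1 else q i / p i
  have hc : ∀ i, 0 < c i := by
    intro i
    by_cases h : p i = 0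
    · simp [c, h]
    · simp only [c, h, if_false]
      exact div_pos ((hq.1 i).lt_of_ne' (mt (hpq i).mpr h)) ((hp.1 i).lt_of_ne' h)
  have hc' : ∀ i, 0 < (c i)⁻¹ := fun i => inv_pos.mpr (hc i)
  have hcp : rescale V c p = q := by
    have h1 : ∀ i, c i * p i = q i := by
      intro i
      by_cases h : p i = 0
      · simp [h, (hpq i).mp h]
      · simp [c, h]
    ext i
    unfold rescale
    simp only [h1]
    rw [sum_eq_one_of_mem_spaceOf hV hq, div_one]
  have hinv : ∀ x ∈ spaceOf K, rescale V c (rescale V c⁻¹ x) = x := fun x hx =>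
    rescale_rescale hV hc' (fun i => mul_inv_cancel₀ (hc i).ne') hx
  have hinv' : ∀ x ∈ spaceOf K, rescale V c⁻¹ (rescale V c x) = x := fun x hx =>
    rescale_rescale hV hc (fun i => inv_mul_cancel₀ (hc i).ne') hx
  have hcont : ∀ r c : ℕ → ℝ, (∀ i, 0 < c i) →
      Continuous fun x : ↥(spaceOf K \ {r}) => rescale V c x := by
    intro r c hc
    have hx : ∀ i, Continuous fun x : ↥(spaceOf K \ {r}) => (x : ℕ → ℝ) i := fun i =>
      (continuous_apply i).comp continuous_subtype_val
    exact continuous_pi fun i => (continuous_const.mul (hx i)).div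
      (continuous_finsetSum _ fun j _ => continuous_const.mul (hx j))
      fun x => (sum_mul_pos hV hc x.2.1).ne'
  refine contractibleSpace_of_leftInverse (Y := ↥(spaceOf K \ {p}))
    ((hcont q c⁻¹ hc').subtype_mk fun x => ⟨rescale_mem hV hc' x.2.1, fun h => x.2.2 ?_⟩)
    ((hcont p c hc).subtype_mk fun x => ⟨rescale_mem hV hc x.2.1, fun h => x.2.2 ?_⟩)
    fun x => Subtype.ext (hinv x x.2.1)
  · have h := Set.mem_singleton_iff.mp h
    rw [Set.mem_singleton_iff, ← hinv x x.2.1, h, hcp]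
  · have h := Set.mem_singleton_iff.mp h
    rw [Set.mem_singleton_iff, ← hinv' x x.2.1, h, ← hcp, hinv' p hp]

end Rescale

lemma not_acyclic_antistar_of_maximal {K : Set (Finset ℕ)} (hK : IsComplex K) (h : Acyclic K)
    {σ : Finset ℕ} (hσ : σ ∈ K) (hmax : ∀ t ∈ K, σ ⊆ t → t = σ) : ¬ Acyclic (antistar K σ) := by
  intro ha
  have hσK : (Finsupp.single σ 1 : OChain) ∈ chains K := Finsupp.single_mem_supported ℝ _ hσ
  have herase : ∀ s ∈ K, ∀ v ∈ s, s.erase v ∈ antistar K σ := by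
    refine fun s hs v hv => ⟨hK s hs _ (Finset.erase_subset v s), fun h' => ?_⟩
    have := hmax s hs (h'.trans (Finset.erase_subset v s))
    subst this
    exact Finset.notMem_erase v s (h' hv)
  obtain ⟨w, hw, hbw⟩ := ha _ (bd_mem_chains 1 herase hσK) (bd_bd_self 1 _)
  obtain ⟨u, hu, hbu⟩ := h (Finsupp.single σ 1 - w)
    (Submodule.sub_mem _ hσK (chains_mono (fun t ht => ht.1) hw)) (by rw [map_sub, hbw, sub_self])
  have h0 : ∀ x ∈ chains (antistar K σ), x σ = 0 := fun x hx => by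
    by_contra hne
    exact ((Finsupp.mem_supported ℝ x).mp hx (Finsupp.mem_support_iff.mpr hne)).2 subset_rfl
  have h1 := h0 _ (bd_mem_chains 1 herase hu)
  rw [hbu, Finsupp.sub_apply, h0 w hw, Finsupp.single_eq_same, sub_zero] at h1
  exact one_ne_zero h1

lemma not_contractibleSpace_diff_bary_of_maximal {K : Set (Finset ℕ)} (hK : IsComplex K)
    (hf : K.Finite) [ContractibleSpace (spaceOf K)] {σ : Finset ℕ} (hσ : σ ∈ K)
    (hne : σ.Nonempty) (hmax : ∀ t ∈ K, σ ⊆ t → t = σ) :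
    ¬ ContractibleSpace ↥(spaceOf K \ {bary σ}) := by
  intro h
  have := contractibleSpace_antistar hne hK
  exact not_acyclic_antistar_of_maximal hK (acyclic_of_contractible hK hf) hσ hmax
    (acyclic_of_contractible (hK.isComplex_antistar σ) (hf.subset fun t ht => ht.1))

/-- The faces all of whose points can be removed from the realization without destroying its
contractibility. -/
def removableFaces (K : Set (Finset ℕ)) : Set (Finset ℕ) :=
  {s ∈ K | ∀ x ∈ face s, ContractibleSpace ↥(spaceOf K \ {x})}

section Ball

variable {d : ℕ} {B : Set (Finset ℕ)}

lemma contractibleSpace_of_homeomorph_closedBall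
    (h : spaceOf B ≃ₜ Metric.closedBall (0 : EuclideanSpace ℝ (Fin d)) 1) :
    ContractibleSpace (spaceOf B) := by
  have : ContractibleSpace (Metric.closedBall (0 : EuclideanSpace ℝ (Fin d)) 1) :=
    (convex_closedBall _ _).contractibleSpace ⟨0, by simp⟩
  exact h.contractibleSpace

lemma contractibleSpace_diff_iff (hB : IsComplex B) (hf : B.Finite)
    (h : spaceOf B ≃ₜ Metric.closedBall (0 : EuclideanSpace ℝ (Fin d)) 1) (p : spaceOf B) :
    ContractibleSpace ↥(spaceOf B \ {(p : ℕ → ℝ)}) ↔ ‖(h p : EuclideanSpace ℝ (Fin d))‖ = 1 := by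
  have hcon := contractibleSpace_of_homeomorph_closedBall h
  have hle : ∀ x, ‖(h x : EuclideanSpace ℝ (Fin d))‖ ≤ 1 := fun x =>
    mem_closedBall_zero_iff.mp (h x).2
  have hsph : ∀ x : spaceOf B, ‖(h x : EuclideanSpace ℝ (Fin d))‖ = 1 →
      ContractibleSpace ↥(spaceOf B \ {(x : ℕ → ℝ)}) := fun x hx => by
    have := contractibleSpace_closedBall_diff_of_norm_eq hx
    exact contractibleSpace_punctured h x
  refine ⟨fun hp => ?_, hsph p⟩
  by_contra hne
  have hlt := (hle p).lt_of_ne hne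
  have hp' : ContractibleSpace ↥(Metric.closedBall (0 : EuclideanSpace ℝ (Fin d)) 1 \
      {(h p : EuclideanSpace ℝ (Fin d))}) := by
    have : ContractibleSpace ↥(spaceOf B \ {((h.symm (h p) : spaceOf B) : ℕ → ℝ)}) := by
      rwa [h.symm_apply_apply]
    exact contractibleSpace_punctured h.symm (h p)
  have hall : ∀ x : spaceOf B, ContractibleSpace ↥(spaceOf B \ {(x : ℕ → ℝ)}) := fun x => by
    rcases (hle x).lt_or_eq with hx | hx
    · have := contractibleSpace_closedBall_diff_of_norm_lt hx hlt
      exact contractibleSpace_punctured h x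
    · exact hsph x hx
  obtain ⟨s, hs, hps⟩ := mem_spaceOf.mp p.2
  obtain ⟨σ, hsσ, hσ⟩ := hf.exists_le_maximal hs
  have hsne : s.Nonempty := by
    by_contra h0
    have := hps.2.2
    simp [Finset.not_nonempty_iff_eq_empty.mp h0] at this
  have hσne := hsne.mono hsσ
  exact not_contractibleSpace_diff_bary_of_maximal hB hf hσ.prop hσne
    (fun t ht hst => (hσ.eq_of_le ht hst).symm)
    (hall ⟨bary σ, mem_spaceOf.mpr ⟨σ, hσ.prop, bary_mem_face hσne⟩⟩)

lemma removableFaces_subset (K : Set (Finset ℕ)) : removableFaces K ⊆ K := fun _ hs => hs.1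

lemma isComplex_removableFaces (hB : IsComplex B) : IsComplex (removableFaces B) :=
  fun s hs t ht => ⟨hB s hs.1 t ht, fun x hx => hs.2 x (face_mono ht hx)⟩

lemma mem_removableFaces_of_contractibleSpace (hB : IsComplex B) (hf : B.Finite)
    (h : spaceOf B ≃ₜ Metric.closedBall (0 : EuclideanSpace ℝ (Fin d)) 1) {s : Finset ℕ}
    (hs : s ∈ B) {x : ℕ → ℝ} (hx : x ∈ face s) (hxs : ∀ i ∈ s, x i ≠ 0)
    (hc : ContractibleSpace ↥(spaceOf B \ {x})) : s ∈ removableFaces B := by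
  obtain ⟨V, hV⟩ := exists_vertex_bound hf
  have hmem : ∀ y ∈ face s, y ∈ spaceOf B := fun y hy => mem_spaceOf.mpr ⟨s, hs, hy⟩
  refine ⟨hs, fun y hy => ?_⟩
  let t : ℕ → ℝ := fun n => 1 / ((n : ℝ) + 1)
  have ht0 : ∀ n, 0 < t n := fun n => by positivity
  have ht1 : ∀ n, t n ≤ 1 := fun n => by
    rw [div_le_one (by positivity)]
    linarith [(Nat.cast_nonneg n : (0 : ℝ) ≤ n)]
  let z : ℕ → ℕ → ℝ := fun n => (1 - t n) • y + t n • x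
  have hz : ∀ n, z n ∈ face s := fun n =>
    convex_face s hy hx (sub_nonneg.mpr (ht1 n)) (ht0 n).le (by ring)
  have hzc : ∀ n, ContractibleSpace ↥(spaceOf B \ {z n}) := fun n => by
    refine contractibleSpace_diff_of_support_eq hV (hmem x hx) (hmem _ (hz n)) fun i => ?_
    by_cases hi : i ∈ s
    · have h1 : 0 < x i := (hx.1 i).lt_of_ne' (hxs i hi)
      have h2 : 0 < z n i := add_pos_of_nonneg_of_pos
        (mul_nonneg (sub_nonneg.mpr (ht1 n)) (hy.1 i)) (mul_pos (ht0 n) h1)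
      exact iff_of_false h1.ne' h2.ne'
    · exact iff_of_true (by_contra fun h' => hi (hx.2.1 i h'))
        (by_contra fun h' => hi ((hz n).2.1 i h'))
  have hlim : Filter.Tendsto z Filter.atTop (nhds y) := by
    have h0 : Filter.Tendsto t Filter.atTop (nhds 0) := tendsto_one_div_add_atTop_nhds_zero_nat
    have := ((tendsto_const_nhds (x := (1 : ℝ))).sub h0).smul_const y |>.add (h0.smul_const x)
    simpa using this
  have hlim' : Filter.Tendsto (fun n => (⟨z n, hmem _ (hz n)⟩ : spaceOf B)) Filter.atTop
      (nhds ⟨y, hmem y hy⟩) := tendsto_subtype_rng.mpr hlim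
  have hnorm := ((continuous_norm.comp
    (continuous_subtype_val.comp h.continuous)).tendsto _).comp hlim'
  refine (contractibleSpace_diff_iff hB hf h ⟨y, hmem y hy⟩).mpr
    (tendsto_nhds_unique hnorm (tendsto_const_nhds.congr fun n => ?_))
  exact ((contractibleSpace_diff_iff hB hf h ⟨z n, hmem _ (hz n)⟩).mp (hzc n)).symm

lemma mem_spaceOf_removableFaces_iff (hB : IsComplex B) (hf : B.Finite)
    (h : spaceOf B ≃ₜ Metric.closedBall (0 : EuclideanSpace ℝ (Fin d)) 1) (x : spaceOf B) :
    (x : ℕ → ℝ) ∈ spaceOf (removableFaces B) ↔ ‖(h x : EuclideanSpace ℝ (Fin d))‖ = 1 := by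
  rw [← contractibleSpace_diff_iff hB hf h]
  constructor
  · intro hx
    obtain ⟨s, hs, hxs⟩ := mem_spaceOf.mp hx
    exact hs.2 x hxs
  · intro hc
    obtain ⟨s, hs, hxs⟩ := mem_spaceOf.mp x.2
    classical
    have hsub : s.filter (fun i => (x : ℕ → ℝ) i ≠ 0) ⊆ s := Finset.filter_subset _ _
    have hx' : (x : ℕ → ℝ) ∈ face (s.filter fun i => (x : ℕ → ℝ) i ≠ 0) :=
      mem_face_of_sum_eq_one hsub hxs.1
        (fun i hi => Finset.mem_filter.mpr ⟨hxs.2.1 i hi, hi⟩) hxs.2.2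
    exact mem_spaceOf.mpr ⟨_, mem_removableFaces_of_contractibleSpace hB hf h (hB s hs _ hsub) hx'
      (fun i hi => (Finset.mem_filter.mp hi).2) hc, hx'⟩

lemma contractibleSpace_removableFaces_diff (hB : IsComplex B) (hf : B.Finite)
    (h : spaceOf B ≃ₜ Metric.closedBall (0 : EuclideanSpace ℝ (Fin d)) 1) {p : ℕ → ℝ}
    (hp : p ∈ spaceOf (removableFaces B)) :
    ContractibleSpace ↥(spaceOf (removableFaces B) \ {p}) := by
  have hsub : ∀ x ∈ spaceOf (removableFaces B), x ∈ spaceOf B := fun x hx => by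
    obtain ⟨s, hs, hxs⟩ := mem_spaceOf.mp hx
    exact mem_spaceOf.mpr ⟨s, hs.1, hxs⟩
  have hiff := mem_spaceOf_removableFaces_iff hB hf h
  have hq := (hiff ⟨p, hsub p hp⟩).mp hp
  have := contractibleSpace_sphere_diff hq
  have hball : ∀ y ∈ Metric.sphere (0 : EuclideanSpace ℝ (Fin d)) 1, y ∈ Metric.closedBall 0 1 :=
    fun y hy => Metric.sphere_subset_closedBall hy
  have hg : ∀ y : ↥(Metric.sphere (0 : EuclideanSpace ℝ (Fin d)) 1 \
      {(h ⟨p, hsub p hp⟩ : EuclideanSpace ℝ (Fin d))}),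
      (h.symm ⟨y, hball y y.2.1⟩ : ℕ → ℝ) ∈ spaceOf (removableFaces B) \ {p} := by
    refine fun y => ⟨(hiff _).mpr ?_, fun hy => y.2.2 ?_⟩
    · simpa using y.2.1
    · have : h.symm ⟨y, hball y y.2.1⟩ = ⟨p, hsub p hp⟩ := Subtype.ext hy
      simp [← this]
  refine contractibleSpace_of_leftInverse
    (Y := ↥(Metric.sphere (0 : EuclideanSpace ℝ (Fin d)) 1 \
      {(h ⟨p, hsub p hp⟩ : EuclideanSpace ℝ (Fin d))}))
    (f := fun x => ⟨h ⟨x, hsub x x.2.1⟩, mem_sphere_zero_iff_norm.mpr ((hiff _).mp x.2.1),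
      fun hx => x.2.2 (congrArg Subtype.val (h.injective (Subtype.ext hx)))⟩)
    (g := fun y => ⟨_, hg y⟩) ?_ ?_ ?_
  · exact (continuous_subtype_val.comp (h.continuous.comp
      (continuous_subtype_val.subtype_mk _))).subtype_mk _
  · exact (continuous_subtype_val.comp (h.symm.continuous.comp
      (continuous_subtype_val.subtype_mk _))).subtype_mk _
  · intro x
    ext1
    simp

lemma bdry_subset_removableFaces (hd : 1 ≤ d) (hB : IsComplex B) (hf : B.Finite)
    (h : spaceOf B ≃ₜ Metric.closedBall (0 : EuclideanSpace ℝ (Fin d)) 1) :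
    bdry d B ⊆ removableFaces B := by
  rintro τ ⟨ρ, hρ, hτρ, hρd, F, ⟨hF, hFd, hρF⟩, huniq⟩
  refine isComplex_removableFaces hB ρ ?_ τ hτρ
  have := contractibleSpace_of_homeomorph_closedBall h
  have hne : ρ.Nonempty := Finset.card_pos.mp (by omega)
  obtain ⟨w, hw⟩ : ∃ w, F \ ρ = {w} := by
    rw [← Finset.card_eq_one, Finset.card_sdiff_of_subset hρF]
    omega
  have hwF : w ∈ F \ ρ := by simp [hw]
  rw [Finset.mem_sdiff] at hwF
  have hins : insert w ρ = F :=
    Finset.eq_of_subset_of_card_le (Finset.insert_subset hwF.1 hρF)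
      (by rw [Finset.card_insert_of_notMem hwF.2]; omega)
  refine mem_removableFaces_of_contractibleSpace hB hf h hρ (bary_mem_face hne)
    (fun i hi => bary_ne_zero.mpr hi)
    (contractibleSpace_diff_bary_of_free hne hwF.2 (hins.symm ▸ hF) fun t ht hρt => ?_)
  have h1 := card_le_of_homeomorph hf h ht
  have h2 := Finset.card_le_card hρt
  rw [hins]
  rcases (show t.card = d ∨ t.card = d + 1 by omega) with h3 | h3
  · rw [← Finset.eq_of_subset_of_card_le hρt (by omega)]
    exact hρF
  · exact (huniq t ⟨ht, h3, hρt⟩).subset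

lemma ballPair_removableFaces (hd : 1 ≤ d) (hB : IsComplex B) (hf : B.Finite)
    (h : spaceOf B ≃ₜ Metric.closedBall (0 : EuclideanSpace ℝ (Fin d)) 1) (h0 : ∅ ∈ bdry d B) :
    BallPair (d + 1) B (removableFaces B) := by
  have hcon := contractibleSpace_of_homeomorph_closedBall h
  have hD := isComplex_removableFaces hB
  have hDf := hf.subset (removableFaces_subset B)
  have hcard := fun s (hs : s ∈ B) => card_le_of_homeomorph hf h hs
  refine ⟨hB, hD, removableFaces_subset B, hcard, fun s hs => ?_, ?_,
    acyclic_of_contractible hB hf, fun s hs hne => ?_, fun s hs hne => ?_⟩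
  · refine (hcard s hs.1).lt_of_ne fun hsd => ?_
    have hne : s.Nonempty := Finset.card_pos.mp (by omega)
    exact not_contractibleSpace_diff_bary_of_maximal hB hf hs.1 hne
      (fun t ht hst => (Finset.eq_of_subset_of_card_le hst (hsd ▸ hcard t ht)).symm)
      (hs.2 _ (bary_mem_face hne))
  · obtain ⟨ρ, hρ, -, hρd, hF⟩ := h0
    exact ⟨ρ, bdry_subset_removableFaces hd hB hf h ⟨ρ, hρ, subset_rfl, hρd, hF⟩, by omega⟩
  · have := hs.2 _ (bary_mem_face hne)
    have := contractibleSpace_antistar hne hB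
    exact acyclic_of_contractible (hB.isComplex_antistar s) (hf.subset fun t ht => ht.1)
  · have := contractibleSpace_removableFaces_diff hB hf h
      (mem_spaceOf.mpr ⟨s, hs, bary_mem_face hne⟩)
    have := contractibleSpace_antistar hne hD
    exact acyclic_of_contractible (hD.isComplex_antistar s) (hDf.subset fun t ht => ht.1)

end Ball

/-- A `(k-1)`-stacked PL `(2k-1)`-ball with `n` vertices and exactly
`C(n-k-1, k-1)` facets is `(k-1)`-neighborly w.r.t. its vertex set. -/
theorem neighborly_of_facet_count (k n : ℕ) (hk : 1 ≤ k) (hn : 2 * k ≤ n)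
    (B : Set (Finset ℕ)) (hc : IsComplex B) (hfin : B.Finite)
    (hb : IsBall (2 * k - 1) B) (hst : IsStacked (k - 1) (2 * k - 1) B)
    (hv : (vertexSet B).ncard = n)
    (hfac : fnum B (2 * k) = Nat.choose (n - k - 1) (k - 1)) :
    Nbrly (k - 1) (vertexSet B) B := by
  obtain ⟨h⟩ := hb
  have h0 : ∅ ∈ B := by
    obtain ⟨s, hs, -⟩ := mem_spaceOf.mp (h.symm ⟨0, by simp⟩).2
    exact hc s hs ∅ (Finset.empty_subset s)
  rcases hk.eq_or_lt with rfl | hk2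
  · intro τ _ hτ
    rwa [Finset.card_eq_zero.mp (Nat.le_zero.mp hτ)]
  have hsub := bdry_subset_removableFaces (by omega) hc hfin h
  have hpair : BallPair (2 * k) B (removableFaces B) := by
    have := ballPair_removableFaces (by omega) hc hfin h
      (hst ∅ h0 (by rw [Finset.card_empty]; omega))
    rwa [Nat.sub_add_cancel (by omega)] at this
  have hvf : (vertexSet B).Finite := Set.finite_of_ncard_pos (by omega)
  have hV : hvf.toFinset.card = n := by rw [← hv, Set.ncard_eq_toFinset_card _ hvf]
  exact hpair.nbrly hk2 (fun s hs hsk => hsub (hst s hs (by omega))) hfin hvf.coe_toFinset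
    (hV ▸ hn) (hV ▸ hfac)
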